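/- arXiv:0711.2169 — 6 statements merged into one kernel-verified Lean document; each statement's English description precedes it below -/
import Mathlib

section
/- Let $X_n$ be a time-homogeneous Markov chain on $\mathbf{R}$ with transition kernel $P$, jump variables $\xi(x)$ and renewal measure $U$. Suppose: (i) the distributions of $\xi(x)$ converge weakly as $x\to\infty$ to the distribution $F$ of a random variable $\xi$ with $\mathbf{E}\xi>0$; (ii) there is a random variable $\eta$ with $\mathbf{E}\eta<\infty$ such that $|\xi(x)|\le_{\rm st}\eta$ for all $x\in\mathbf{R}$; (iii) $\sup_{k\in\mathbf{Z}}U(k,k+1]<\infty$; (iv) the limit $p_0=\lim_{n\to\infty}\mathbf{P}\{X_n>0\}$ exists. If $F$ is non-lattice, then for every fixed $h>0$, $U(x,x+h]\to p_0\, h/\mathbf{E}\xi$ as $x\to\infty$. -/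
open MeasureTheory ProbabilityTheory Filter Set

/-- The distribution of the Markov chain with transition kernel `P` and initial
distribution `μ0` at time `n`. -/
noncomputable def chainDist (P : Kernel ℝ ℝ) (μ0 : Measure ℝ) : ℕ → Measure ℝ
  | 0 => μ0
  | n + 1 => (chainDist P μ0 n).bind P

/-- The renewal measure `U(B) = ∑_{n≥0} P{X_n ∈ B}`. -/
noncomputable def renewalMeasure (P : Kernel ℝ ℝ) (μ0 : Measure ℝ) : Measure ℝ :=
  Measure.sum (chainDist P μ0)

/-- The law of the jump `ξ(x)` of the chain at state `x`. -/
noncomputable def jumpLaw (P : Kernel ℝ ℝ) (x : ℝ) : Measure ℝ :=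
  (P x).map (fun y => y - x)

/-! ## Part 1: an asymptotic Choquet-Deny lemma -/

lemma kr_int_bdd (F : Measure ℝ) [IsProbabilityMeasure F] {g : ℝ → ℝ} (hg : Measurable g)
    {c : ℝ} (hc : ∀ x, |g x| ≤ c) : Integrable g F :=
  Integrable.of_bound hg.aestronglyMeasurable c (Eventually.of_forall hc)

lemma kr_abs_int_le (F : Measure ℝ) [IsProbabilityMeasure F] {g : ℝ → ℝ}
    {c : ℝ} (hc : ∀ x, |g x| ≤ c) : |∫ s, g s ∂F| ≤ c := by
  have := norm_integral_le_of_norm_le_const (μ := F) (f := g) (C := c) (Eventually.of_forall hc)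
  simpa using this

lemma kr_Q_meas (F : Measure ℝ) [IsProbabilityMeasure F] {g : ℝ → ℝ → ℝ}
    (hg : Measurable (Function.uncurry g)) :
    Measurable (fun x => ∫ s, g x s ∂F) :=
  (hg.stronglyMeasurable.integral_prod_right (ν := F)).measurable

lemma kr_Q_tendsto (F : Measure ℝ) [IsProbabilityMeasure F] {g : ℝ → ℝ → ℝ}
    (hg : ∀ x, Measurable (g x)) {c : ℝ} (hc : ∀ x s, |g x s| ≤ c)
    (h0 : ∀ s, Tendsto (fun x => g x s) atTop (nhds 0)) :
    Tendsto (fun x => ∫ s, g x s ∂F) atTop (nhds 0) := by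
  have := tendsto_integral_filter_of_dominated_convergence (μ := F) (l := (atTop : Filter ℝ))
    (F := g) (f := fun _ => 0) (fun _ => c)
    (Eventually.of_forall fun x => (hg x).aestronglyMeasurable)
    (Eventually.of_forall fun x => Eventually.of_forall fun s => hc x s)
    (integrable_const c) (Eventually.of_forall fun s => h0 s)
  simpa using this

lemma kr_jensen (F : Measure ℝ) [IsProbabilityMeasure F] {g : ℝ → ℝ} (hg : Measurable g)
    {c : ℝ} (hc : ∀ x, |g x| ≤ c) : (∫ s, g s ∂F) ^ 2 ≤ ∫ s, g s ^ 2 ∂F := by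
  have hi := kr_int_bdd F hg hc
  have hi2 : Integrable (fun s => g s ^ 2) F :=
    kr_int_bdd F (c := c ^ 2) (by fun_prop) (fun x => by
      rw [abs_pow]; exact pow_le_pow_left₀ (abs_nonneg _) (hc x) 2)
  set m := ∫ s, g s ∂F with hm
  have h1 : 0 ≤ ∫ s, (g s - m) ^ 2 ∂F := integral_nonneg fun s => sq_nonneg _
  have h2 : ∫ s, (g s - m) ^ 2 ∂F = ∫ s, g s ^ 2 ∂F - m ^ 2 := by
    have : (fun s => (g s - m) ^ 2) = fun s => (g s ^ 2 - 2 * m * g s) + m ^ 2 := by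
      ext s; ring
    have hi3 : Integrable (fun s => g s ^ 2 - 2 * m * g s) F := hi2.sub (hi.const_mul _)
    rw [this, integral_add hi3 (integrable_const _),
      integral_sub hi2 (hi.const_mul _), integral_const_mul, ← hm]
    simp; ring
  linarith

section CD
variable {F : Measure ℝ} [IsProbabilityMeasure F] {u : ℝ → ℝ} {M : ℝ}

lemma kr_D_tendsto (hum : Measurable u) (hM : ∀ x, |u x| ≤ M)
    (hQ : Tendsto (fun x => ∫ s, u (x - s) ∂F - u x) atTop (nhds 0)) :
    Tendsto (fun x => ∫ s, (u (x - s) - u x) ^ 2 ∂F) atTop (nhds 0) := by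
  have hM0 : 0 ≤ M := (abs_nonneg _).trans (hM 0)
  set D : ℝ → ℝ := fun x => ∫ s, (u (x - s) - u x) ^ 2 ∂F with hD
  set ε : ℝ → ℝ := fun x => ∫ s, u (x - s) ∂F - u x with hε
  have hεm : Measurable ε := by
    refine Measurable.sub (kr_Q_meas F (g := fun x s => u (x - s)) ?_) hum
    exact hum.comp (by fun_prop)
  have hdb : ∀ x y, |u x - u y| ≤ 2 * M := fun x y => by
    have := abs_sub (u x) (u y); linarith [hM x, hM y]
  have hεb : ∀ x, |ε x| ≤ 2 * M := fun x => by
    have h1 : |∫ s, u (x - s) ∂F| ≤ M := kr_abs_int_le F (fun s => hM _)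
    have := abs_sub (∫ s, u (x - s) ∂F) (u x)
    simp only [hε]; linarith [hM x]
  have hDb : ∀ x, |D x| ≤ (2 * M) ^ 2 := fun x => by
    refine kr_abs_int_le F fun s => ?_
    rw [abs_pow]; exact pow_le_pow_left₀ (abs_nonneg _) (hdb _ _) 2
  have hDm : Measurable D := by
    refine kr_Q_meas F (g := fun x s => (u (x - s) - u x) ^ 2) ?_
    exact ((hum.comp (by fun_prop : Measurable fun p : ℝ × ℝ => p.1 - p.2)).sub
      (hum.comp measurable_fst)).pow_const 2
  have hD0 : ∀ x, 0 ≤ D x := fun x => integral_nonneg fun s => sq_nonneg _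
  -- D = Q u² - u² - 2 u ε
  have hD1 : ∀ x, D x = ∫ s, u (x - s) ^ 2 ∂F - u x ^ 2 - 2 * u x * ε x := by
    intro x
    have hi : Integrable (fun s => u (x - s)) F :=
      kr_int_bdd F (hum.comp (by fun_prop)) (fun s => hM _)
    have hi2 : Integrable (fun s => u (x - s) ^ 2) F :=
      kr_int_bdd F ((hum.comp (by fun_prop)).pow_const 2) (c := M ^ 2) (fun s => by
        rw [abs_pow]; exact pow_le_pow_left₀ (abs_nonneg _) (hM _) 2)
    have : (fun s => (u (x - s) - u x) ^ 2)
        = fun s => (u (x - s) ^ 2 - 2 * u x * u (x - s)) + u x ^ 2 := by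
      ext s; ring
    simp only [hD, hε]
    have hi3 : Integrable (fun s => u (x - s) ^ 2 - 2 * u x * u (x - s)) F :=
      hi2.sub (hi.const_mul _)
    rw [this, integral_add hi3 (integrable_const _),
      integral_sub hi2 (hi.const_mul _), integral_const_mul]
    simp; ring
  -- e'
  set e' : ℝ → ℝ := fun x => ∫ s, |ε (x - s) - ε x| ∂F with he'
  have he'm : Measurable e' := by
    refine kr_Q_meas F (g := fun x s => |ε (x - s) - ε x|) ?_
    exact ((hεm.comp (by fun_prop : Measurable fun p : ℝ × ℝ => p.1 - p.2)).sub
      (hεm.comp measurable_fst)).abs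
  have hεdb : ∀ x y, |ε x - ε y| ≤ 4 * M := fun x y => by
    have := abs_sub (ε x) (ε y); linarith [hεb x, hεb y]
  have he'b : ∀ x, |e' x| ≤ 4 * M := fun x =>
    kr_abs_int_le F fun s => by rw [abs_abs]; exact hεdb _ _
  have he't : Tendsto e' atTop (nhds 0) := by
    refine kr_Q_tendsto F (g := fun x s => |ε (x - s) - ε x|) (c := 4 * M) ?_ ?_ ?_
    · intro x
      exact ((hεm.comp (by fun_prop)).sub measurable_const).abs
    · intro x s; rw [abs_abs]; exact hεdb _ _
    · intro s
      have h1 : Tendsto (fun x => ε (x - s)) atTop (nhds 0) :=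
        hQ.comp (tendsto_atTop_add_const_right atTop (-s) tendsto_id)
      simpa using (h1.sub hQ).abs
  -- QD ≥ D - 4 M e'
  have hQD : ∀ x, D x - 4 * M * e' x ≤ ∫ r, D (x - r) ∂F := by
    intro x
    have hmm : Measurable (fun p : ℝ × ℝ => (u (x - p.1 - p.2) - u (x - p.1)) ^ 2) :=
      ((hum.comp (by fun_prop : Measurable fun p : ℝ × ℝ => x - p.1 - p.2)).sub
        (hum.comp (by fun_prop : Measurable fun p : ℝ × ℝ => x - p.1))).pow_const 2
    have hii : Integrable (Function.uncurry fun r s => (u (x - r - s) - u (x - r)) ^ 2)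
        (F.prod F) := by
      refine Integrable.of_bound hmm.aestronglyMeasurable ((2 * M) ^ 2)
        (Eventually.of_forall fun p => ?_)
      simp only [Function.uncurry, Real.norm_eq_abs]
      rw [abs_pow]; exact pow_le_pow_left₀ (abs_nonneg _) (hdb _ _) 2
    have hsw : ∫ r, D (x - r) ∂F = ∫ s, ∫ r, (u (x - r - s) - u (x - r)) ^ 2 ∂F ∂F := by
      simp only [hD]
      exact integral_integral_swap hii
    rw [hsw]
    have hl : D x - 4 * M * e' x
        = ∫ s, ((u (x - s) - u x) ^ 2 - 4 * M * |ε (x - s) - ε x|) ∂F := by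
      rw [integral_sub, integral_const_mul]
      · refine kr_int_bdd F (c := (2 * M) ^ 2) ?_ (fun s => ?_)
        · exact ((hum.comp (by fun_prop)).sub measurable_const).pow_const 2
        · rw [abs_pow]; exact pow_le_pow_left₀ (abs_nonneg _) (hdb _ _) 2
      · refine Integrable.const_mul (kr_int_bdd F (c := 4 * M) ?_ (fun s => ?_)) _
        · exact ((hεm.comp (by fun_prop)).sub measurable_const).abs
        · rw [abs_abs]; exact hεdb _ _
    rw [hl]
    refine integral_mono ?_ hii.integral_prod_right ?_
    · refine Integrable.sub ?_ (Integrable.const_mul (kr_int_bdd F (c := 4 * M) ?_ (fun s => ?_)) _)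
      · refine kr_int_bdd F (c := (2 * M) ^ 2) ?_ (fun s => ?_)
        · exact ((hum.comp (by fun_prop)).sub measurable_const).pow_const 2
        · rw [abs_pow]; exact pow_le_pow_left₀ (abs_nonneg _) (hdb _ _) 2
      · exact ((hεm.comp (by fun_prop)).sub measurable_const).abs
      · rw [abs_abs]; exact hεdb _ _
    · intro s
      have hj := kr_jensen F (g := fun r => u (x - r - s) - u (x - r)) (c := 2 * M)
        ((hum.comp (by fun_prop)).sub (hum.comp (by fun_prop))) (fun r => hdb _ _)
      have hval : ∫ r, (u (x - r - s) - u (x - r)) ∂F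
          = (u (x - s) - u x) + (ε (x - s) - ε x) := by
        rw [integral_sub]
        · simp only [hε]
          have : ∀ r, x - r - s = x - s - r := fun r => by ring
          simp only [this]; ring
        · exact kr_int_bdd F (hum.comp (by fun_prop)) (fun s => hM _)
        · exact kr_int_bdd F (hum.comp (by fun_prop)) (fun s => hM _)
      rw [hval] at hj
      refine le_trans ?_ hj
      set a := u (x - s) - u x
      set e := ε (x - s) - ε x
      have ha : |a| ≤ 2 * M := hdb _ _
      have h3 : -(|a| * |e|) ≤ a * e := by rw [← abs_mul]; exact neg_abs_le _
      have h4 : |a| * |e| ≤ 2 * M * |e| := mul_le_mul_of_nonneg_right ha (abs_nonneg _)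
      nlinarith [sq_nonneg e]
  -- induction
  have key : ∀ n : ℕ, ∃ w e : ℝ → ℝ, Measurable w ∧ Measurable e ∧ (∀ x, |w x| ≤ M ^ 2) ∧
      (∃ c, ∀ x, |e x| ≤ c) ∧ Tendsto e atTop (nhds 0) ∧
      ∀ x, n * D x ≤ w x - u x ^ 2 + e x := by
    intro n
    induction n with
    | zero =>
      refine ⟨fun x => u x ^ 2, fun _ => 0, hum.pow_const 2, measurable_const, fun x => ?_,
        ⟨0, by simp⟩, tendsto_const_nhds, by simp⟩
      rw [abs_pow]; exact pow_le_pow_left₀ (abs_nonneg _) (hM _) 2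
    | succ n ih =>
      obtain ⟨w, e, hw, he, hwb, ⟨c, hc⟩, het, hle⟩ := ih
      refine ⟨fun x => ∫ s, w (x - s) ∂F,
        fun x => ∫ s, e (x - s) ∂F + (n * (4 * M * e' x) - 2 * u x * ε x), ?_, ?_, ?_, ?_, ?_, ?_⟩
      · exact kr_Q_meas F (g := fun x s => w (x - s)) (hw.comp (by fun_prop))
      · exact (kr_Q_meas F (g := fun x s => e (x - s)) (he.comp (by fun_prop))).add
          (by fun_prop)
      · exact fun x => kr_abs_int_le F fun s => hwb _
      · refine ⟨c + (n * (4 * M * (4 * M)) + 2 * M * (2 * M)), fun x => ?_⟩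
        have h1 : |∫ s, e (x - s) ∂F| ≤ c := kr_abs_int_le F fun s => hc _
        have h2 : |n * (4 * M * e' x)| ≤ n * (4 * M * (4 * M)) := by
          rw [abs_mul, abs_mul, abs_of_nonneg (by positivity : (0 : ℝ) ≤ n),
            abs_of_nonneg (by positivity : 0 ≤ 4 * M)]
          have := he'b x
          gcongr
        have h3 : |2 * u x * ε x| ≤ 2 * M * (2 * M) := by
          rw [abs_mul, abs_mul, abs_two]
          have := hM x; have := hεb x
          gcongr
        refine (abs_add_le _ _).trans (add_le_add h1 ((abs_sub _ _).trans (add_le_add h2 h3)))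
      · have h1 : Tendsto (fun x => ∫ s, e (x - s) ∂F) atTop (nhds 0) := by
          refine kr_Q_tendsto F (g := fun x s => e (x - s)) (c := c) ?_ (fun x s => hc _) ?_
          · intro x; exact he.comp (by fun_prop)
          · intro s
            exact het.comp (tendsto_atTop_add_const_right atTop (-s) tendsto_id)
        have h2 : Tendsto (fun x => (n : ℝ) * (4 * M * e' x)) atTop (nhds 0) := by
          simpa using (he't.const_mul (4 * M)).const_mul (n : ℝ)
        have h3 : Tendsto (fun x => 2 * u x * ε x) atTop (nhds 0) := by
          rw [tendsto_zero_iff_abs_tendsto_zero]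
          have h4 : Tendsto (fun x => 2 * M * |ε x|) atTop (nhds 0) := by
            simpa using hQ.abs.const_mul (2 * M)
          refine squeeze_zero (fun x => abs_nonneg _) (fun x => ?_) h4
          change |2 * u x * ε x| ≤ _
          rw [abs_mul, abs_mul, abs_two]
          have := hM x
          gcongr
        simpa using h1.add (h2.sub h3)
      · intro x
        have hmono : ∫ s, (n : ℝ) * D (x - s) ∂F
            ≤ ∫ s, (w (x - s) - u (x - s) ^ 2 + e (x - s)) ∂F := by
          refine integral_mono ?_ ?_ (fun s => hle _)
          · exact (kr_int_bdd F (hDm.comp (by fun_prop)) (fun s => hDb _)).const_mul _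
          · refine Integrable.add (Integrable.sub ?_ ?_) ?_
            · exact kr_int_bdd F (hw.comp (by fun_prop)) (fun s => hwb _)
            · exact kr_int_bdd F ((hum.comp (by fun_prop)).pow_const 2) (c := M ^ 2) (fun s => by
                rw [abs_pow]; exact pow_le_pow_left₀ (abs_nonneg _) (hM _) 2)
            · exact kr_int_bdd F (he.comp (by fun_prop)) (fun s => hc _)
        rw [integral_const_mul, integral_add, integral_sub] at hmono
        · have h5 := mul_le_mul_of_nonneg_left (hQD x) (Nat.cast_nonneg n : (0 : ℝ) ≤ n)
          have h6 := hD1 x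
          push_cast
          linarith
        · exact kr_int_bdd F (hw.comp (by fun_prop)) (fun s => hwb _)
        · exact kr_int_bdd F ((hum.comp (by fun_prop)).pow_const 2) (c := M ^ 2) (fun s => by
            rw [abs_pow]; exact pow_le_pow_left₀ (abs_nonneg _) (hM _) 2)
        · refine Integrable.sub ?_ ?_
          · exact kr_int_bdd F (hw.comp (by fun_prop)) (fun s => hwb _)
          · exact kr_int_bdd F ((hum.comp (by fun_prop)).pow_const 2) (c := M ^ 2) (fun s => by
              rw [abs_pow]; exact pow_le_pow_left₀ (abs_nonneg _) (hM _) 2)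
        · exact kr_int_bdd F (he.comp (by fun_prop)) (fun s => hc _)
  rw [Metric.tendsto_nhds]
  intro δ hδ
  obtain ⟨n, hn⟩ := exists_nat_gt ((M ^ 2 + 1) / δ)
  obtain ⟨w, e, -, -, hwb, -, het, hle⟩ := key n
  have hn' : M ^ 2 + 1 < n * δ := by rwa [div_lt_iff₀ hδ] at hn
  filter_upwards [het.eventually (gt_mem_nhds (zero_lt_one' ℝ))] with x hx
  rw [Real.dist_eq, sub_zero, abs_of_nonneg (hD0 x)]
  by_contra hcon
  push Not at hcon
  have h1 := mul_le_mul_of_nonneg_left hcon (Nat.cast_nonneg n : (0 : ℝ) ≤ n)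
  have h2 := hle x
  have h3 := (le_abs_self _).trans (hwb x)
  nlinarith [sq_nonneg (u x)]

lemma kr_choquet_deny (hum : UniformContinuous u) (hM : ∀ x, |u x| ≤ M)
    (hQ : Tendsto (fun x => ∫ s, u (x - s) ∂F - u x) atTop (nhds 0))
    (hnl : ¬ ∃ a > (0 : ℝ), F {x : ℝ | ∃ k : ℤ, x = k * a} = 1) (t : ℝ) :
    Tendsto (fun x => u (x - t) - u x) atTop (nhds 0) := by
  have hmeas : Measurable u := hum.continuous.measurable
  have hDt := kr_D_tendsto hmeas hM hQ
  have hsh : ∀ {f : ℝ → ℝ} (s : ℝ), Tendsto f atTop (nhds 0) →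
      Tendsto (fun x => f (x + s)) atTop (nhds 0) := fun s hf =>
    hf.comp (tendsto_atTop_add_const_right atTop s tendsto_id)
  let K : AddSubgroup ℝ :=
    { carrier := {s | Tendsto (fun x => u (x - s) - u x) atTop (nhds 0)}
      zero_mem' := by simp
      add_mem' := by
        intro a b ha hb
        have := (hsh (-a) hb).add ha
        simp only [add_zero] at this
        refine this.congr fun x => ?_
        have : x + -a - b = x - (a + b) := by ring
        rw [this, ← sub_eq_add_neg]; ring
      neg_mem' := by
        intro a ha
        have := (hsh a ha).neg
        simp only [neg_zero] at this
        refine this.congr fun x => ?_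
        have : x + a - a = x := by ring
        rw [this, sub_neg_eq_add]; ring }
  have hKmem : ∀ s, s ∈ K ↔ Tendsto (fun x => u (x - s) - u x) atTop (nhds 0) := fun s => Iff.rfl
  rw [Metric.uniformContinuous_iff] at hum
  have hclosed : ∀ s, (∀ δ > 0, ∃ s' ∈ K, |s - s'| < δ) → s ∈ K := by
    intro s hs
    rw [hKmem, Metric.tendsto_nhds]
    intro ε hε
    obtain ⟨δ, hδ, hu⟩ := hum (ε / 2) (by positivity)
    obtain ⟨s', hs', hd⟩ := hs δ hδ
    rw [hKmem, Metric.tendsto_nhds] at hs'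
    filter_upwards [hs' (ε / 2) (by positivity)] with x hx
    have := @hu (x - s) (x - s') (by
      rw [Real.dist_eq, show x - s - (x - s') = -(s - s') by ring, abs_neg]; exact hd)
    simp only [Real.dist_eq, sub_zero] at *
    calc |u (x - s) - u x| = |(u (x - s) - u (x - s')) + (u (x - s') - u x)| := by ring_nf
      _ ≤ _ := abs_add_le _ _
      _ < ε := by linarith
  have hsupp : F.support ⊆ K := by
    intro s hs
    by_contra hns
    rw [SetLike.mem_coe, hKmem, Metric.tendsto_nhds] at hns
    push Not at hns
    obtain ⟨ε, hε, hfr⟩ := hns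
    obtain ⟨δ, hδ, hu⟩ := hum (ε / 2) (by positivity)
    have hpos := (Measure.mem_support_iff_forall s).1 hs _ (Metric.ball_mem_nhds s hδ)
    have hpos' : 0 < F.real (Metric.ball s δ) :=
      ENNReal.toReal_pos hpos.ne' (measure_ne_top _ _)
    rw [Metric.tendsto_nhds] at hDt
    have hev := hDt ((ε / 2) ^ 2 * F.real (Metric.ball s δ)) (by positivity)
    obtain ⟨x, hx1, hx2⟩ := (hfr.and_eventually hev).exists
    simp only [Real.dist_eq, sub_zero] at hx1 hx2
    have hI : Integrable (fun s => (u (x - s) - u x) ^ 2) F := by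
      refine kr_int_bdd F (c := (2 * M) ^ 2) ?_ (fun s => ?_)
      · exact ((hmeas.comp (by fun_prop)).sub measurable_const).pow_const 2
      · rw [abs_pow]
        refine pow_le_pow_left₀ (abs_nonneg _) ?_ 2
        have := abs_sub (u (x - s)) (u x)
        linarith [hM (x - s), hM x]
    have h1 : (ε / 2) ^ 2 * F.real (Metric.ball s δ)
        ≤ ∫ r in Metric.ball s δ, (u (x - r) - u x) ^ 2 ∂F := by
      have := setIntegral_mono_on (μ := F) (s := Metric.ball s δ) (f := fun _ => (ε / 2) ^ 2)
        (g := fun r => (u (x - r) - u x) ^ 2) (integrableOn_const (measure_ne_top _ _))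
        hI.integrableOn measurableSet_ball (fun r hr => by
          have h2 := @hu (x - s) (x - r) (by
            rw [Real.dist_eq, show x - s - (x - r) = r - s by ring]; exact hr)
          rw [Real.dist_eq] at h2
          rw [← sq_abs (u (x - r) - u x)]
          refine pow_le_pow_left₀ (by positivity) ?_ 2
          have h3 : |u (x - s) - u x| ≤ |u (x - s) - u (x - r)| + |u (x - r) - u x| :=
            abs_sub_le _ _ _
          linarith)
      rwa [setIntegral_const, smul_eq_mul, mul_comm] at this
    have h2 : ∫ r in Metric.ball s δ, (u (x - r) - u x) ^ 2 ∂F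
        ≤ ∫ r, (u (x - r) - u x) ^ 2 ∂F :=
      setIntegral_le_integral hI (Eventually.of_forall fun r => sq_nonneg _)
    have h3 := le_abs_self (∫ r, (u (x - r) - u x) ^ 2 ∂F)
    linarith
  rcases AddSubgroup.dense_or_cyclic K with hd | ⟨a, ha⟩
  · refine (hKmem t).1 (hclosed t fun δ hδ => ?_)
    obtain ⟨s', hs', hd'⟩ := Metric.mem_closure_iff.1 (hd t) δ hδ
    exact ⟨s', hs', hd'⟩
  · exfalso
    apply hnl
    refine ⟨if a = 0 then 1 else |a|, ?_, ?_⟩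
    · split_ifs with h0
      · exact one_pos
      · exact abs_pos.2 h0
    · refine (prob_compl_eq_zero_iff₀ ?_).1 ?_
      · refine (Set.Countable.measurableSet ?_).nullMeasurableSet
        refine (Set.countable_range (fun k : ℤ => (k : ℝ) * (if a = 0 then 1 else |a|))).mono ?_
        rintro x ⟨k, hk⟩
        exact ⟨k, hk.symm⟩
      · have h0 : F (F.support)ᶜ = 0 := Measure.measure_compl_support_of_regular
        refine measure_mono_null ?_ h0
        refine compl_subset_compl.2 fun s hs => ?_
        have hsK := hsupp hs
        rw [ha, SetLike.mem_coe, AddSubgroup.mem_closure_singleton] at hsK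
        obtain ⟨k, hk⟩ := hsK
        rw [zsmul_eq_mul] at hk
        simp only [mem_ofPred_eq]
        split_ifs with h0
        · exact ⟨0, by rw [← hk, h0]; simp⟩
        · rcases abs_choice a with h | h
          · exact ⟨k, by rw [h, hk]⟩
          · exact ⟨-k, by rw [h, ← hk]; push_cast; ring⟩
end CD
/-! ## Part 2: integrals against a measure that is bounded on unit intervals -/

section UB
variable {U : Measure ℝ} {C : NNReal}

lemma kr_cell_le (hU : ∀ x : ℝ, U (Ioc x (x + 1)) ≤ C) {g : ℝ → ℝ}
    {y b : ℝ} (hb : ∀ z ∈ Ioc y (y + 1), |g z| ≤ b) :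
    ‖∫ z in Ioc y (y + 1), g z ∂U‖ ≤ C * b := by
  have hfin : U (Ioc y (y + 1)) < ⊤ := (hU y).trans_lt ENNReal.coe_lt_top
  have h1 := norm_setIntegral_le_of_norm_le_const (μ := U) (s := Ioc y (y + 1)) (f := g) (C := b)
    hfin hb
  have hb0 : 0 ≤ b := (abs_nonneg _).trans (hb (y + 1) ⟨by linarith, le_rfl⟩)
  have h2 : U.real (Ioc y (y + 1)) ≤ C := by
    have := ENNReal.toReal_mono ENNReal.coe_ne_top (hU y)
    rwa [ENNReal.coe_toReal] at this
  calc _ ≤ b * U.real (Ioc y (y + 1)) := h1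
    _ ≤ b * C := by gcongr
    _ = _ := mul_comm _ _

lemma kr_integrable (hU : ∀ x : ℝ, U (Ioc x (x + 1)) ≤ C) {g : ℝ → ℝ} (hg : Measurable g)
    {B : ℤ → ℝ} (hB : Summable B) (x : ℝ)
    (hb : ∀ k : ℤ, ∀ z ∈ Ioc (x + k) (x + k + 1), |g z| ≤ B k) :
    Integrable g U := by
  rw [← integrableOn_univ, ← iUnion_Ioc_add_intCast x]
  refine integrableOn_iUnion_of_summable_integral_norm (fun k => ?_) ?_
  · have hfin : U (Ioc (x + k) (x + k + 1)) < ⊤ := (hU _).trans_lt ENNReal.coe_lt_top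
    refine Measure.integrableOn_of_bounded (M := B k) hfin.ne hg.aestronglyMeasurable ?_
    exact (ae_restrict_iff' measurableSet_Ioc).2 (Eventually.of_forall (hb k))
  · refine Summable.of_nonneg_of_le (fun k => integral_nonneg fun z => norm_nonneg _)
      (fun k => ?_) (hB.mul_left (C : ℝ))
    refine (le_abs_self _).trans (kr_cell_le hU (g := fun z => ‖g z‖) fun z hz => ?_)
    simpa using hb k z hz

lemma kr_hasSum {g : ℝ → ℝ} (hg : Integrable g U) (x : ℝ) :
    HasSum (fun k : ℤ => ∫ z in Ioc (x + k) (x + k + 1), g z ∂U) (∫ z, g z ∂U) := by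
  have := hasSum_integral_iUnion (μ := U) (f := g)
    (s := fun k : ℤ => Ioc (x + k) (x + k + 1)) (fun k => measurableSet_Ioc)
    (pairwise_disjoint_Ioc_add_intCast x) hg.integrableOn
  rwa [iUnion_Ioc_add_intCast, setIntegral_univ] at this

lemma kr_abs_le (hU : ∀ x : ℝ, U (Ioc x (x + 1)) ≤ C) {g : ℝ → ℝ} (hg : Measurable g)
    {B : ℤ → ℝ} (hB : Summable B) (x : ℝ)
    (hb : ∀ k : ℤ, ∀ z ∈ Ioc (x + k) (x + k + 1), |g z| ≤ B k) :
    |∫ z, g z ∂U| ≤ C * ∑' k, B k := by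
  have hs := kr_hasSum (kr_integrable hU hg hB x hb) x
  rw [← hs.tsum_eq, ← tsum_mul_left]
  exact tsum_of_norm_bounded (hB.mul_left (C : ℝ)).hasSum
    (fun k => kr_cell_le hU (hb k))

lemma kr_tannery (hU : ∀ x : ℝ, U (Ioc x (x + 1)) ≤ C) {g : ℝ → ℝ → ℝ}
    (hg : ∀ x, Measurable (g x)) {B : ℤ → ℝ} (hB : Summable B)
    (hb : ∀ x : ℝ, ∀ k : ℤ, ∀ z ∈ Ioc (x + k) (x + k + 1), |g x z| ≤ B k)
    (h0 : ∀ k : ℤ, ∀ ε > 0, ∀ᶠ x : ℝ in atTop, ∀ z ∈ Ioc (x + k) (x + k + 1), |g x z| ≤ ε) :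
    Tendsto (fun x => ∫ z, g x z ∂U) atTop (nhds 0) := by
  have h := tendsto_tsum_of_dominated_convergence (𝓕 := (atTop : Filter ℝ)) (hB.mul_left (C : ℝ))
    (f := fun x (k : ℤ) => ∫ z in Ioc (x + k) (x + k + 1), g x z ∂U) (g := fun _ => 0)
    (fun k => ?_) (Eventually.of_forall fun x k => kr_cell_le hU (hb x k))
  · simp only [tsum_zero] at h
    refine h.congr fun x => ?_
    exact (kr_hasSum (kr_integrable hU (hg x) hB x (hb x)) x).tsum_eq
  · rw [Metric.tendsto_nhds]
    intro ε hε
    filter_upwards [h0 k (ε / (C + 1)) (by positivity)] with x hx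
    rw [dist_zero_right]
    refine (kr_cell_le hU hx).trans_lt ?_
    rw [mul_div_assoc', div_lt_iff₀ (by positivity)]
    nlinarith [C.coe_nonneg]

end UB

/-- tails of an integrable law are summable -/
lemma kr_tail_summable (ν : Measure ℝ) [IsProbabilityMeasure ν]
    (hν : ∫⁻ s, ENNReal.ofReal |s| ∂ν < ⊤) (c : ℝ) :
    Summable (fun k : ℤ => ν.real {s : ℝ | |(k : ℝ)| - c < |s|}) := by
  have key : Summable (fun k : ℕ => ν.real {s : ℝ | (k : ℝ) - c < |s|}) := by
    have h1 : Integrable (fun s : ℝ => |s| + |c|) ν := by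
      refine Integrable.add ⟨by fun_prop, ?_⟩ (integrable_const _)
      rw [hasFiniteIntegral_iff_norm]
      simpa using hν
    have h2 := @tsum_prob_mem_Ioi_lt_top ℝ ⟨ν⟩ inferInstance _ h1
      (fun s => by simp only [Pi.zero_apply]; positivity)
    have h3 := ENNReal.summable_toReal h2.ne
    refine Summable.of_nonneg_of_le (fun k => measureReal_nonneg) (fun k => ?_) h3
    refine measureReal_mono (fun s hs => ?_) (measure_ne_top _ _)
    simp only [mem_ofPred_eq, mem_Ioi] at hs ⊢
    linarith [le_abs_self c]
  refine Summable.of_nat_of_neg ?_ ?_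
  · simpa using key
  · simpa using key

/-- Test functions: bounded, Lipschitz, constant near both ends. -/
structure KRTest (G : ℝ → ℝ) (R K A a b : ℝ) : Prop where
  lip : ∀ x y, |G x - G y| ≤ K * |x - y|
  bdd : ∀ x, |G x| ≤ A
  left : ∀ x ≤ -R, G x = a
  right : ∀ x, R ≤ x → G x = b

namespace KRTest
variable {G : ℝ → ℝ} {R K A a b : ℝ}

lemma K_nonneg (h : KRTest G R K A a b) : 0 ≤ K := by
  have := (abs_nonneg _).trans (h.lip 1 0)
  simpa using this

lemma A_nonneg (h : KRTest G R K A a b) : 0 ≤ A := (abs_nonneg _).trans (h.bdd 0)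

lemma cont (h : KRTest G R K A a b) : Continuous G := by
  have : LipschitzWith ⟨K, h.K_nonneg⟩ G := LipschitzWith.of_dist_le_mul fun x y => by
    rw [Real.dist_eq, Real.dist_eq]; exact h.lip x y
  exact this.continuous

lemma diff_le (h : KRTest G R K A a b) (k : ℤ) {z : ℝ} (hz : z ∈ Ioc (k : ℝ) (k + 1)) (s : ℝ) :
    |G (z + s) - G z| ≤ indicator {s : ℝ | |(k : ℝ)| - (R + 2) < |s|} (fun _ => 2 * A) s := by
  by_cases hs : s ∈ {s : ℝ | |(k : ℝ)| - (R + 2) < |s|}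
  · rw [indicator_of_mem hs]
    have := abs_sub (G (z + s)) (G z)
    linarith [h.bdd (z + s), h.bdd z]
  · rw [indicator_of_notMem hs]
    simp only [mem_ofPred_eq, not_lt] at hs
    have h1 := le_abs_self s
    have h2 := neg_abs_le s
    rcases le_total 0 (k : ℝ) with hk | hk
    · rw [abs_of_nonneg hk] at hs
      rw [h.right z (by linarith [hz.1]), h.right (z + s) (by linarith [hz.1])]
      simp
    · rw [abs_of_nonpos hk] at hs
      rw [h.left z (by linarith [hz.2]), h.left (z + s) (by linarith [hz.2])]
      simp

lemma integrable (h : KRTest G R K A a b) (ν : Measure ℝ) [IsProbabilityMeasure ν] (z : ℝ) :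
    Integrable (fun s => G (z + s)) ν :=
  kr_int_bdd ν (h.cont.measurable.comp (by fun_prop)) (fun s => h.bdd _)

lemma integral_diff_le (h : KRTest G R K A a b) (ν : Measure ℝ) [IsProbabilityMeasure ν]
    (k : ℤ) {z : ℝ} (hz : z ∈ Ioc (k : ℝ) (k + 1)) :
    ∫ s, |G (z + s) - G z| ∂ν ≤ 2 * A * ν.real {s : ℝ | |(k : ℝ)| - (R + 2) < |s|} := by
  have hm : MeasurableSet {s : ℝ | |(k : ℝ)| - (R + 2) < |s|} :=
    measurableSet_lt measurable_const (by fun_prop)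
  have h1 := integral_mono (μ := ν) ((h.integrable ν z).sub (integrable_const (G z))).abs
    ((integrable_const (2 * A)).indicator hm) (fun s => h.diff_le k hz s)
  rw [integral_indicator_const _ hm, smul_eq_mul, mul_comm] at h1
  exact h1

lemma abs_integral_diff_le (h : KRTest G R K A a b) (ν : Measure ℝ) [IsProbabilityMeasure ν]
    (k : ℤ) {z : ℝ} (hz : z ∈ Ioc (k : ℝ) (k + 1)) :
    |∫ s, G (z + s) ∂ν - G z| ≤ 2 * A * ν.real {s : ℝ | |(k : ℝ)| - (R + 2) < |s|} := by
  refine le_trans ?_ (h.integral_diff_le ν k hz)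
  have : ∫ s, G (z + s) ∂ν - G z = ∫ s, (G (z + s) - G z) ∂ν := by
    rw [integral_sub (h.integrable ν z) (integrable_const _)]; simp
  rw [this]
  exact abs_integral_le_integral_abs

end KRTest
/-! ## Part 3: compactly supported integrands -/

open Classical in
/-- indicator of the unit cells that meet `[-R, R]` -/
noncomputable def krB (R : ℝ) (k : ℤ) : ℝ := if |(k : ℝ)| ≤ R + 1 then 1 else 0

lemma krB_summable (R : ℝ) : Summable (krB R) := by
  refine summable_of_hasFiniteSupport ?_
  refine (Set.finite_Icc (-⌈R + 1⌉) ⌈R + 1⌉).subset fun k hk => ?_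
  have hk' : |(k : ℝ)| ≤ R + 1 := by
    by_contra hcon
    exact hk (by simp [krB, hcon])
  have h1 := abs_le.1 hk'
  have h2 := Int.le_ceil (R + 1)
  constructor
  · have : ((-⌈R + 1⌉ : ℤ) : ℝ) ≤ k := by push_cast; linarith
    exact_mod_cast this
  · have : (k : ℝ) ≤ ⌈R + 1⌉ := by linarith
    exact_mod_cast this

lemma krB_bound {R c x : ℝ} {g : ℝ → ℝ} (hc : ∀ y, |g y| ≤ c) (h0 : ∀ y, R < |y - x| → g y = 0)
    (k : ℤ) : ∀ z ∈ Ioc (x + k) (x + k + 1), |g z| ≤ c * krB R k := by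
  intro z hz
  by_cases hk : |(k : ℝ)| ≤ R + 1
  · simpa [krB, hk] using hc z
  · have : R < |z - x| := by
      push Not at hk
      rcases le_total 0 (k : ℝ) with h | h
      · rw [abs_of_nonneg h] at hk
        have := le_abs_self (z - x)
        linarith [hz.1]
      · rw [abs_of_nonpos h] at hk
        have := neg_abs_le (z - x)
        linarith [hz.2]
    simp [krB, hk, h0 z this]

section UB2
variable {U : Measure ℝ} {C : NNReal}

lemma kr_cpt_integrable (hU : ∀ x : ℝ, U (Ioc x (x + 1)) ≤ C) {R c x : ℝ} {g : ℝ → ℝ}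
    (hg : Measurable g) (hc : ∀ y, |g y| ≤ c) (h0 : ∀ y, R < |y - x| → g y = 0) :
    Integrable g U :=
  kr_integrable hU hg ((krB_summable R).mul_left c) x (krB_bound hc h0)

lemma kr_cpt_le (hU : ∀ x : ℝ, U (Ioc x (x + 1)) ≤ C) {R c x : ℝ} {g : ℝ → ℝ}
    (hg : Measurable g) (hc : ∀ y, |g y| ≤ c) (h0 : ∀ y, R < |y - x| → g y = 0) :
    |∫ y, g y ∂U| ≤ C * (c * ∑' k, krB R k) := by
  rw [← tsum_mul_left]
  exact kr_abs_le hU hg ((krB_summable R).mul_left c) x (krB_bound hc h0)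
end UB2

/-! ## Part 4: the chain -/

section Chain
variable {P : Kernel ℝ ℝ} [IsMarkovKernel P] {μ0 : Measure ℝ} [IsProbabilityMeasure μ0]

instance kr_chain_prob (n : ℕ) : IsProbabilityMeasure (chainDist P μ0 n) := by
  induction n with
  | zero => simpa [chainDist] using (inferInstance : IsProbabilityMeasure μ0)
  | succ n ih =>
    simp only [chainDist]
    infer_instance

instance kr_sfinite : SFinite (renewalMeasure P μ0) := by
  unfold renewalMeasure; infer_instance

instance kr_jump_prob (x : ℝ) : IsProbabilityMeasure (jumpLaw P x) :=
  Measure.isProbabilityMeasure_map (by fun_prop)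

lemma kr_integral_bind (μ : Measure ℝ) [IsProbabilityMeasure μ] {g : ℝ → ℝ} (hg : Measurable g)
    {c : ℝ} (hc : ∀ x, |g x| ≤ c) : ∫ w, g w ∂(μ.bind P) = ∫ y, ∫ w, g w ∂(P y) ∂μ := by
  have h := Kernel.integral_comp (κ := Kernel.const Unit μ) (η := P) (a := ()) (f := g)
    (by
      rw [Kernel.comp_apply, Kernel.const_apply]
      exact kr_int_bdd _ hg hc)
  rwa [Kernel.comp_apply, Kernel.const_apply] at h

lemma kr_jump_integral (x y : ℝ) {G : ℝ → ℝ} (hG : Measurable G) :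
    ∫ s, G (y - x + s) ∂(jumpLaw P y) = ∫ w, G (w - x) ∂(P y) := by
  unfold jumpLaw
  have hm : Measurable (fun s => G (y - x + s)) := hG.comp (by fun_prop)
  rw [integral_map (by fun_prop) hm.aestronglyMeasurable]
  congr 1; ext w; congr 1; ring

variable {C : NNReal} {G : ℝ → ℝ} {R K A a b : ℝ}

lemma kr_lim_n (hU : ∀ x : ℝ, renewalMeasure P μ0 (Ioc x (x + 1)) ≤ C) {p0 : ℝ}
    (hp0 : Tendsto (fun n : ℕ => ((chainDist P μ0 n) (Set.Ioi (0 : ℝ))).toReal)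
      atTop (nhds p0)) (hG : KRTest G R K A a b) (x : ℝ) :
    Tendsto (fun n => ∫ w, G (w - x) ∂(chainDist P μ0 n)) atTop (nhds (a + (b - a) * p0)) := by
  have ha : |a| ≤ A := by rw [← hG.left (-R) le_rfl]; exact hG.bdd _
  have hb : |b| ≤ A := by rw [← hG.right R le_rfl]; exact hG.bdd _
  set g : ℝ → ℝ := fun w => G (w - x) - (a + (b - a) * indicator (Ioi 0) (fun _ => 1) w) with hg
  have hind : Measurable (indicator (Ioi (0 : ℝ)) (fun _ => (1 : ℝ))) :=
    measurable_const.indicator measurableSet_Ioi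
  have hGm : Measurable (fun w => G (w - x)) := hG.cont.measurable.comp (by fun_prop)
  have hgm : Measurable g := hGm.sub (measurable_const.add (hind.const_mul _))
  have hind0 : ∀ w : ℝ, 0 ≤ indicator (Ioi (0 : ℝ)) (fun _ => (1 : ℝ)) w := fun w =>
    indicator_nonneg (fun _ _ => zero_le_one) w
  have hind1 : ∀ w : ℝ, indicator (Ioi (0 : ℝ)) (fun _ => (1 : ℝ)) w ≤ 1 := fun w =>
    indicator_le_self' (fun _ _ => zero_le_one) w
  have hgb : ∀ w, |g w| ≤ 4 * A := by
    intro w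
    have h1 := abs_le.1 (hG.bdd (w - x))
    have h2 := abs_le.1 ha
    have h3 := abs_le.1 hb
    have h4 : indicator (Ioi (0 : ℝ)) (fun _ => (1 : ℝ)) w = 0 ∨
      indicator (Ioi (0 : ℝ)) (fun _ => (1 : ℝ)) w = 1 := indicator_eq_zero_or_self _ _ w
    rw [abs_le]
    simp only [hg]
    rcases h4 with h4 | h4 <;> rw [h4] <;> constructor <;> linarith
  have hg0 : ∀ w, |x| + |R| < |w - 0| → g w = 0 := by
    intro w hw
    rw [sub_zero] at hw
    have h1 := le_abs_self x
    have h2 := neg_abs_le x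
    have h3 := le_abs_self R
    rcases le_total 0 w with h | h
    · rw [abs_of_nonneg h] at hw
      have hw0 : w ∈ Ioi (0 : ℝ) := by
        have := abs_nonneg x; have := abs_nonneg R
        simp only [mem_Ioi]; linarith
      simp only [hg, indicator_of_mem hw0]
      rw [hG.right _ (by linarith)]; ring
    · rw [abs_of_nonpos h] at hw
      have hw0 : w ∉ Ioi (0 : ℝ) := by simpa using h
      simp only [hg, indicator_of_notMem hw0]
      rw [hG.left _ (by linarith)]; ring
  have hgi : Integrable g (renewalMeasure P μ0) := kr_cpt_integrable hU hgm hgb hg0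
  have ht : Tendsto (fun n => ∫ w, g w ∂(chainDist P μ0 n)) atTop (nhds 0) :=
    (hasSum_integral_measure hgi).summable.tendsto_atTop_zero
  have h2 := ht.add ((hp0.const_mul (b - a)).const_add a)
  rw [zero_add] at h2
  refine h2.congr fun n => ?_
  have hi1 : Integrable (fun w => G (w - x)) (chainDist P μ0 n) :=
    kr_int_bdd _ hGm (fun _ => hG.bdd _)
  have hi2 : Integrable (indicator (Ioi (0 : ℝ)) (fun _ => (1 : ℝ))) (chainDist P μ0 n) :=
    kr_int_bdd _ hind (c := 1) (fun w => by rw [abs_of_nonneg (hind0 w)]; exact hind1 w)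
  have hi3 : Integrable (fun w => a + (b - a) * indicator (Ioi (0 : ℝ)) (fun _ => (1 : ℝ)) w)
      (chainDist P μ0 n) := (integrable_const a).add (hi2.const_mul (b - a))
  simp only [hg]
  rw [integral_sub hi1 hi3, integral_add (integrable_const a) (hi2.const_mul (b - a)),
    integral_const_mul, integral_indicator_const _ measurableSet_Ioi]
  simp [measureReal_def]

lemma kr_unif {F : Measure ℝ} [IsProbabilityMeasure F]
    (hweak : ∀ f : BoundedContinuousFunction ℝ ℝ,
      Tendsto (fun x : ℝ => ∫ s, f s ∂(jumpLaw P x)) atTop (nhds (∫ s, f s ∂F)))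
    (hG : KRTest G R K A a b) (k : ℝ) {ε : ℝ} (hε : 0 < ε) :
    ∀ᶠ y in atTop, ∀ z ∈ Icc k (k + 1),
      |∫ s, G (z + s) ∂(jumpLaw P y) - ∫ s, G (z + s) ∂F| ≤ ε := by
  have hK := hG.K_nonneg
  have hlip : ∀ (ν : Measure ℝ) [IsProbabilityMeasure ν] (z z' : ℝ),
      |∫ s, G (z + s) ∂ν - ∫ s, G (z' + s) ∂ν| ≤ K * |z - z'| := by
    intro ν _ z z'
    rw [← integral_sub (hG.integrable ν z) (hG.integrable ν z')]
    refine kr_abs_int_le ν fun s => ?_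
    have := hG.lip (z + s) (z' + s)
    rwa [show z + s - (z' + s) = z - z' by ring] at this
  refine (isCompact_Icc (a := k) (b := k + 1)).induction_on
    (p := fun S => ∀ᶠ y in atTop, ∀ z ∈ S,
      |∫ s, G (z + s) ∂(jumpLaw P y) - ∫ s, G (z + s) ∂F| ≤ ε) ?_ ?_ ?_ ?_
  · simp
  · intro s t hst ht
    filter_upwards [ht] with y hy z hz using hy z (hst hz)
  · intro s t hs ht
    filter_upwards [hs, ht] with y h1 h2 z hz
    exact hz.elim (h1 z) (h2 z)
  · intro z0 _
    have hw := hweak (BoundedContinuousFunction.ofNormedAddCommGroup (fun s => G (z0 + s))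
      (hG.cont.comp (by fun_prop)) A (fun s => hG.bdd _))
    simp only [BoundedContinuousFunction.coe_ofNormedAddCommGroup] at hw
    rw [Metric.tendsto_nhds] at hw
    refine ⟨Metric.ball z0 (ε / (3 * (K + 1))),
      mem_nhdsWithin_of_mem_nhds (Metric.ball_mem_nhds _ (by positivity)), ?_⟩
    filter_upwards [hw (ε / 3) (by positivity)] with y hy z hz
    rw [Real.dist_eq] at hy
    rw [Metric.mem_ball, Real.dist_eq, lt_div_iff₀ (by positivity)] at hz
    have h1 := hlip (jumpLaw P y) z z0
    have h2 := hlip F z z0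
    have h3 : K * |z - z0| ≤ ε / 3 := by nlinarith [abs_nonneg (z - z0)]
    have h4 := abs_le.1 (h1.trans h3)
    have h5 := abs_le.1 (h2.trans h3)
    have h6 := abs_lt.1 hy
    rw [abs_le]
    constructor <;> linarith [h4.1, h4.2, h5.1, h5.2, h6.1, h6.2]

lemma kr_main {F ηm : Measure ℝ} [IsProbabilityMeasure F] [IsProbabilityMeasure ηm]
    (hU : ∀ x : ℝ, renewalMeasure P μ0 (Ioc x (x + 1)) ≤ C) {p0 : ℝ}
    (hp0 : Tendsto (fun n : ℕ => ((chainDist P μ0 n) (Set.Ioi (0 : ℝ))).toReal)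
      atTop (nhds p0))
    (hweak : ∀ f : BoundedContinuousFunction ℝ ℝ,
      Tendsto (fun x : ℝ => ∫ s, f s ∂(jumpLaw P x)) atTop (nhds (∫ s, f s ∂F)))
    (hF : ∫⁻ s, ENNReal.ofReal |s| ∂F < ⊤)
    (hη : ∫⁻ s, ENNReal.ofReal |s| ∂ηm < ⊤)
    (hdom : ∀ x : ℝ, ∀ t : ℝ, jumpLaw P x {s : ℝ | t < |s|} ≤ ηm {s : ℝ | t < s})
    (hG : KRTest G R K A a b) :
    Tendsto (fun x => ∫ y, (∫ s, G (y - x + s) ∂F - G (y - x)) ∂(renewalMeasure P μ0))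
      atTop (nhds ((b - a) * p0)) := by
  have hA := hG.A_nonneg
  have hcell : ∀ {x y : ℝ} {k : ℤ}, y ∈ Ioc (x + k) (x + k + 1) → y - x ∈ Ioc (k : ℝ) (k + 1) := by
    intro x y k h
    exact ⟨by linarith [h.1], by linarith [h.2]⟩
  set tF : ℤ → ℝ := fun k => 2 * A * F.real {s : ℝ | |(k : ℝ)| - (R + 2) < |s|} with htF
  set tE : ℤ → ℝ := fun k => 2 * A * ηm.real {s : ℝ | |(k : ℝ)| - (R + 2) < |s|} with htE
  have hsF : Summable tF := (kr_tail_summable F hF _).mul_left _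
  have hsE : Summable tE := (kr_tail_summable ηm hη _).mul_left _
  set Φ : ℝ → ℝ → ℝ := fun x y => ∫ s, G (y - x + s) ∂(jumpLaw P y) - G (y - x) with hΦ
  set H : ℝ → ℝ → ℝ := fun x y => ∫ s, G (y - x + s) ∂F - G (y - x) with hH
  have hGm : ∀ x : ℝ, Measurable (fun w => G (w - x)) := fun x =>
    hG.cont.measurable.comp (by fun_prop)
  have hΦm : ∀ x, Measurable (Φ x) := by
    intro x
    refine Measurable.sub ?_ (hGm x)
    simp only [kr_jump_integral x _ hG.cont.measurable]
    exact ((hGm x).stronglyMeasurable.integral_kernel).measurable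
  have hHm : ∀ x, Measurable (H x) := by
    intro x
    refine Measurable.sub ?_ (hGm x)
    exact kr_Q_meas F (g := fun y s => G (y - x + s)) (hG.cont.measurable.comp (by fun_prop))
  have hHb : ∀ x : ℝ, ∀ k : ℤ, ∀ y ∈ Ioc (x + k) (x + k + 1), |H x y| ≤ tF k :=
    fun x k y hy => hG.abs_integral_diff_le F k (hcell hy)
  have hΦb : ∀ x : ℝ, ∀ k : ℤ, ∀ y ∈ Ioc (x + k) (x + k + 1), |Φ x y| ≤ tE k := by
    intro x k y hy
    refine (hG.abs_integral_diff_le (jumpLaw P y) k (hcell hy)).trans ?_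
    refine mul_le_mul_of_nonneg_left ?_ (by positivity)
    refine ENNReal.toReal_mono (measure_ne_top _ _) ((hdom y _).trans (measure_mono ?_))
    intro s hs
    exact lt_of_lt_of_le hs (le_abs_self s)
  have hHi : ∀ x, Integrable (H x) (renewalMeasure P μ0) := fun x =>
    kr_integrable hU (hHm x) hsF x (hHb x)
  have hΦi : ∀ x, Integrable (Φ x) (renewalMeasure P μ0) := fun x =>
    kr_integrable hU (hΦm x) hsE x (hΦb x)
  -- telescoping
  have htel : ∀ x, ∫ y, Φ x y ∂(renewalMeasure P μ0)
      = a + (b - a) * p0 - ∫ w, G (w - x) ∂μ0 := by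
    intro x
    have h1 : HasSum (fun n => ∫ y, Φ x y ∂(chainDist P μ0 n))
      (∫ y, Φ x y ∂(renewalMeasure P μ0)) := hasSum_integral_measure (hΦi x)
    have h2 := h1.tendsto_sum_nat
    have hn : ∀ n, ∫ y, Φ x y ∂(chainDist P μ0 n)
        = ∫ w, G (w - x) ∂(chainDist P μ0 (n + 1)) - ∫ w, G (w - x) ∂(chainDist P μ0 n) := by
      intro n
      have e1 : ∫ w, G (w - x) ∂(chainDist P μ0 (n + 1))
          = ∫ y, ∫ w, G (w - x) ∂(P y) ∂(chainDist P μ0 n) := by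
        simp only [chainDist]
        exact kr_integral_bind _ (hGm x) (fun w => hG.bdd _)
      rw [e1]
      simp only [hΦ, kr_jump_integral x _ hG.cont.measurable]
      rw [integral_sub]
      · exact kr_int_bdd _ ((hGm x).stronglyMeasurable.integral_kernel).measurable
          (fun y => kr_abs_int_le _ fun w => hG.bdd _)
      · exact kr_int_bdd _ (hGm x) (fun y => hG.bdd _)
    simp only [hn] at h2
    simp only [Finset.sum_range_sub (fun n => ∫ w, G (w - x) ∂(chainDist P μ0 n))] at h2
    have h3 := (kr_lim_n hU hp0 hG x).sub_const (∫ w, G (w - x) ∂(chainDist P μ0 0))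
    exact tendsto_nhds_unique h2 h3
  have hμ0 : Tendsto (fun x => ∫ w, G (w - x) ∂μ0) atTop (nhds a) := by
    have := tendsto_integral_filter_of_dominated_convergence (μ := μ0) (l := (atTop : Filter ℝ))
      (F := fun x w => G (w - x)) (f := fun _ => a) (fun _ => A)
      (Eventually.of_forall fun x => (hGm x).aestronglyMeasurable)
      (Eventually.of_forall fun x => Eventually.of_forall fun s => hG.bdd _)
      (integrable_const A) (Eventually.of_forall fun w => ?_)
    · simpa using this
    · refine tendsto_const_nhds.congr' ?_
      filter_upwards [eventually_ge_atTop (w + R)] with x hx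
      exact (hG.left _ (by linarith)).symm
  have hΦt : Tendsto (fun x => ∫ y, Φ x y ∂(renewalMeasure P μ0)) atTop
      (nhds ((b - a) * p0)) := by
    simp only [htel]
    have := hμ0.const_sub (a + (b - a) * p0)
    rwa [add_sub_cancel_left] at this
  have hdiff : Tendsto (fun x => ∫ y, (Φ x y - H x y) ∂(renewalMeasure P μ0)) atTop
      (nhds 0) := by
    refine kr_tannery hU (g := fun x y => Φ x y - H x y) (fun x => (hΦm x).sub (hHm x))
      (hsE.add hsF) ?_ ?_
    · intro x k z hz
      exact (abs_sub _ _).trans (add_le_add (hΦb x k z hz) (hHb x k z hz))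
    · intro k ε hε
      obtain ⟨Y, hY⟩ := eventually_atTop.1 (kr_unif hweak hG (k : ℝ) hε)
      filter_upwards [eventually_ge_atTop (Y - k)] with x hx y hy
      have hc := hcell hy
      have := hY y (by linarith [hy.1]) (y - x) ⟨hc.1.le, hc.2⟩
      simp only [hΦ, hH]
      rwa [sub_sub_sub_cancel_right]
  have hfin := hΦt.sub hdiff
  rw [sub_zero] at hfin
  refine hfin.congr fun x => ?_
  rw [integral_sub (hΦi x) (hHi x)]
  simp [hH]

end Chain
/-! ## Part 5: convergence for test functions -/

section Conv
variable {U : Measure ℝ} [SFinite U] {C : NNReal} {G f : ℝ → ℝ} {R K A a b : ℝ}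

lemma kr_fubini {F : Measure ℝ} [IsProbabilityMeasure F]
    (hU : ∀ x : ℝ, U (Ioc x (x + 1)) ≤ C)
    (hF : ∫⁻ s, ENNReal.ofReal |s| ∂F < ⊤) (hG : KRTest G R K A a b) (x : ℝ) :
    ∫ y, (∫ s, G (y - x + s) ∂F - G (y - x)) ∂U
      = ∫ s, ∫ y, (G (y - x + s) - G (y - x)) ∂U ∂F := by
  have hGm := hG.cont.measurable
  have hmeas : Measurable (Function.uncurry fun y s => G (y - x + s) - G (y - x)) :=
    (hGm.comp (by fun_prop : Measurable fun p : ℝ × ℝ => p.1 - x + p.2)).sub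
      (hGm.comp (by fun_prop : Measurable fun p : ℝ × ℝ => p.1 - x))
  have hitg : Integrable (Function.uncurry fun y s => G (y - x + s) - G (y - x)) (U.prod F) := by
    rw [integrable_prod_iff hmeas.aestronglyMeasurable]
    constructor
    · exact Eventually.of_forall fun y => (hG.integrable F (y - x)).sub
        (integrable_const (G (y - x)))
    · refine kr_integrable hU (kr_Q_meas F hmeas.norm)
        ((kr_tail_summable F hF (R + 2)).mul_left (2 * A)) x ?_
      intro k y hy
      rw [abs_of_nonneg (integral_nonneg fun s => norm_nonneg _)]
      have hz : y - x ∈ Ioc (k : ℝ) (k + 1) := ⟨by linarith [hy.1], by linarith [hy.2]⟩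
      exact hG.integral_diff_le F k hz
  rw [← integral_integral_swap hitg]
  congr 1; ext y
  rw [integral_sub (hG.integrable F (y - x)) (integrable_const _)]
  simp

/-- the renewal function of a test function -/
noncomputable def kru (U : Measure ℝ) (f : ℝ → ℝ) (x : ℝ) : ℝ := ∫ y, f (y - x) ∂U

lemma kr_zero (hf : KRTest f R K A 0 0) {x y : ℝ} (h : R < |y - x|) : f (y - x) = 0 := by
  rcases le_total 0 (y - x) with h0 | h0
  · rw [abs_of_nonneg h0] at h; exact hf.right _ h.le
  · rw [abs_of_nonpos h0] at h; exact hf.left _ (by linarith)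

lemma kru_integrable (hU : ∀ x : ℝ, U (Ioc x (x + 1)) ≤ C) (hf : KRTest f R K A 0 0) (x : ℝ) :
    Integrable (fun y => f (y - x)) U :=
  kr_cpt_integrable hU (hf.cont.measurable.comp (by fun_prop)) (fun _ => hf.bdd _)
    (fun _ h => kr_zero hf h)

lemma kru_bdd (hU : ∀ x : ℝ, U (Ioc x (x + 1)) ≤ C) (hf : KRTest f R K A 0 0) (x : ℝ) :
    |kru U f x| ≤ C * (A * ∑' k, krB R k) :=
  kr_cpt_le hU (hf.cont.measurable.comp (by fun_prop)) (fun _ => hf.bdd _)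
    (fun _ h => kr_zero hf h)

lemma kru_uc (hU : ∀ x : ℝ, U (Ioc x (x + 1)) ≤ C) (hf : KRTest f R K A 0 0) :
    UniformContinuous (kru U f) := by
  have hK := hf.K_nonneg
  set S := ∑' k, krB (R + 1) k with hS
  have hS0 : 0 ≤ S := tsum_nonneg fun k => by unfold krB; split_ifs <;> norm_num
  have key : ∀ x x', |x - x'| ≤ 1 → |kru U f x - kru U f x'| ≤ C * (K * |x - x'| * S) := by
    intro x x' hx
    unfold kru
    rw [← integral_sub (kru_integrable hU hf x) (kru_integrable hU hf x')]
    refine kr_cpt_le hU (x := x) (R := R + 1) (g := fun y => f (y - x) - f (y - x')) ?_ ?_ ?_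
    · exact (hf.cont.measurable.comp (by fun_prop)).sub (hf.cont.measurable.comp (by fun_prop))
    · intro y
      have := hf.lip (y - x) (y - x')
      rwa [show y - x - (y - x') = -(x - x') by ring, abs_neg] at this
    · intro y hy
      have h1 : |y - x| ≤ |y - x'| + |x - x'| := by
        have := abs_sub_le y x' x
        rwa [abs_sub_comm x' x] at this
      rw [kr_zero hf (by linarith : R < |y - x|), kr_zero hf (by linarith : R < |y - x'|), sub_zero]
  rw [Metric.uniformContinuous_iff]
  intro ε hε
  refine ⟨min 1 (ε / (C * (K * S) + 1)), by positivity, fun x x' hx => ?_⟩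
  rw [Real.dist_eq] at hx ⊢
  have h1 : |x - x'| < 1 := hx.trans_le (min_le_left _ _)
  have h2 : |x - x'| < ε / (C * (K * S) + 1) := hx.trans_le (min_le_right _ _)
  rw [lt_div_iff₀ (by positivity)] at h2
  refine (key x x' h1.le).trans_lt ?_
  rcases (abs_nonneg (x - x')).eq_or_lt with h0 | h0
  · rw [← h0]; simpa using hε
  · nlinarith

/-- the antiderivative of a test function -/
noncomputable def krG (f : ℝ → ℝ) (R z : ℝ) : ℝ := ∫ t in (-R)..z, f t

lemma krG_sub (hf : KRTest f R K A 0 0) (x y : ℝ) :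
    krG f R x - krG f R y = ∫ t in y..x, f t := by
  unfold krG
  exact intervalIntegral.integral_interval_sub_left (hf.cont.intervalIntegrable _ _)
    (hf.cont.intervalIntegrable _ _)

lemma krG_test (hf : KRTest f R K A 0 0) (hR : 0 ≤ R) :
    KRTest (krG f R) R A (A * (2 * R)) 0 (∫ t in (-R)..R, f t) := by
  have hA := hf.A_nonneg
  have hleft : ∀ x ≤ -R, krG f R x = 0 := by
    intro x hx
    unfold krG
    rw [intervalIntegral.integral_congr (g := fun _ => 0)]
    · simp
    · intro t ht
      rw [uIcc_of_ge hx] at ht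
      exact hf.left t ht.2
  have hright : ∀ x, R ≤ x → krG f R x = ∫ t in (-R)..R, f t := by
    intro x hx
    have h1 := krG_sub hf x R
    rw [intervalIntegral.integral_congr (g := fun _ => 0)] at h1
    · simp only [intervalIntegral.integral_zero] at h1
      rw [sub_eq_zero.1 h1]; rfl
    · intro t ht
      rw [uIcc_of_le hx] at ht
      exact hf.right t ht.1
  have hlip : ∀ x y, |krG f R x - krG f R y| ≤ A * |x - y| := by
    intro x y
    rw [krG_sub hf]
    exact intervalIntegral.norm_integral_le_of_norm_le_const (f := f) (C := A)
      fun t _ => hf.bdd t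
  refine ⟨hlip, ?_, hleft, hright⟩
  have hmid : ∀ x, -R ≤ x → x ≤ R → |krG f R x| ≤ A * (2 * R) := by
    intro x h1 h2
    have h := hlip x (-R)
    rw [hleft (-R) le_rfl, sub_zero] at h
    refine h.trans (mul_le_mul_of_nonneg_left ?_ hA)
    rw [abs_of_nonneg (by linarith)]; linarith
  intro x
  rcases le_total x (-R) with h | h
  · rw [hleft x h]; simp; positivity
  · rcases le_total x R with h' | h'
    · exact hmid x h h'
    · rw [hright x h']
      exact hmid R (by linarith) le_rfl

lemma kr_v_eq (hU : ∀ x : ℝ, U (Ioc x (x + 1)) ≤ C) (hf : KRTest f R K A 0 0) (x s : ℝ) :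
    ∫ y, (krG f R (y - x + s) - krG f R (y - x)) ∂U = ∫ r in (0 : ℝ)..s, kru U f (x - r) := by
  have hfm := hf.cont.measurable
  have hmeas : Measurable (Function.uncurry fun (r y : ℝ) => f (y - (x - r))) :=
    hfm.comp (by fun_prop : Measurable fun p : ℝ × ℝ => p.2 - (x - p.1))
  have hitg : Integrable (Function.uncurry fun (r y : ℝ) => f (y - (x - r)))
      ((volume.restrict (Set.uIoc 0 s)).prod U) := by
    rw [integrable_prod_iff hmeas.aestronglyMeasurable]
    constructor
    · exact Eventually.of_forall fun r => kru_integrable hU hf (x - r)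
    · refine Measure.integrableOn_of_bounded (M := C * (A * ∑' k, krB R k)) (by simp)
        (hmeas.norm.stronglyMeasurable.integral_prod_right (ν := U)).aestronglyMeasurable ?_
      refine Eventually.of_forall fun r => ?_
      refine kr_cpt_le hU (x := x - r) (g := fun y => ‖f (y - (x - r))‖) ?_ ?_ ?_
      · exact (hfm.comp (by fun_prop)).norm
      · intro y; rw [Real.norm_eq_abs, abs_abs]; exact hf.bdd _
      · intro y hy; rw [kr_zero hf hy, norm_zero]
  unfold kru
  rw [intervalIntegral_integral_swap hitg]
  congr 1; ext y
  rw [krG_sub hf]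
  have := intervalIntegral.integral_comp_add_right (a := 0) (b := s) f (y - x)
  rw [zero_add, add_comm s] at this
  rw [← this]
  congr 1; ext r; congr 1; ring

end Conv

section Final
variable {P : Kernel ℝ ℝ} [IsMarkovKernel P] {μ0 : Measure ℝ} [IsProbabilityMeasure μ0]
variable {C : NNReal} {f : ℝ → ℝ} {R K A : ℝ}

lemma kr_conv {F ηm : Measure ℝ} [IsProbabilityMeasure F] [IsProbabilityMeasure ηm]
    (hU : ∀ x : ℝ, renewalMeasure P μ0 (Ioc x (x + 1)) ≤ C) {p0 : ℝ}
    (hp0 : Tendsto (fun n : ℕ => ((chainDist P μ0 n) (Set.Ioi (0 : ℝ))).toReal)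
      atTop (nhds p0))
    (hweak : ∀ f : BoundedContinuousFunction ℝ ℝ,
      Tendsto (fun x : ℝ => ∫ s, f s ∂(jumpLaw P x)) atTop (nhds (∫ s, f s ∂F)))
    (hF_int : Integrable (fun s : ℝ => s) F)
    (hEpos : 0 < ∫ s, s ∂F)
    (hη : ∫⁻ s, ENNReal.ofReal |s| ∂ηm < ⊤)
    (hdom : ∀ x : ℝ, ∀ t : ℝ, jumpLaw P x {s : ℝ | t < |s|} ≤ ηm {s : ℝ | t < s})
    (hnl : ¬ ∃ a > (0 : ℝ), F {x : ℝ | ∃ k : ℤ, x = k * a} = 1)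
    (hf : KRTest f R K A 0 0) (hR : 0 ≤ R) :
    Tendsto (kru (renewalMeasure P μ0) f) atTop
      (nhds ((∫ t in (-R)..R, f t) * p0 / ∫ s, s ∂F)) := by
  have hF : ∫⁻ s, ENNReal.ofReal |s| ∂F < ⊤ := by
    have := hF_int.2
    rw [hasFiniteIntegral_iff_norm] at this
    simpa using this
  set U := renewalMeasure P μ0 with hUdef
  set u := kru U f with hu
  set M : ℝ := C * (A * ∑' k, krB R k) with hM
  have huM : ∀ x, |u x| ≤ M := kru_bdd hU hf
  have huc : UniformContinuous u := kru_uc hU hf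
  have hcont : Continuous u := huc.continuous
  have hQ : Tendsto (fun x => ∫ s, u (x - s) ∂F - u x) atTop (nhds 0) := by
    have h1 := kr_main hU hp0 hweak hF hη hdom hf
    rw [sub_zero, zero_mul] at h1
    refine h1.congr fun x => ?_
    rw [kr_fubini hU hF hf x]
    have h2 : ∀ s, ∫ y, (f (y - x + s) - f (y - x)) ∂U = u (x - s) - u x := by
      intro s
      simp only [hu, kru]
      rw [← integral_sub (kru_integrable hU hf (x - s)) (kru_integrable hU hf x)]
      congr 1; ext y; congr 2; ring
    simp only [h2]
    rw [integral_sub _ (integrable_const _)]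
    · simp
    · exact kr_int_bdd F (hcont.measurable.comp (by fun_prop)) (fun s => huM _)
  have hcd := kr_choquet_deny huc huM hQ hnl
  have hitg : ∀ x p q : ℝ, IntervalIntegrable (fun r => u (x - r)) volume p q := fun x p q =>
    (hcont.comp (by fun_prop : Continuous fun r => x - r)).intervalIntegrable _ _
  set v : ℝ → ℝ → ℝ := fun x s => ∫ r in (0 : ℝ)..s, u (x - r) with hv
  have hvc : ∀ x, Continuous (v x) := fun x =>
    intervalIntegral.continuous_primitive (hitg x) 0
  have hv1 : Tendsto (fun x => ∫ s, v x s ∂F) atTop (nhds ((∫ t in (-R)..R, f t) * p0)) := by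
    have h1 := kr_main hU hp0 hweak hF hη hdom (krG_test hf hR)
    rw [sub_zero] at h1
    refine h1.congr fun x => ?_
    rw [kr_fubini hU hF (krG_test hf hR) x]
    have h2 := kr_v_eq hU hf x
    simp only [h2, hv, hu]
  have hve : ∀ x s, v x s - s * u x = ∫ r in (0 : ℝ)..s, (u (x - r) - u x) := by
    intro x s
    rw [intervalIntegral.integral_sub (hitg x 0 s) (by simp)]
    simp [hv]
  have hdb : ∀ x y, |u x - u y| ≤ 2 * M := fun x y => by
    have := abs_sub (u x) (u y); linarith [huM x, huM y]
  have hvb : ∀ x s, |v x s - s * u x| ≤ 2 * M * |s| := by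
    intro x s
    rw [hve]
    have := intervalIntegral.norm_integral_le_of_norm_le_const (a := 0) (b := s) (C := 2 * M)
      (f := fun r => u (x - r) - u x) fun r _ => hdb _ _
    simpa using this
  have hvi : ∀ x, Integrable (fun s => v x s - s * u x) F := fun x =>
    Integrable.mono' (hF_int.abs.const_mul (2 * M))
      ((hvc x).sub (continuous_id.mul continuous_const)).aestronglyMeasurable
      (Eventually.of_forall fun s => hvb x s)
  have hv2 : Tendsto (fun x => ∫ s, (v x s - s * u x) ∂F) atTop (nhds 0) := by
    have h := tendsto_integral_filter_of_dominated_convergence (μ := F) (l := (atTop : Filter ℝ))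
      (F := fun x s => v x s - s * u x) (f := fun _ => 0) (fun s => 2 * M * |s|)
      (Eventually.of_forall fun x => (hvi x).aestronglyMeasurable)
      (Eventually.of_forall fun x => Eventually.of_forall fun s => hvb x s)
      (hF_int.abs.const_mul (2 * M)) (Eventually.of_forall fun s => ?_)
    · simpa using h
    · simp only [hve]
      have h := intervalIntegral.tendsto_integral_filter_of_dominated_convergence (μ := volume)
        (a := 0) (b := s) (l := (atTop : Filter ℝ))
        (F := fun x r => u (x - r) - u x) (f := fun _ => 0) (fun _ => 2 * M)
        (Eventually.of_forall fun x => Continuous.aestronglyMeasurable (by fun_prop))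
        (Eventually.of_forall fun x => Eventually.of_forall fun r _ => hdb _ _)
        (by simp) (Eventually.of_forall fun r _ => hcd r)
      simpa using h
  have hfin := (hv1.sub hv2).div_const (∫ s, s ∂F)
  rw [sub_zero] at hfin
  refine hfin.congr fun x => ?_
  have hvi' : Integrable (v x) F := by
    have := (hvi x).add (hF_int.mul_const (u x))
    refine this.congr (Eventually.of_forall fun s => ?_)
    simp
  rw [integral_sub hvi' (hF_int.mul_const (u x)), integral_mul_const]
  field_simp
  ring

end Final

/-! ## Part 6: trapezoids and the final sandwich -/

/-- a trapezoidal test function -/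
noncomputable def krTrap (a b δ z : ℝ) : ℝ := max 0 (min 1 (min ((z - a) / δ) ((b - z) / δ)))

section Trap
variable {a b δ : ℝ}

lemma krTrap_nonneg (z : ℝ) : 0 ≤ krTrap a b δ z := le_max_left _ _

lemma krTrap_le_one (z : ℝ) : krTrap a b δ z ≤ 1 := max_le zero_le_one (min_le_left _ _)

lemma krTrap_left (hδ : 0 < δ) {z : ℝ} (hz : z ≤ a) : krTrap a b δ z = 0 := by
  refine max_eq_left ?_
  refine (min_le_right _ _).trans ((min_le_left _ _).trans ?_)
  exact div_nonpos_of_nonpos_of_nonneg (by linarith) hδ.le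

lemma krTrap_right (hδ : 0 < δ) {z : ℝ} (hz : b ≤ z) : krTrap a b δ z = 0 := by
  refine max_eq_left ?_
  refine (min_le_right _ _).trans ((min_le_right _ _).trans ?_)
  exact div_nonpos_of_nonpos_of_nonneg (by linarith) hδ.le

lemma krTrap_mid (hδ : 0 < δ) {z : ℝ} (h1 : a + δ ≤ z) (h2 : z ≤ b - δ) :
    krTrap a b δ z = 1 := by
  refine le_antisymm (krTrap_le_one z) (le_max_of_le_right (le_min le_rfl (le_min ?_ ?_)))
  · rw [le_div_iff₀ hδ]; linarith
  · rw [le_div_iff₀ hδ]; linarith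

lemma krTrap_test (hδ : 0 < δ) :
    KRTest (krTrap a b δ) (|a| + |b|) (1 / δ) 1 0 0 := by
  refine ⟨fun x y => ?_, fun x => ?_, fun x hx => ?_, fun x hx => ?_⟩
  · have hm : |min ((x - a) / δ) ((b - x) / δ) - min ((y - a) / δ) ((b - y) / δ)|
        ≤ 1 / δ * |x - y| := by
      refine (abs_min_sub_min_le_max _ _ _ _).trans (max_le (le_of_eq ?_) (le_of_eq ?_))
      · rw [show (x - a) / δ - (y - a) / δ = 1 / δ * (x - y) by ring, abs_mul,
          abs_of_pos (by positivity)]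
      · rw [show (b - x) / δ - (b - y) / δ = -(1 / δ * (x - y)) by ring, abs_neg, abs_mul,
          abs_of_pos (by positivity)]
    have h0 : (0 : ℝ) ≤ 1 / δ * |x - y| := by positivity
    refine (abs_max_sub_max_le_max _ _ _ _).trans (max_le (by simpa using h0) ?_)
    exact (abs_min_sub_min_le_max _ _ _ _).trans (max_le (by simpa using h0) hm)
  · rw [abs_of_nonneg (krTrap_nonneg x)]; exact krTrap_le_one x
  · exact krTrap_left hδ (by linarith [neg_abs_le a, abs_nonneg b])
  · exact krTrap_right hδ (by linarith [le_abs_self b, abs_nonneg a])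

lemma krTrap_integral_le (hδ : 0 < δ) (hab : a ≤ b) :
    ∫ t in (-(|a| + |b|))..(|a| + |b|), krTrap a b δ t ≤ b - a := by
  have hi : ∀ p q : ℝ, IntervalIntegrable (krTrap a b δ) volume p q := fun p q =>
    (krTrap_test hδ).cont.intervalIntegrable _ _
  rw [← intervalIntegral.integral_add_adjacent_intervals (hi _ a) (hi a _),
    ← intervalIntegral.integral_add_adjacent_intervals (hi a b) (hi b _)]
  have h1 : ∫ t in (-(|a| + |b|))..a, krTrap a b δ t = 0 := by
    rw [intervalIntegral.integral_congr (g := fun _ => 0)]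
    · simp
    · intro t ht
      rw [uIcc_of_le (by linarith [neg_abs_le a, abs_nonneg b])] at ht
      exact krTrap_left hδ ht.2
  have h2 : ∫ t in b..(|a| + |b|), krTrap a b δ t = 0 := by
    rw [intervalIntegral.integral_congr (g := fun _ => 0)]
    · simp
    · intro t ht
      rw [uIcc_of_le (by linarith [le_abs_self b, abs_nonneg a])] at ht
      exact krTrap_right hδ ht.1
  have h3 := intervalIntegral.integral_mono_on hab (hi a b)
    (intervalIntegrable_const (c := (1 : ℝ))) (fun t _ => krTrap_le_one t)
  simp at h3
  linarith

lemma krTrap_le_integral (hδ : 0 < δ) (hab : a + δ ≤ b - δ) :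
    b - a - 2 * δ ≤ ∫ t in (-(|a| + |b|))..(|a| + |b|), krTrap a b δ t := by
  have h1 := intervalIntegral.integral_mono_interval (μ := volume) (f := krTrap a b δ)
    (c := -(|a| + |b|)) (d := |a| + |b|) (a := a + δ) (b := b - δ)
    (by linarith [neg_abs_le a, abs_nonneg b]) hab (by linarith [le_abs_self b, abs_nonneg a])
    (Eventually.of_forall fun t => krTrap_nonneg t)
    ((krTrap_test hδ).cont.intervalIntegrable _ _)
  rw [intervalIntegral.integral_congr (g := fun _ => (1 : ℝ))] at h1
  · rw [intervalIntegral.integral_const, smul_eq_mul, mul_one] at h1; linarith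
  · intro t ht
    rw [uIcc_of_le hab] at ht
    exact krTrap_mid hδ ht.1 ht.2

end Trap

lemma kr_sup_bound {U : Measure ℝ} (hU : (⨆ k : ℤ, U (Set.Ioc (k : ℝ) (k + 1))) < ⊤) :
    ∃ C : NNReal, ∀ x : ℝ, U (Ioc x (x + 1)) ≤ C := by
  obtain ⟨C, hC⟩ := ENNReal.lt_iff_exists_coe.1 hU
  refine ⟨2 * C, fun x => ?_⟩
  have hk : ∀ k : ℤ, U (Ioc (k : ℝ) (k + 1)) ≤ C := fun k => by
    rw [← hC.1]; exact le_iSup (fun k : ℤ => U (Set.Ioc (k : ℝ) (k + 1))) k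
  have hsub : Ioc x (x + 1) ⊆ Ioc (⌊x⌋ : ℝ) (⌊x⌋ + 1) ∪
      Ioc ((⌊x⌋ + 1 : ℤ) : ℝ) ((⌊x⌋ + 1 : ℤ) + 1) := by
    intro y hy
    have h1 := Int.floor_le x
    have h2 := Int.lt_floor_add_one x
    push_cast
    rcases le_or_gt y (⌊x⌋ + 1) with h | h
    · exact Or.inl ⟨by linarith [hy.1], h⟩
    · exact Or.inr ⟨h, by linarith [hy.2]⟩
  refine (measure_mono hsub).trans ((measure_union_le _ _).trans ?_)
  refine (add_le_add (hk _) (hk _)).trans (le_of_eq ?_)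
  push_cast; ring

/-- **The key renewal theorem for a transient Markov chain, non-lattice case.**
If the jumps `ξ(x)` converge weakly as `x → ∞` to a random variable `ξ` with
distribution `F` and `E ξ > 0`; the family `{|ξ(x)|}` is stochastically dominated
by an integrable random variable `η`; the renewal measure `U` is bounded on unit
intervals; `P{X_n > 0} → p₀`; and `F` is non-lattice, then
`U(x, x+h] → p₀ h / E ξ` as `x → ∞`, for every fixed `h > 0`. -/
theorem key_renewal_theorem_nonlattice
    (P : Kernel ℝ ℝ) [IsMarkovKernel P]
    (μ0 : Measure ℝ) [IsProbabilityMeasure μ0]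
    (F : Measure ℝ) [IsProbabilityMeasure F]
    (ηm : Measure ℝ) [IsProbabilityMeasure ηm]
    -- (i) weak convergence of the jumps to `F`:
    (hweak : ∀ f : BoundedContinuousFunction ℝ ℝ,
      Tendsto (fun x : ℝ => ∫ s, f s ∂(jumpLaw P x)) atTop (nhds (∫ s, f s ∂F)))
    -- positive limiting drift `E ξ > 0`:
    (hF_int : Integrable (fun s : ℝ => s) F)
    (hEpos : 0 < ∫ s, s ∂F)
    -- (ii) integrable stochastic majorant `η`:
    (hdom : ∀ x : ℝ, ∀ t : ℝ, jumpLaw P x {s : ℝ | t < |s|} ≤ ηm {s : ℝ | t < s})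
    (hη_int : ∫⁻ s, ENNReal.ofReal |s| ∂ηm < ⊤)
    -- (iii) the renewal measure is bounded on unit intervals:
    (hU : (⨆ k : ℤ, renewalMeasure P μ0 (Set.Ioc (k : ℝ) (k + 1))) < ⊤)
    -- (iv) existence of the limit `p₀ = lim P{X_n > 0}`:
    (p0 : ℝ)
    (hp0 : Tendsto (fun n : ℕ => ((chainDist P μ0 n) (Set.Ioi (0 : ℝ))).toReal)
      atTop (nhds p0))
    -- `F` is non-lattice:
    (hnonlattice : ¬ ∃ a > (0 : ℝ), F {x : ℝ | ∃ k : ℤ, x = k * a} = 1)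
    (h : ℝ) (hh : 0 < h) :
    Tendsto (fun x : ℝ => (renewalMeasure P μ0 (Set.Ioc x (x + h))).toReal)
      atTop (nhds (p0 * h / ∫ s, s ∂F)) := by
  obtain ⟨C, hC⟩ := kr_sup_bound hU
  set U := renewalMeasure P μ0 with hUdef
  set m := ∫ s, s ∂F with hm
  have hp0' : 0 ≤ p0 := ge_of_tendsto' hp0 fun n => ENNReal.toReal_nonneg
  have hconv : ∀ a b δ : ℝ, 0 < δ → Tendsto (kru U (krTrap a b δ)) atTop
      (nhds ((∫ t in (-(|a| + |b|))..(|a| + |b|), krTrap a b δ t) * p0 / m)) :=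
    fun a b δ hδ => kr_conv hC hp0 hweak hF_int hEpos hη_int hdom hnonlattice
      (krTrap_test hδ) (by positivity)
  have hind : ∀ x, (U (Ioc x (x + h))).toReal
      = ∫ y, indicator (Ioc x (x + h)) (fun _ => (1 : ℝ)) y ∂U := by
    intro x
    rw [integral_indicator_const _ measurableSet_Ioc]; simp [Measure.real]
  have hindi : ∀ x, Integrable (indicator (Ioc x (x + h)) (fun _ => (1 : ℝ))) U := by
    intro x
    refine kr_cpt_integrable hC (R := h) (c := 1) (x := x)
      (measurable_const.indicator measurableSet_Ioc) (fun y => ?_) (fun y hy => ?_)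
    · by_cases hy : y ∈ Ioc x (x + h) <;> simp [hy]
    · refine indicator_of_notMem (fun hy' => ?_) _
      rw [abs_of_pos (by linarith [hy'.1])] at hy
      linarith [hy'.2]
  have hlow : ∀ δ > 0, ∀ x, kru U (krTrap 0 h δ) x ≤ (U (Ioc x (x + h))).toReal := by
    intro δ hδ x
    rw [hind]
    refine integral_mono (kru_integrable hC (krTrap_test hδ) x) (hindi x) fun y => ?_
    by_cases hy : y ∈ Ioc x (x + h)
    · simpa [hy] using krTrap_le_one (a := 0) (b := h) (δ := δ) (y - x)
    · simp only [indicator_of_notMem hy]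
      rcases le_or_gt y x with h1 | h1
      · exact (krTrap_left hδ (by linarith)).le
      · have : x + h < y := by
          by_contra h2; exact hy ⟨h1, not_lt.1 h2⟩
        exact (krTrap_right hδ (by linarith)).le
  have hup : ∀ δ > 0, ∀ x, (U (Ioc x (x + h))).toReal ≤ kru U (krTrap (-δ) (h + δ) δ) x := by
    intro δ hδ x
    rw [hind]
    refine integral_mono (hindi x) (kru_integrable hC (krTrap_test hδ) x) fun y => ?_
    by_cases hy : y ∈ Ioc x (x + h)
    · simp only [indicator_of_mem hy]
      exact (krTrap_mid hδ (by linarith [hy.1]) (by linarith [hy.2])).ge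
    · simp only [indicator_of_notMem hy]
      exact krTrap_nonneg _
  have hcl : Tendsto (fun δ : ℝ => (h - 2 * δ) * p0 / m) (nhdsWithin 0 (Ioi 0))
      (nhds (p0 * h / m)) := by
    have : Continuous fun δ : ℝ => (h - 2 * δ) * p0 / m := by fun_prop
    have h1 := (this.tendsto 0).mono_left (nhdsWithin_le_nhds (s := Ioi 0))
    simpa [mul_comm] using h1
  have hcu : Tendsto (fun δ : ℝ => (h + 2 * δ) * p0 / m) (nhdsWithin 0 (Ioi 0))
      (nhds (p0 * h / m)) := by
    have : Continuous fun δ : ℝ => (h + 2 * δ) * p0 / m := by fun_prop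
    have h1 := (this.tendsto 0).mono_left (nhdsWithin_le_nhds (s := Ioi 0))
    simpa [mul_comm] using h1
  have hpos : ∀ᶠ δ : ℝ in nhdsWithin 0 (Ioi 0), 0 < δ := self_mem_nhdsWithin
  have hsm : ∀ᶠ δ : ℝ in nhdsWithin 0 (Ioi 0), δ < h / 4 :=
    nhdsWithin_le_nhds (eventually_lt_nhds (by positivity))
  refine tendsto_order.2 ⟨fun l hl => ?_, fun l hl => ?_⟩
  · obtain ⟨δ, ⟨h1, hδ⟩, hδh⟩ :=
      (((hcl.eventually (eventually_gt_nhds hl)).and hpos).and hsm).exists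
    have h2 : l < (∫ t in (-(|0| + |h|))..(|0| + |h|), krTrap 0 h δ t) * p0 / m := by
      refine h1.trans_le ?_
      have := krTrap_le_integral (a := 0) (b := h) hδ (by linarith)
      gcongr
      linarith
    filter_upwards [(hconv 0 h δ hδ).eventually (eventually_gt_nhds h2)] with x hx
    exact hx.trans_le (hlow δ hδ x)
  · obtain ⟨δ, ⟨h1, hδ⟩, hδh⟩ :=
      (((hcu.eventually (eventually_lt_nhds hl)).and hpos).and hsm).exists
    have h2 : (∫ t in (-(|(-δ)| + |h + δ|))..(|(-δ)| + |h + δ|), krTrap (-δ) (h + δ) δ t)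
        * p0 / m < l := by
      refine lt_of_le_of_lt ?_ h1
      have := krTrap_integral_le (a := -δ) (b := h + δ) hδ (by linarith)
      gcongr
      linarith
    filter_upwards [(hconv (-δ) (h + δ) δ hδ).eventually (eventually_lt_nhds h2)] with x hx
    exact (hup δ hδ x).trans_lt hx
end

section
/- Let $X_n$ be a time-homogeneous Markov chain valued in $\mathbf{Z}$ with jump variables $\xi(x)$ and renewal measure $U$. Suppose: (i) the distributions of $\xi(x)$ converge weakly as $x\to\infty$ to the distribution $F$ of an integer-valued random variable $\xi$ with $\mathbf{E}\xi>0$, and $\mathbf{Z}$ is the lattice of minimal span for $F$; (ii) there is a random variable $\eta$ with $\mathbf{E}\eta<\infty$ such that $|\xi(x)|\le_{\rm st}\eta$ for all $x$; (iii) $\sup_{k\in\mathbf{Z}}U\{k\}<\infty$; (iv) the limit $p_0=\lim_{n\to\infty}\mathbf{P}\{X_n>0\}$ exists. Then $U\{n\}\to p_0/\mathbf{E}\xi$ as $n\to\infty$. -/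
open MeasureTheory ProbabilityTheory Filter Set

/-- The distribution of the integer-valued Markov chain with transition kernel `P`
and initial distribution `μ0` at time `n`. -/
noncomputable def chainDistZ (P : Kernel ℤ ℤ) (μ0 : Measure ℤ) : ℕ → Measure ℤ
  | 0 => μ0
  | n + 1 => (chainDistZ P μ0 n).bind P

/-- The renewal measure `U(B) = ∑_{n≥0} P{X_n ∈ B}`. -/
noncomputable def renewalMeasureZ (P : Kernel ℤ ℤ) (μ0 : Measure ℤ) : Measure ℤ :=
  Measure.sum (chainDistZ P μ0)

/-- The law of the jump `ξ(x)` of the chain at state `x`. -/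
noncomputable def jumpLawZ (P : Kernel ℤ ℤ) (x : ℤ) : Measure ℤ :=
  (P x).map (fun y => y - x)


/-- limits along ultrafilters of bounded functions -/
lemma exists_ultra_lim {ι : Type*} (l : Ultrafilter ι) (g : ι → ℝ) (C : ℝ) (h : ∀ i, |g i| ≤ C) :
    ∃ a, |a| ≤ C ∧ Tendsto g l (nhds a) := by
  have := (isCompact_Icc (a := -C) (b := C)).ultrafilter_le_nhds (l.map g) (by
    rw [Filter.le_principal_iff]
    change g ⁻¹' (Icc (-C) C) ∈ l
    refine Filter.mem_of_superset Filter.univ_mem ?_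
    intro i _
    exact abs_le.1 (h i))
  obtain ⟨a, ha, h2⟩ := this
  exact ⟨a, abs_le.2 ha, h2⟩

lemma harmonic_shift {ι : Type*} (l : Filter ι) (f : ℤ → ℝ) (hf0 : ∀ s, 0 ≤ f s) (hf : HasSum f 1)
    (C : ℝ) (w : ℤ → ℝ) (hw : ∀ k, |w k| ≤ C) (hh : ∀ k, HasSum (fun s => w (k - s) * f s) (w k))
    (φ : ι → ℤ) [l.NeBot] (w' : ℤ → ℝ) (hw' : ∀ k, Tendsto (fun i => w (φ i + k)) l (nhds (w' k))) (k : ℤ) :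
    w' k = ∑' s, w' (k - s) * f s := by
  have h1 := tendsto_tsum_of_dominated_convergence (𝓕 := l) (f := fun i s => w (φ i + k - s) * f s)
    (g := fun s => w' (k - s) * f s) (bound := fun s => C * f s) (hf.summable.mul_left C)
    (fun s => by
      have := (hw' (k - s)).mul_const (f s)
      simpa only [add_sub_assoc] using this)
    (Eventually.of_forall fun i s => by
      rw [Real.norm_eq_abs, abs_mul, abs_of_nonneg (hf0 s)]
      exact mul_le_mul_of_nonneg_right (hw _) (hf0 s))
  refine tendsto_nhds_unique (hw' k) (h1.congr fun i => ?_)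
  exact (hh (φ i + k)).tsum_eq

lemma harmonic_summable (f : ℤ → ℝ) (hf0 : ∀ s, 0 ≤ f s) (hf : HasSum f 1)
    (C : ℝ) (w : ℤ → ℝ) (hw : ∀ k, |w k| ≤ C) (k : ℤ) : Summable (fun s => w (k - s) * f s) := by
  refine Summable.of_norm_bounded (hf.summable.mul_left C) fun s => ?_
  rw [Real.norm_eq_abs, abs_mul, abs_of_nonneg (hf0 s)]
  exact mul_le_mul_of_nonneg_right (hw _) (hf0 s)

lemma choquet_aux (f : ℤ → ℝ) (hf0 : ∀ s, 0 ≤ f s) (hf : HasSum f 1)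
    (C : ℝ) (w : ℤ → ℝ) (hw : ∀ k, |w k| ≤ C) (hh : ∀ k, HasSum (fun s => w (k - s) * f s) (w k))
    (s : ℤ) (hs : f s ≠ 0) (k : ℤ) : w k - w (k - s) ≤ 0 := by
  by_contra! hpos
  set v : ℤ → ℝ := fun k => w k - w (k - s) with hv
  have hbdd : BddAbove (range v) := by
    refine ⟨C + C, ?_⟩
    rintro _ ⟨j, rfl⟩
    have h1 := abs_le.1 (hw j)
    have h2 := abs_le.1 (hw (j - s))
    simp only [hv]; linarith
  set β := sSup (range v) with hβ
  have hle : ∀ j, v j ≤ β := fun j => le_csSup hbdd ⟨j, rfl⟩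
  have hβpos : 0 < β := lt_of_lt_of_le hpos (hle k)
  have hmem : β ∈ closure (range v) := csSup_mem_closure ⟨_, ⟨k, rfl⟩⟩ hbdd
  have hne : (comap v (nhds β)).NeBot := by
    rw [comap_neBot_iff]
    intro t ht
    obtain ⟨x, hx, j, rfl⟩ := mem_closure_iff_nhds.1 hmem t ht
    exact ⟨j, hx⟩
  let l := Ultrafilter.of (comap v (nhds β))
  have hl : Tendsto v l (nhds β) := tendsto_comap.mono_left (Ultrafilter.of_le _)
  choose w' hw'b hw' using fun k => exists_ultra_lim l (fun i => w (i + k)) C (fun i => hw _)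
  have hh' := harmonic_shift (l : Filter ℤ) f hf0 hf C w hw hh id w' hw'
  have hsum' := harmonic_summable f hf0 hf C w' hw'b
  set v' : ℤ → ℝ := fun k => w' k - w' (k - s) with hv'
  have hlim : ∀ j, Tendsto (fun i => v (i + j)) l (nhds (v' j)) := by
    intro j
    have := (hw' j).sub (hw' (j - s))
    simpa only [hv, hv', add_sub_assoc] using this
  have hv'le : ∀ j, v' j ≤ β := fun j => le_of_tendsto (hlim j) (Eventually.of_forall fun i => hle _)
  have hv'0 : v' 0 = β := by
    have := hlim 0
    simp only [add_zero] at this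
    exact tendsto_nhds_unique this hl
  have hharm : ∀ j, HasSum (fun t => v' (j - t) * f t) (v' j) := by
    intro j
    have h1 := (hsum' j).hasSum
    have h2 := (hsum' (j - s)).hasSum
    rw [← hh'] at h1 h2
    have := h1.sub h2
    refine this.congr_fun ?_ |> fun h => h
    intro t
    simp only [hv']
    rw [show j - t - s = j - s - t by ring]; ring
  have hstep : ∀ j, v' j = β → v' (j - s) = β := by
    intro j hj
    have h1 : HasSum (fun t => (β - v' (j - t)) * f t) 0 := by
      have := (hf.mul_left β).sub (hharm j)
      rw [hj] at this
      simp only [mul_one, sub_self] at this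
      have e : (fun t => (β - v' (j - t)) * f t) = fun t => β * f t - v' (j - t) * f t := by
        funext t; ring
      rw [e]; exact this
    have h2 := (hasSum_zero_iff_of_nonneg (fun t => mul_nonneg (sub_nonneg.2 (hv'le _)) (hf0 t))).1 h1
    have h3 := congrFun h2 s
    simp only [Pi.zero_apply, mul_eq_zero, hs, or_false] at h3
    linarith
  have hall : ∀ m : ℕ, v' (-(m * s)) = β := by
    intro m
    induction m with
    | zero => simpa using hv'0
    | succ m ih =>
      have := hstep _ ih
      rw [← this]; congr 1; push_cast; ring
  have htel : ∀ m : ℕ, w' 0 - w' (-(m * s)) = m * β := by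
    intro m
    induction m with
    | zero => simp
    | succ m ih =>
      have h1 := hall m
      simp only [hv'] at h1
      rw [show -((((m + 1 : ℕ) : ℤ)) * s) = -(m * s) - s by push_cast; ring]
      push_cast
      linarith
  obtain ⟨m, hm⟩ := exists_nat_gt ((C + C) / β)
  rw [div_lt_iff₀ hβpos] at hm
  have h1 := abs_le.1 (hw'b 0)
  have h2 := abs_le.1 (hw'b (-(m * s)))
  have := htel m
  linarith

lemma choquet_deny (f : ℤ → ℝ) (hf0 : ∀ s, 0 ≤ f s) (hf : HasSum f 1)
    (hgen : ∀ H : AddSubgroup ℤ, (∀ s, f s ≠ 0 → s ∈ H) → H = ⊤)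
    (C : ℝ) (w : ℤ → ℝ) (hw : ∀ k, |w k| ≤ C) (hh : ∀ k, HasSum (fun s => w (k - s) * f s) (w k))
    (k : ℤ) : w k = w 0 := by
  let H : AddSubgroup ℤ :=
    { carrier := {s | ∀ k, w (k + s) = w k}
      zero_mem' := by simp
      add_mem' := by
        intro a b ha hb k
        rw [← add_assoc, hb, ha]
      neg_mem' := by
        intro a ha k
        have := ha (k + -a)
        rw [← this]; simp }
  have hH := hgen H (by
    intro s hs k
    have h1 := choquet_aux f hf0 hf C w hw hh s hs (k + s)
    have h2 := choquet_aux f hf0 hf C (fun k => - w k) (by simpa using hw)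
      (fun k => by simpa using (hh k).neg) s hs (k + s)
    simp only [add_sub_cancel_right] at h1 h2
    linarith)
  have : k ∈ H := by rw [hH]; trivial
  simpa using this 0

lemma summable_tail (ηm : Measure ℝ) [IsProbabilityMeasure ηm]
    (hη_int : ∫⁻ s, ENNReal.ofReal |s| ∂ηm < ⊤) :
    Summable (fun s : ℤ => ηm.real {t : ℝ | |(s : ℝ)| - 1 < t}) := by
  have hI : Integrable (fun x : ℝ => |x|) ηm := by
    refine ⟨by fun_prop, ?_⟩
    rw [hasFiniteIntegral_iff_norm]
    simpa using hη_int
  have h0 : (∑' j : ℕ, ηm {t : ℝ | (j : ℝ) < |t|}) < ⊤ :=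
    letI : MeasureSpace ℝ := ⟨ηm⟩
    tsum_prob_mem_Ioi_lt_top (Ω := ℝ) hI (fun x => abs_nonneg x)
  have h1 : Summable (fun j : ℕ => ηm.real {t : ℝ | (j : ℝ) < |t|}) :=
    ENNReal.summable_toReal h0.ne
  have h2 : Summable (fun j : ℕ => ηm.real {t : ℝ | (j : ℝ) - 1 < t}) := by
    rw [← summable_nat_add_iff 1]
    refine Summable.of_nonneg_of_le (fun _ => measureReal_nonneg) (fun j => ?_) h1
    refine measureReal_mono ?_
    intro t ht
    simp only [mem_ofPred_eq] at ht ⊢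
    push_cast at ht
    have := le_abs_self t
    linarith
  rw [summable_int_iff_summable_nat_and_neg]
  constructor <;> simpa using h2

lemma mean_eq (F : Measure ℤ) [IsProbabilityMeasure F]
    (hF_int : Integrable (fun s : ℤ => (s : ℝ)) F) :
    ∫ s, (s : ℝ) ∂F = (∑' s : ℤ, if 0 ≤ s then F.real (Ioi s) else 0)
      - ∑' s : ℤ, if s < 0 then F.real (Iic s) else 0 := by
  rw [integral_eq_lintegral_pos_part_sub_lintegral_neg_part hF_int]
  have h1 : ∫⁻ x : ℤ, ENNReal.ofReal (x : ℝ) ∂F = ∑' s : ℤ, if 0 ≤ s then F (Ioi s) else 0 := by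
    have : ∀ x : ℤ, ENNReal.ofReal (x : ℝ) = ∑' s : ℤ, (if 0 ≤ s then (Ioi s).indicator 1 x else 0) := by
      intro x
      rw [tsum_eq_sum (s := Finset.Ico 0 x), Finset.sum_congr rfl (g := fun _ => 1)]
      · simp only [Finset.sum_const, Int.card_Ico, sub_zero, nsmul_eq_mul, mul_one]
        rw [← ENNReal.ofReal_natCast]
        rcases le_total 0 x with h | h
        · congr 1; exact_mod_cast (Int.toNat_of_nonneg h).symm
        · rw [Int.toNat_of_nonpos h, ENNReal.ofReal_of_nonpos (by exact_mod_cast h)]; simp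
      · intro s hs
        rw [Finset.mem_Ico] at hs
        simp [hs.1, hs.2]
      · intro s hs
        rw [Finset.mem_Ico] at hs
        by_cases h : 0 ≤ s
        · have : ¬ s < x := fun h2 => hs ⟨h, h2⟩
          simp [this]
        · simp [h]
    simp_rw [this]
    rw [lintegral_tsum (fun _ => by measurability)]
    refine tsum_congr fun s => ?_
    split_ifs
    · rw [lintegral_indicator_one (by measurability)]
    · simp
  have h2 : ∫⁻ x : ℤ, ENNReal.ofReal (-(x : ℝ)) ∂F = ∑' s : ℤ, if s < 0 then F (Iic s) else 0 := by
    have : ∀ x : ℤ, ENNReal.ofReal (-(x : ℝ)) = ∑' s : ℤ, (if s < 0 then (Iic s).indicator 1 x else 0) := by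
      intro x
      rw [tsum_eq_sum (s := Finset.Ico x 0), Finset.sum_congr rfl (g := fun _ => 1)]
      · simp only [Finset.sum_const, Int.card_Ico, zero_sub, nsmul_eq_mul, mul_one]
        rw [← ENNReal.ofReal_natCast]
        rcases le_total 0 (-x) with h | h
        · congr 1; exact_mod_cast (Int.toNat_of_nonneg h).symm
        · rw [Int.toNat_of_nonpos h, ENNReal.ofReal_of_nonpos (by exact_mod_cast h)]; simp
      · intro s hs
        rw [Finset.mem_Ico] at hs
        simp [hs.1, hs.2]
      · intro s hs
        rw [Finset.mem_Ico] at hs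
        by_cases h : s < 0
        · have : ¬ x ≤ s := fun h2 => hs ⟨h2, h⟩
          simp [this]
        · simp [h]
    simp_rw [this]
    rw [lintegral_tsum (fun _ => by measurability)]
    refine tsum_congr fun s => ?_
    split_ifs
    · rw [lintegral_indicator_one (by measurability)]
    · simp
  rw [h1, h2, ENNReal.tsum_toReal_eq, ENNReal.tsum_toReal_eq]
  · congr 1 <;>
    · refine tsum_congr fun s => ?_
      split_ifs <;> simp [Measure.real]
  · intro s; split_ifs <;> simp
  · intro s; split_ifs <;> simp

instance chainDistZ_prob (P : Kernel ℤ ℤ) [IsMarkovKernel P]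
    (μ0 : Measure ℤ) [IsProbabilityMeasure μ0] (n : ℕ) : IsProbabilityMeasure (chainDistZ P μ0 n) := by
  induction n with
  | zero => simpa [chainDistZ]
  | succ n ih => simp only [chainDistZ]; infer_instance

instance jumpLawZ_prob (P : Kernel ℤ ℤ) [IsMarkovKernel P] (x : ℤ) :
    IsProbabilityMeasure (jumpLawZ P x) := by
  unfold jumpLawZ
  exact Measure.isProbabilityMeasure_map (by fun_prop)

lemma jumpLawZ_apply (P : Kernel ℤ ℤ) (x : ℤ) (A : Set ℤ) :
    jumpLawZ P x A = P x ((fun y => y - x) ⁻¹' A) := by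
  unfold jumpLawZ
  rw [Measure.map_apply (by fun_prop) (MeasurableSet.of_discrete)]

lemma chain_succ (P : Kernel ℤ ℤ) (μ0 : Measure ℤ) (n : ℕ) (A : Set ℤ) :
    chainDistZ P μ0 (n + 1) A = ∑' x, chainDistZ P μ0 n {x} * P x A := by
  simp only [chainDistZ]
  rw [Measure.bind_apply MeasurableSet.of_discrete P.aemeasurable, lintegral_countable']
  exact tsum_congr fun x => mul_comm _ _

lemma renewal_apply (P : Kernel ℤ ℤ) (μ0 : Measure ℤ) (A : Set ℤ) :
    renewalMeasureZ P μ0 A = ∑' n, chainDistZ P μ0 n A := by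
  unfold renewalMeasureZ
  rw [Measure.sum_apply _ MeasurableSet.of_discrete]

lemma renewal_mul (P : Kernel ℤ ℤ) (μ0 : Measure ℤ) (g : ℤ → ENNReal) :
    ∑' x, renewalMeasureZ P μ0 {x} * g x = ∑' n, ∑' x, chainDistZ P μ0 n {x} * g x := by
  rw [ENNReal.tsum_comm]
  refine tsum_congr fun x => ?_
  rw [renewal_apply, ENNReal.tsum_mul_right]

lemma renewal_eq (P : Kernel ℤ ℤ) (μ0 : Measure ℤ) (k : ℤ) :
    renewalMeasureZ P μ0 {k} = μ0 {k} + ∑' x, renewalMeasureZ P μ0 {x} * jumpLawZ P x {k - x} := by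
  rw [renewal_mul, renewal_apply, tsum_eq_zero_add' ENNReal.summable]
  congr 1
  refine tsum_congr fun n => ?_
  rw [chain_succ]
  refine tsum_congr fun x => ?_
  rw [jumpLawZ_apply]
  congr 2
  ext y
  simp

/-- upward crossing set -/
def upSet (s : ℤ) : Set ℤ := if 0 ≤ s then Ioi s else ∅
/-- downward crossing set -/
def downSet (s : ℤ) : Set ℤ := if s < 0 then Iic s else ∅

lemma flux_one (P : Kernel ℤ ℤ) [IsMarkovKernel P] (μ0 : Measure ℤ) (m : ℕ) (n : ℤ) :
    chainDistZ P μ0 (m + 1) (Ioi n) + ∑' x, chainDistZ P μ0 m {x} * jumpLawZ P x (downSet (n - x))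
     = chainDistZ P μ0 m (Ioi n) + ∑' x, chainDistZ P μ0 m {x} * jumpLawZ P x (upSet (n - x)) := by
  have h : chainDistZ P μ0 m (Ioi n) = ∑' x, chainDistZ P μ0 m {x} * (if n < x then 1 else 0) := by
    rw [← lintegral_indicator_one MeasurableSet.of_discrete, lintegral_countable']
    refine tsum_congr fun x => ?_
    rw [mul_comm]; congr 1
    simp [Set.indicator_apply]
  rw [h, chain_succ, ← ENNReal.tsum_add, ← ENNReal.tsum_add]
  refine tsum_congr fun x => ?_
  rw [← mul_add, ← mul_add]
  congr 1
  rw [jumpLawZ_apply, jumpLawZ_apply]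
  by_cases hx : n < x
  · have h1 : (fun y => y - x) ⁻¹' downSet (n - x) = (Ioi n)ᶜ := by
      ext y; simp [downSet, hx]
    have h2 : upSet (n - x) = ∅ := by simp [upSet, hx]
    rw [h1, h2, measure_add_measure_compl MeasurableSet.of_discrete]
    simp [hx]
  · have h1 : (fun y => y - x) ⁻¹' upSet (n - x) = (Ioi n) := by
      ext y; simp [upSet, not_lt.1 hx]
    have h2 : downSet (n - x) = ∅ := by simp [downSet, not_lt.1 hx]
    rw [h1, h2]
    simp [hx]

lemma flux_sum (P : Kernel ℤ ℤ) [IsMarkovKernel P] (μ0 : Measure ℤ) (N : ℕ) (n : ℤ) :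
    chainDistZ P μ0 N (Ioi n) + ∑ m ∈ Finset.range N,
        ∑' x, chainDistZ P μ0 m {x} * jumpLawZ P x (downSet (n - x))
     = μ0 (Ioi n) + ∑ m ∈ Finset.range N,
        ∑' x, chainDistZ P μ0 m {x} * jumpLawZ P x (upSet (n - x)) := by
  induction N with
  | zero => simp [chainDistZ]
  | succ N ih =>
    rw [Finset.sum_range_succ, Finset.sum_range_succ, ← add_assoc (μ0 _), ← ih,
      add_comm (Finset.sum _ _), ← add_assoc, flux_one]
    ring

lemma tendsto_above (P : Kernel ℤ ℤ) [IsMarkovKernel P] (μ0 : Measure ℤ) [IsProbabilityMeasure μ0]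
    (hU : ∀ k : ℤ, renewalMeasureZ P μ0 {k} ≠ ⊤) (p0 : ℝ)
    (hp0 : Tendsto (fun n : ℕ => ((chainDistZ P μ0 n) {x : ℤ | 0 < x}).toReal)
      atTop (nhds p0)) (n : ℤ) (hn : 0 ≤ n) :
    Tendsto (fun N => chainDistZ P μ0 N (Ioi n)) atTop (nhds (ENNReal.ofReal p0)) := by
  have hsmall : ∀ k : ℤ, Tendsto (fun N => chainDistZ P μ0 N {k}) atTop (nhds 0) := by
    intro k
    have := hU k
    rw [renewal_apply] at this
    exact ENNReal.tendsto_atTop_zero_of_tsum_ne_top this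
  have h1 : Tendsto (fun N => ∑ k ∈ Finset.Ioc 0 n, chainDistZ P μ0 N {k}) atTop (nhds 0) := by
    have := tendsto_finsetSum (Finset.Ioc 0 n) (fun k _ => hsmall k)
    simpa using this
  have h2 : Tendsto (fun N => chainDistZ P μ0 N (Ioi 0)) atTop (nhds (ENNReal.ofReal p0)) := by
    have := ENNReal.tendsto_ofReal hp0
    refine this.congr fun N => ?_
    rw [ENNReal.ofReal_toReal (measure_ne_top _ _)]
    rfl
  have h3 := ENNReal.Tendsto.sub h2 h1 (Or.inr (by simp))
  rw [tsub_zero] at h3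
  refine h3.congr fun N => ?_
  rw [sum_measure_singleton]
  have : Ioi (0:ℤ) = Ioi n ∪ ↑(Finset.Ioc 0 n) := by
    ext y; simp; omega
  rw [this, measure_union _ MeasurableSet.of_discrete]
  · exact ENNReal.add_sub_cancel_right (measure_ne_top _ _)
  · rw [Set.disjoint_left]; intro y; simp; omega

lemma flux (P : Kernel ℤ ℤ) [IsMarkovKernel P] (μ0 : Measure ℤ) [IsProbabilityMeasure μ0]
    (hU : ∀ k : ℤ, renewalMeasureZ P μ0 {k} ≠ ⊤) (p0 : ℝ)
    (hp0 : Tendsto (fun n : ℕ => ((chainDistZ P μ0 n) {x : ℤ | 0 < x}).toReal)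
      atTop (nhds p0)) (n : ℤ) (hn : 0 ≤ n) :
    ENNReal.ofReal p0 + ∑' x, renewalMeasureZ P μ0 {x} * jumpLawZ P x (downSet (n - x))
     = μ0 (Ioi n) + ∑' x, renewalMeasureZ P μ0 {x} * jumpLawZ P x (upSet (n - x)) := by
  rw [renewal_mul, renewal_mul]
  refine tendsto_nhds_unique ((tendsto_above P μ0 hU p0 hp0 n hn).add
    (ENNReal.summable.hasSum.tendsto_sum_nat)) ?_
  simp_rw [flux_sum]
  exact tendsto_const_nhds.add (ENNReal.summable.hasSum.tendsto_sum_nat)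

lemma tendsto_jump (P : Kernel ℤ ℤ) [IsMarkovKernel P] (F : Measure ℤ) [IsProbabilityMeasure F]
    (hweak : ∀ f : BoundedContinuousFunction ℤ ℝ,
      Tendsto (fun x : ℤ => ∫ s, f s ∂(jumpLawZ P x)) atTop (nhds (∫ s, f s ∂F))) (A : Set ℤ) :
    Tendsto (fun x => (jumpLawZ P x).real A) atTop (nhds (F.real A)) := by
  let f : BoundedContinuousFunction ℤ ℝ := BoundedContinuousFunction.ofNormedAddCommGroup
    (A.indicator 1) continuous_of_discreteTopology 1 (by
      intro x
      by_cases hx : x ∈ A <;> simp [hx])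
  have := hweak f
  have e : ∀ μ : Measure ℤ, ∫ s, f s ∂μ = μ.real A := fun μ =>
    integral_indicator_one MeasurableSet.of_discrete
  simpa only [e] using this

lemma main_conv (P : Kernel ℤ ℤ) [IsMarkovKernel P] (u : ℤ → ℝ) (hu0 : ∀ x, 0 ≤ u x) (C : ℝ)
    (huC : ∀ x, u x ≤ C)
    (F : Measure ℤ) [IsProbabilityMeasure F]
    (ηm : Measure ℝ) [IsProbabilityMeasure ηm]
    (hweak : ∀ f : BoundedContinuousFunction ℤ ℝ,
      Tendsto (fun x : ℤ => ∫ s, f s ∂(jumpLawZ P x)) atTop (nhds (∫ s, f s ∂F)))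
    (hdom : ∀ x : ℤ, ∀ t : ℝ, jumpLawZ P x {s : ℤ | t < |(s : ℝ)|} ≤ ηm {s : ℝ | t < s})
    (hη_int : ∫⁻ s, ENNReal.ofReal |s| ∂ηm < ⊤)
    (S : ℤ → Set ℤ) (hS : ∀ s, ∀ t ∈ S s, |(s : ℝ)| - 1 < |(t : ℝ)|) :
    (∀ n, Summable (fun s => u (n - s) * (jumpLawZ P (n - s)).real (S s))) ∧
    ∀ (l : Filter ℤ) (_ : l ≤ atTop) (w : ℤ → ℝ)
      (_ : ∀ k, Tendsto (fun n => u (n + k)) l (nhds (w k))) (k : ℤ),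
      Tendsto (fun n => ∑' s, u (n + k - s) * (jumpLawZ P (n + k - s)).real (S s)) l
        (nhds (∑' s, w (k - s) * F.real (S s))) := by
  have hb : ∀ n s, ‖u (n - s) * (jumpLawZ P (n - s)).real (S s)‖
      ≤ C * ηm.real {t : ℝ | |(s : ℝ)| - 1 < t} := by
    intro n s
    rw [Real.norm_eq_abs, abs_of_nonneg (mul_nonneg (hu0 _) measureReal_nonneg)]
    refine mul_le_mul (huC _) ?_ measureReal_nonneg ((hu0 0).trans (huC 0))
    refine ENNReal.toReal_mono (measure_ne_top _ _) ?_
    exact (measure_mono (fun t ht => hS s t ht)).trans (hdom (n - s) (|(s : ℝ)| - 1))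
  have hs := (summable_tail ηm hη_int).mul_left C
  refine ⟨fun n => Summable.of_norm_bounded hs (hb n), ?_⟩
  intro l hl w hw k
  refine tendsto_tsum_of_dominated_convergence hs (fun s => ?_)
    (Eventually.of_forall fun n s => hb (n + k) s)
  refine Tendsto.mul ?_ ?_
  · simpa only [add_sub_assoc] using hw (k - s)
  · refine (tendsto_jump P F hweak (S s)).comp ?_
    simp only [add_sub_assoc]
    exact (tendsto_atTop_add_const_right _ _ tendsto_id).mono_left hl

lemma tsum_conv (P : Kernel ℤ ℤ) [IsMarkovKernel P] (U : Measure ℤ) (hU : ∀ k : ℤ, U {k} ≠ ⊤)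
    (S : ℤ → Set ℤ) (n : ℤ)
    (hs : Summable (fun s => (U {n - s}).toReal * (jumpLawZ P (n - s)).real (S s))) :
    ∑' x, U {x} * jumpLawZ P x (S (n - x)) =
      ENNReal.ofReal (∑' s, (U {n - s}).toReal * (jumpLawZ P (n - s)).real (S s)) := by
  rw [ENNReal.ofReal_tsum_of_nonneg (fun s => by positivity) hs, ← (Equiv.subLeft n).tsum_eq]
  refine tsum_congr fun s => ?_
  rw [ENNReal.ofReal_mul (by positivity), ENNReal.ofReal_toReal (hU _), ofReal_measureReal]
  simp

lemma gen_of_span (F : Measure ℤ) [IsProbabilityMeasure F]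
    (hEpos : 0 < ∫ s, (s : ℝ) ∂F)
    (hspan : ∀ d : ℕ, 2 ≤ d → F {x : ℤ | (d : ℤ) ∣ x} < 1)
    (H : AddSubgroup ℤ) (hH : ∀ s, F.real {s} ≠ 0 → s ∈ H) : H = ⊤ := by
  obtain ⟨a, ha⟩ := Int.subgroup_cyclic H
  have hae : ∀ᵐ s ∂F, (a.natAbs : ℤ) ∣ s := by
    rw [ae_iff_of_countable]
    intro s hs
    have := hH s (by simpa [Measure.real, ENNReal.toReal_eq_zero_iff] using hs)
    rw [ha, ← AddSubgroup.zmultiples_eq_closure, Int.mem_zmultiples_iff] at this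
    exact Int.natAbs_dvd.2 this
  rcases Nat.lt_or_ge a.natAbs 2 with h | h
  · have : a.natAbs = 0 ∨ a.natAbs = 1 := by omega
    rcases this with h0 | h1
    · exfalso
      rw [h0] at hae
      have : ∫ s, (s : ℝ) ∂F = ∫ s, (0 : ℝ) ∂F := by
        refine integral_congr_ae ?_
        filter_upwards [hae] with s hs
        simpa using hs
      rw [this] at hEpos
      simp at hEpos
    · rw [ha, eq_top_iff]
      intro x _
      rw [← AddSubgroup.zmultiples_eq_closure, Int.mem_zmultiples_iff, ← Int.natAbs_dvd, h1]
      simp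
  · have h1 := hspan _ h
    have h2 : F {x : ℤ | (a.natAbs : ℤ) ∣ x} = 1 := by
      rw [← measure_univ (μ := F)]
      exact measure_congr (eventuallyEq_univ.2 hae)
    exact absurd h2 h1.ne

/-- **The key renewal theorem for a transient Markov chain, lattice case.**
If the integer-valued chain has jumps `ξ(x)` converging weakly as `x → ∞` to an
integer-valued random variable `ξ` with distribution `F`, `E ξ > 0`, `ℤ` is the
lattice of minimal span for `F`; the jumps admit an integrable stochastic
majorant `η`; the renewal measure is bounded on singletons; and
`P{X_n > 0} → p₀`, then `U{n} → p₀ / E ξ` as `n → ∞`. -/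
theorem key_renewal_theorem_lattice
    (P : Kernel ℤ ℤ) [IsMarkovKernel P]
    (μ0 : Measure ℤ) [IsProbabilityMeasure μ0]
    (F : Measure ℤ) [IsProbabilityMeasure F]
    (ηm : Measure ℝ) [IsProbabilityMeasure ηm]
    -- (i) weak convergence of the jumps to `F`:
    (hweak : ∀ f : BoundedContinuousFunction ℤ ℝ,
      Tendsto (fun x : ℤ => ∫ s, f s ∂(jumpLawZ P x)) atTop (nhds (∫ s, f s ∂F)))
    -- positive limiting drift `E ξ > 0`:
    (hF_int : Integrable (fun s : ℤ => (s : ℝ)) F)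
    (hEpos : 0 < ∫ s, (s : ℝ) ∂F)
    -- `ℤ` is the lattice with minimal span for `F`:
    (hspan : ∀ d : ℕ, 2 ≤ d → F {x : ℤ | (d : ℤ) ∣ x} < 1)
    -- (ii) integrable stochastic majorant `η`:
    (hdom : ∀ x : ℤ, ∀ t : ℝ, jumpLawZ P x {s : ℤ | t < |(s : ℝ)|} ≤ ηm {s : ℝ | t < s})
    (hη_int : ∫⁻ s, ENNReal.ofReal |s| ∂ηm < ⊤)
    -- (iii) the renewal measure is bounded on singletons:
    (hU : (⨆ k : ℤ, renewalMeasureZ P μ0 {k}) < ⊤)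
    -- (iv) existence of the limit `p₀ = lim P{X_n > 0}`:
    (p0 : ℝ)
    (hp0 : Tendsto (fun n : ℕ => ((chainDistZ P μ0 n) {x : ℤ | 0 < x}).toReal)
      atTop (nhds p0)) :
    Tendsto (fun n : ℤ => (renewalMeasureZ P μ0 {n}).toReal)
      atTop (nhds (p0 / ∫ s, (s : ℝ) ∂F)) := by
  have hUk : ∀ k : ℤ, renewalMeasureZ P μ0 {k} ≠ ⊤ := fun k =>
    ((le_iSup (fun k : ℤ => renewalMeasureZ P μ0 {k}) k).trans_lt hU).ne
  set C : ℝ := (⨆ k : ℤ, renewalMeasureZ P μ0 {k}).toReal with hC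
  set u : ℤ → ℝ := fun k => (renewalMeasureZ P μ0 {k}).toReal with hu
  have hu0 : ∀ x, 0 ≤ u x := fun x => ENNReal.toReal_nonneg
  have huC : ∀ x, u x ≤ C := fun x =>
    ENNReal.toReal_mono hU.ne (le_iSup (fun k : ℤ => renewalMeasureZ P μ0 {k}) x)
  have hp0nn : 0 ≤ p0 := ge_of_tendsto hp0 (Eventually.of_forall fun _ => ENNReal.toReal_nonneg)
  -- initial distribution is negligible at infinity
  have hmu : Tendsto (fun n : ℤ => μ0.real (Ioi n)) atTop (nhds 0) := by
    have h1 := (ENNReal.tendsto_toReal (measure_ne_top μ0 univ)).comp (tendsto_measure_Iic_atTop μ0)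
    have h2 := (tendsto_const_nhds (x := (1 : ℝ))).sub h1
    simp only [measure_univ, ENNReal.toReal_one, sub_self] at h2
    refine h2.congr fun n => ?_
    have := probReal_compl_eq_one_sub (μ := μ0) (s := Iic n) MeasurableSet.of_discrete
    rw [compl_Iic] at this
    rw [this]; rfl
  have hmu1 : ∀ k : ℤ, Tendsto (fun n : ℤ => μ0.real {n + k}) atTop (nhds 0) := by
    intro k
    have h1 : Tendsto (fun n : ℤ => μ0.real (Ioi (n + (k - 1)))) atTop (nhds 0) :=
      hmu.comp (tendsto_atTop_add_const_right _ _ tendsto_id)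
    refine squeeze_zero (fun _ => measureReal_nonneg) (fun n => measureReal_mono ?_) h1
    intro y hy
    simp only [mem_singleton_iff] at hy
    simp only [mem_Ioi]; omega
  -- the three families of sets
  have c1 := main_conv P u hu0 C huC F ηm hweak hdom hη_int (fun s => {s}) (by
    intro s t ht
    rw [mem_singleton_iff] at ht
    rw [ht]; linarith)
  have c2 := main_conv P u hu0 C huC F ηm hweak hdom hη_int upSet (by
    intro s t ht
    unfold upSet at ht
    split_ifs at ht with h
    · have h1 : (0 : ℝ) ≤ s := by exact_mod_cast h
      have h2 : (s : ℝ) < t := by exact_mod_cast ht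
      rw [abs_of_nonneg h1, abs_of_nonneg (h1.trans h2.le)]
      linarith
    · exact absurd ht (Set.notMem_empty t))
  have c3 := main_conv P u hu0 C huC F ηm hweak hdom hη_int downSet (by
    intro s t ht
    unfold downSet at ht
    split_ifs at ht with h
    · have h1 : (s : ℝ) < 0 := by exact_mod_cast h
      have h2 : (t : ℝ) ≤ s := by exact_mod_cast ht
      rw [abs_of_neg h1, abs_of_neg (h2.trans_lt h1)]
      linarith
    · exact absurd ht (Set.notMem_empty t))
  have hren : ∀ k, u k = μ0.real {k} + ∑' s, u (k - s) * (jumpLawZ P (k - s)).real {s} := by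
    intro k
    have h1 := renewal_eq P μ0 k
    rw [tsum_conv P _ hUk (fun s => {s}) k (c1.1 k)] at h1
    simp only [hu]
    rw [h1, ENNReal.toReal_add (measure_ne_top _ _) ENNReal.ofReal_ne_top,
      ENNReal.toReal_ofReal (tsum_nonneg fun s => by positivity)]
    rfl
  have hflux : ∀ n, 0 ≤ n → p0 + ∑' s, u (n - s) * (jumpLawZ P (n - s)).real (downSet s)
      = μ0.real (Ioi n) + ∑' s, u (n - s) * (jumpLawZ P (n - s)).real (upSet s) := by
    intro n hn
    have h1 := flux P μ0 hUk p0 hp0 n hn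
    rw [tsum_conv P _ hUk upSet n (c2.1 n), tsum_conv P _ hUk downSet n (c3.1 n)] at h1
    have h2 := congrArg ENNReal.toReal h1
    rw [ENNReal.toReal_add (measure_ne_top _ _) ENNReal.ofReal_ne_top,
      ENNReal.toReal_add ENNReal.ofReal_ne_top ENNReal.ofReal_ne_top,
      ENNReal.toReal_ofReal (tsum_nonneg fun s => by positivity),
      ENNReal.toReal_ofReal (tsum_nonneg fun s => by positivity),
      ENNReal.toReal_ofReal hp0nn] at h2
    exact h2
  rw [tendsto_iff_ultrafilter]
  intro l hl
  choose w hwb hw using fun k => exists_ultra_lim l (fun n => u (n + k)) C (fun n => by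
    rw [abs_of_nonneg (hu0 _)]; exact huC _)
  have hf : HasSum (fun s : ℤ => F.real {s}) 1 := by
    have h1 : ∑' s : ℤ, F {s} = 1 := by
      have := lintegral_countable' (μ := F) (fun _ => 1)
      simpa using this.symm
    have h2 : Summable (fun s : ℤ => F.real {s}) := ENNReal.summable_toReal (by rw [h1]; simp)
    have h3 : ∑' s : ℤ, F.real {s} = 1 := by
      have := ENNReal.tsum_toReal_eq (f := fun s : ℤ => F {s}) (fun _ => measure_ne_top _ _)
      rw [h1] at this
      simpa [Measure.real] using this.symm
    rw [← h3]; exact h2.hasSum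
  have hharm : ∀ k, HasSum (fun s => w (k - s) * F.real {s}) (w k) := by
    intro k
    have h1 := (harmonic_summable (fun s : ℤ => F.real {s}) (fun _ => measureReal_nonneg) hf C w hwb k)
    have h2 := ((hmu1 k).mono_left hl).add (c1.2 l hl w hw k)
    have h3 : w k = ∑' s, w (k - s) * F.real {s} := by
      rw [zero_add] at h2
      exact tendsto_nhds_unique (hw k) (h2.congr fun n => (hren (n + k)).symm)
    rw [h3]; exact h1.hasSum
  have hconst := choquet_deny (fun s : ℤ => F.real {s}) (fun _ => measureReal_nonneg) hf
    (gen_of_span F hEpos hspan) C w hwb hharm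
  have hup := c2.2 l hl w hw 0
  have hdown := c3.2 l hl w hw 0
  have hlim := (hmu.mono_left hl).add hup
  have hlim2 := (tendsto_const_nhds (x := p0) (f := (l : Filter ℤ))).add hdown
  have heq : p0 + ∑' s, w (0 - s) * F.real (downSet s) = 0 + ∑' s, w (0 - s) * F.real (upSet s) := by
    refine tendsto_nhds_unique hlim2 (hlim.congr' ?_)
    filter_upwards [hl (eventually_ge_atTop 0)] with n hn
    simp only [add_zero]
    exact (hflux n hn).symm
  have hm := mean_eq F hF_int
  have e1 : ∀ s : ℤ, F.real (upSet s) = if 0 ≤ s then F.real (Ioi s) else 0 := by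
    intro s; unfold upSet; split_ifs <;> simp
  have e2 : ∀ s : ℤ, F.real (downSet s) = if s < 0 then F.real (Iic s) else 0 := by
    intro s; unfold downSet; split_ifs <;> simp
  simp_rw [hconst (0 - _), e1, e2, tsum_mul_left] at heq
  have hw0 : w 0 = p0 / ∫ s, (s : ℝ) ∂F := by
    rw [eq_div_iff hEpos.ne', hm, mul_sub]
    linarith
  rw [← hw0]
  simpa using hw 0
end

section
/- Let $X_n$ be a time-homogeneous Markov chain on $\mathbf{R}$ whose jump variables satisfy $\xi(x)\Rightarrow\xi$ weakly as $x\to\infty$, where $\xi$ has distribution $F$, and suppose there is a random variable $\eta$ with $\mathbf{E}\eta<\infty$ and $|\xi(x)|\le_{\rm st}\eta$ for all $x\in\mathbf{R}$, and that $\sup_{k\in\mathbf{Z}}U(k,k+1]<\infty$. If $t_n\to\infty$ is a sequence of points such that the shifted measures $U(t_n+\cdot)$ converge weakly (on every bounded interval) to a measure $\lambda$, then $\lambda$ satisfies the convolution identity $\lambda=\lambda*F$, i.e. $\int f\,d\lambda=\int\!\!\int f(x+y)\,F(dx)\,\lambda(dy)$ for every smooth function $f$ with bounded support. -/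
open MeasureTheory ProbabilityTheory Filter Set

open scoped ENNReal Topology

instance chainDist_prob (P : Kernel ℝ ℝ) [IsMarkovKernel P]
    (μ0 : Measure ℝ) [IsProbabilityMeasure μ0] (n : ℕ) :
    IsProbabilityMeasure (chainDist P μ0 n) := by
  induction n with
  | zero => simpa [chainDist]
  | succ n ih => simp only [chainDist]; infer_instance

instance renewal_sfinite (P : Kernel ℝ ℝ) [IsMarkovKernel P]
    (μ0 : Measure ℝ) [IsProbabilityMeasure μ0] : SFinite (renewalMeasure P μ0) := by
  unfold renewalMeasure; infer_instance

theorem renewal_aux (P : Kernel ℝ ℝ) (c : ℕ → Measure ℝ)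
    (hc : ∀ n, c (n + 1) = (c n).bind P) :
    Measure.sum c = c 0 + (Measure.sum c).bind P := by
  ext s hs
  have h : ∀ n : ℕ, c (n + 1) s = ∫⁻ a, P a s ∂(c n) := by
    intro n
    rw [hc, Measure.bind_apply hs P.aemeasurable]
  have h2 : (∑' n, c n s) = c 0 s + ∑' n, c (n + 1) s :=
    tsum_eq_zero_add' (f := fun n => c n s) ENNReal.summable
  rw [Measure.add_apply, Measure.bind_apply hs P.aemeasurable, Measure.sum_apply _ hs,
    lintegral_sum_measure, h2, tsum_congr h]

theorem renewal_eq_s2 (P : Kernel ℝ ℝ) (μ0 : Measure ℝ) :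
    renewalMeasure P μ0 = μ0 + (renewalMeasure P μ0).bind P :=
  renewal_aux P (chainDist P μ0) (fun _ => rfl)

instance jumpLaw_prob (P : Kernel ℝ ℝ) [IsMarkovKernel P] (x : ℝ) :
    IsProbabilityMeasure (jumpLaw P x) := by
  unfold jumpLaw
  exact Measure.isProbabilityMeasure_map (by fun_prop)

/-- Bound on symmetric intervals for shifted measures. -/
theorem shifted_bound (U : Measure ℝ) (K : ℝ≥0∞)
    (hK : ∀ k : ℤ, U (Set.Ioc (k : ℝ) (k + 1)) ≤ K) (t : ℝ) (m : ℕ) :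
    (U.map (fun y => y - t)) (Icc (-(m : ℝ)) m) ≤ K * (2 * m + 2) := by
  rw [Measure.map_apply (by fun_prop) measurableSet_Icc]
  have hsub : (fun y => y - t) ⁻¹' (Icc (-(m : ℝ)) m) ⊆
      ⋃ j ∈ Finset.range (2 * m + 2), Set.Ioc (((⌈t⌉ - m - 1 + j : ℤ)) : ℝ)
        (((⌈t⌉ - m - 1 + j : ℤ) : ℝ) + 1) := by
    intro y hy
    simp only [mem_preimage, mem_Icc] at hy
    simp only [mem_iUnion, Finset.mem_range]
    have h1 := Int.le_ceil t
    have h2 := Int.ceil_lt_add_one t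
    have h3 := Int.le_ceil y
    have h4 := Int.ceil_lt_add_one y
    have h5 : ⌈t⌉ - m ≤ ⌈y⌉ := by
      have : (⌈t⌉ : ℝ) - m - 1 < ⌈y⌉ := by linarith
      have : ⌈t⌉ - (m : ℤ) - 1 < ⌈y⌉ := by exact_mod_cast this
      omega
    have h6 : ⌈y⌉ ≤ ⌈t⌉ + m := by
      have : (⌈y⌉ : ℝ) < ⌈t⌉ + m + 1 := by linarith
      have : ⌈y⌉ < ⌈t⌉ + (m : ℤ) + 1 := by exact_mod_cast this
      omega
    refine ⟨(⌈y⌉ - (⌈t⌉ - m)).toNat, by omega, ?_⟩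
    have h7 : (⌈t⌉ - m - 1 + ((⌈y⌉ - (⌈t⌉ - m)).toNat : ℤ) : ℤ) = ⌈y⌉ - 1 := by omega
    rw [h7]
    push_cast
    constructor <;> linarith
  refine (measure_mono hsub).trans ((measure_biUnion_finset_le _ _).trans ?_)
  refine (Finset.sum_le_card_nsmul _ _ K fun j _ => hK _).trans ?_
  rw [Finset.card_range, nsmul_eq_mul]
  push_cast
  rw [mul_comm]

/-- The tail functional. -/
noncomputable def tailPhi (ηm : Measure ℝ) (K : ℝ≥0∞) (M A : ℝ) : ℝ≥0∞ :=
  ∫⁻ s in {s : ℝ | A - M < s}, K * (2 * (⌈|s| + M⌉₊ : ℝ≥0∞) + 2) ∂ηm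

theorem meas_H (ηm : Measure ℝ) [IsProbabilityMeasure ηm] (M : ℝ) :
    Measurable (fun y : ℝ => ηm {s : ℝ | |y| - M < s}) := by
  have : MeasurableSet {p : ℝ × ℝ | |p.1| - M < p.2} :=
    measurableSet_lt (by fun_prop) (by fun_prop)
  exact measurable_measure_prodMk_left this

theorem tail_le (ηm : Measure ℝ) [IsProbabilityMeasure ηm] (K : ℝ≥0∞) (M A : ℝ) 
    (μ : Measure ℝ) [SFinite μ] (hμ : ∀ m : ℕ, μ (Icc (-(m : ℝ)) m) ≤ K * (2 * m + 2)) :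
    ∫⁻ y in {y : ℝ | A < |y|}, ηm {s : ℝ | |y| - M < s} ∂μ ≤ tailPhi ηm K M A := by
  have hmeas : MeasurableSet {p : ℝ × ℝ | |p.1| - M < p.2} :=
    measurableSet_lt (by fun_prop) (by fun_prop)
  have e1 : ∀ y : ℝ, ηm {s : ℝ | |y| - M < s} =
      ∫⁻ s, ({p : ℝ × ℝ | |p.1| - M < p.2}.indicator 1 (y, s)) ∂ηm := by
    intro y
    have : (fun s => ({p : ℝ × ℝ | |p.1| - M < p.2}.indicator (1 : ℝ × ℝ → ℝ≥0∞) (y, s)))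
      = {s : ℝ | |y| - M < s}.indicator 1 := by
      ext s; simp [indicator]
    rw [this, lintegral_indicator_one]
    exact measurableSet_lt (by fun_prop) (by fun_prop)
  simp_rw [e1]
  rw [lintegral_lintegral_swap (by
    exact (measurable_one.indicator hmeas).aemeasurable)]
  unfold tailPhi
  have hm2 : MeasurableSet {s : ℝ | A - M < s} := measurableSet_lt (by fun_prop) (by fun_prop)
  rw [← lintegral_indicator hm2]
  refine lintegral_mono fun s => ?_
  have hm3 : MeasurableSet {y : ℝ | A < |y|} := measurableSet_lt (by fun_prop) (by fun_prop)
  rw [← lintegral_indicator hm3]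
  by_cases hs : A - M < s
  · rw [indicator_of_mem (show s ∈ {s : ℝ | A - M < s} from hs)]
    refine le_trans ?_ (hμ ⌈|s| + M⌉₊)
    rw [← lintegral_indicator_one measurableSet_Icc]
    refine lintegral_mono fun y => ?_
    simp only [indicator, mem_ofPred_eq, mem_Icc]
    split_ifs with h1 h2 h3 h3
    · simp
    · exfalso
      apply h3
      have := Nat.le_ceil (|s| + M)
      have := le_abs_self s
      rw [← abs_le]
      linarith
    all_goals simp
  · rw [indicator_of_notMem (show s ∉ {s : ℝ | A - M < s} from hs)]
    rw [nonpos_iff_eq_zero, lintegral_eq_zero_iff]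
    · refine Eventually.of_forall fun y => ?_
      simp only [indicator, mem_ofPred_eq, Pi.zero_apply]
      split_ifs with h1 h2
      · exfalso; apply hs; linarith
      · rfl
      · rfl
    · refine Measurable.indicator ?_ hm3
      exact (measurable_one.indicator hmeas).comp (by fun_prop)

theorem phi_dens_finite (ηm : Measure ℝ) [IsProbabilityMeasure ηm] (K : ℝ≥0∞) (hK : K ≠ ⊤) (M : ℝ)
    (hM : 0 ≤ M) (hη_int : ∫⁻ s, ENNReal.ofReal |s| ∂ηm < ⊤) :
    ∫⁻ s, K * (2 * (⌈|s| + M⌉₊ : ℝ≥0∞) + 2) ∂ηm ≠ ⊤ := by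
  have : ∫⁻ s, K * (2 * (⌈|s| + M⌉₊ : ℝ≥0∞) + 2) ∂ηm ≤
      ∫⁻ s, K * (2 * (ENNReal.ofReal |s| + ENNReal.ofReal (M + 1)) + 2) ∂ηm := by
    refine lintegral_mono fun s => ?_
    gcongr
    rw [← ENNReal.ofReal_add (abs_nonneg _) (by positivity), ← ENNReal.ofReal_natCast]
    apply ENNReal.ofReal_le_ofReal
    have := (Nat.ceil_lt_add_one (show 0 ≤ |s| + M by positivity)).le
    linarith
  refine (lt_of_le_of_lt this ?_).ne
  rw [lintegral_const_mul _ (by fun_prop), lintegral_add_right _ (by fun_prop),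
    lintegral_const_mul _ (by fun_prop), lintegral_add_right _ (by fun_prop)]
  simp only [lintegral_const, measure_univ, mul_one]
  refine ENNReal.mul_lt_top hK.lt_top ?_
  refine ENNReal.add_lt_top.2 ⟨ENNReal.mul_lt_top (by simp) (ENNReal.add_lt_top.2 ⟨hη_int, by simp⟩), by simp⟩

theorem tailPhi_finite (ηm : Measure ℝ) [IsProbabilityMeasure ηm] (K : ℝ≥0∞) (hK : K ≠ ⊤) (M A : ℝ)
    (hM : 0 ≤ M) (hη_int : ∫⁻ s, ENNReal.ofReal |s| ∂ηm < ⊤) :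
    tailPhi ηm K M A ≠ ⊤ :=
  ((setLIntegral_le_lintegral _ _).trans_lt (phi_dens_finite ηm K hK M hM hη_int).lt_top).ne

theorem tailPhi_tendsto (ηm : Measure ℝ) [IsProbabilityMeasure ηm] (K : ℝ≥0∞) (hK : K ≠ ⊤) (M : ℝ)
    (hM : 0 ≤ M) (hη_int : ∫⁻ s, ENNReal.ofReal |s| ∂ηm < ⊤) :
    Tendsto (fun n : ℕ => tailPhi ηm K M n) atTop (𝓝 0) := by
  unfold tailPhi
  apply tendsto_setLIntegral_zero (phi_dens_finite ηm K hK M hM hη_int)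
  have h := tendsto_measure_iInter_atTop (μ := ηm) (s := fun n : ℕ => {s : ℝ | (n : ℝ) - M < s})
    (fun n => (measurableSet_lt (by fun_prop) (by fun_prop)).nullMeasurableSet)
    (fun i j hij s hs => by
      simp only [mem_ofPred_eq] at hs ⊢
      have : (i : ℝ) ≤ j := by exact_mod_cast hij
      linarith)
    ⟨0, measure_ne_top _ _⟩
  have : (⋂ n : ℕ, {s : ℝ | (n : ℝ) - M < s}) = ∅ := by
    ext s
    simp only [mem_iInter, mem_ofPred_eq, mem_empty_iff_false, iff_false, not_forall, not_lt]
    obtain ⟨n, hn⟩ := exists_nat_ge (s + M)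
    exact ⟨n, by linarith⟩
  rw [this, measure_empty] at h
  exact h

/-- pointwise bound for expectations. -/
theorem expect_bound (ηm : Measure ℝ) [IsProbabilityMeasure ηm] (ν : Measure ℝ)
    (hν : ∀ t : ℝ, ν {s : ℝ | t < |s|} ≤ ηm {s : ℝ | t < s})
    (f : ℝ → ℝ) (C M : ℝ) (hC : ∀ z, |f z| ≤ C) (hM : ∀ z, M ≤ |z| → f z = 0) (y : ℝ) :
    ‖∫ s, f (s + y) ∂ν‖ₑ ≤ ENNReal.ofReal C * ηm {s : ℝ | |y| - M < s} := by
  refine (enorm_integral_le_lintegral_enorm _).trans ?_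
  have hms : MeasurableSet {s : ℝ | |y| - M < |s|} := measurableSet_lt (by fun_prop) (by fun_prop)
  calc ∫⁻ s, ‖f (s + y)‖ₑ ∂ν ≤ ∫⁻ s, {s : ℝ | |y| - M < |s|}.indicator (fun _ => ENNReal.ofReal C) s ∂ν := by
        refine lintegral_mono fun s => ?_
        by_cases hs : |y| - M < |s|
        · rw [indicator_of_mem (show s ∈ {s : ℝ | |y| - M < |s|} from hs), Real.enorm_eq_ofReal_abs]
          exact ENNReal.ofReal_le_ofReal (hC _)
        · rw [hM]
          · simp
          · have := abs_sub_abs_le_abs_sub y (-s)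
            rw [abs_neg, sub_neg_eq_add, add_comm y s] at this
            linarith
    _ = ENNReal.ofReal C * ν {s : ℝ | |y| - M < |s|} := by
        rw [lintegral_indicator hms, setLIntegral_const]
    _ ≤ _ := mul_le_mul_right (hν _) _

theorem bdd_integrable (ν : Measure ℝ) [IsFiniteMeasure ν] (f : ℝ → ℝ) (hf : Continuous f) (C : ℝ)
    (hC : ∀ z, |f z| ≤ C) (y : ℝ) : Integrable (fun s => f (s + y)) ν :=
  Integrable.of_bound (by fun_prop) C (Eventually.of_forall fun s => hC _)

theorem diff_bound (ν : Measure ℝ) [IsProbabilityMeasure ν] (f : ℝ → ℝ) (hf : Continuous f) (C : ℝ)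
    (hC : ∀ z, |f z| ≤ C) (δ ε : ℝ) (hu : ∀ a b, |a - b| < δ → |f a - f b| ≤ ε) (y z : ℝ)
    (hyz : |y - z| < δ) :
    |∫ s, f (s + y) ∂ν - ∫ s, f (s + z) ∂ν| ≤ ε := by
  rw [← integral_sub (bdd_integrable ν f hf C hC y) (bdd_integrable ν f hf C hC z)]
  have := norm_integral_le_of_norm_le_const (μ := ν) (f := fun s => f (s + y) - f (s + z)) (C := ε)
    (Eventually.of_forall fun s => by
      apply hu
      rwa [add_sub_add_left_eq_sub])
  simpa using this

theorem unif_conv (P : Kernel ℝ ℝ) [IsMarkovKernel P] (F : Measure ℝ) [IsProbabilityMeasure F]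
    (hweak : ∀ f : BoundedContinuousFunction ℝ ℝ,
      Tendsto (fun x : ℝ => ∫ s, f s ∂(jumpLaw P x)) atTop (nhds (∫ s, f s ∂F)))
    (f : ℝ → ℝ) (hf : Continuous f) (hfu : UniformContinuous f) (C : ℝ) (hC : ∀ z, |f z| ≤ C)
    (A ε : ℝ) (hε : 0 < ε) :
    ∀ᶠ T : ℝ in atTop, ∀ y : ℝ, |y| ≤ A →
      |∫ s, f (s + y) ∂(jumpLaw P (y + T)) - ∫ s, f (s + y) ∂F| ≤ ε := by
  obtain ⟨δ, hδ, hu⟩ := Metric.uniformContinuous_iff.1 hfu (ε / 3) (by positivity)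
  have hu' : ∀ a b, |a - b| < δ → |f a - f b| ≤ ε / 3 := fun a b h => (hu h).le
  obtain ⟨S, -, hSf, hS⟩ := (isCompact_Icc (a := -A) (b := A)).finite_cover_balls hδ
  have h1 : ∀ᶠ x in atTop, ∀ z ∈ S, |∫ s, f (s + z) ∂(jumpLaw P x) - ∫ s, f (s + z) ∂F| < ε / 3 := by
    rw [eventually_all_finite hSf]
    intro z _
    have := hweak (BoundedContinuousFunction.ofNormedAddCommGroup (fun s => f (s + z))
      (by fun_prop) C (fun s => hC _))
    exact (Metric.tendsto_nhds.1 this (ε / 3) (by positivity))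
  obtain ⟨X, hX⟩ := eventually_atTop.1 h1
  filter_upwards [eventually_ge_atTop (X + A)] with T hT y hy
  obtain ⟨z, hz, hyz⟩ := mem_iUnion₂.1 (hS (abs_le.1 hy))
  have hyz' : |y - z| < δ := hyz
  have a1 := diff_bound (jumpLaw P (y + T)) f hf C hC δ _ hu' y z hyz'
  have a2 := diff_bound F f hf C hC δ _ hu' y z hyz'
  have a3 := (hX (y + T) (by linarith [(abs_le.1 hy).1]) z hz).le
  rw [abs_le] at *
  constructor <;> linarith

theorem limit_bound (P : Kernel ℝ ℝ) [IsMarkovKernel P] (F : Measure ℝ) [IsProbabilityMeasure F]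
    (ηm : Measure ℝ) [IsProbabilityMeasure ηm]
    (hweak : ∀ f : BoundedContinuousFunction ℝ ℝ,
      Tendsto (fun x : ℝ => ∫ s, f s ∂(jumpLaw P x)) atTop (nhds (∫ s, f s ∂F)))
    (hdom : ∀ x : ℝ, ∀ t : ℝ, jumpLaw P x {s : ℝ | t < |s|} ≤ ηm {s : ℝ | t < s})
    (f : ℝ → ℝ) (hf : Continuous f) (C M : ℝ) (hC : ∀ z, |f z| ≤ C)
    (hM : ∀ z, M ≤ |z| → f z = 0) (y : ℝ) :
    ‖∫ s, f (s + y) ∂F‖ₑ ≤ ENNReal.ofReal C * ηm {s : ℝ | |y| - M < s} := by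
  have := hweak (BoundedContinuousFunction.ofNormedAddCommGroup (fun s => f (s + y))
      (by fun_prop) C (fun s => hC _))
  exact le_of_tendsto' this.enorm fun x => expect_bound ηm _ (hdom x) f C M hC hM y

/-- One step identity for the renewal measure, shifted. -/
theorem shifted_identity (P : Kernel ℝ ℝ) [IsMarkovKernel P]
    (μ0 : Measure ℝ) [IsProbabilityMeasure μ0] (f : ℝ → ℝ) (hf : Continuous f) (t : ℝ)
    (hint : Integrable f ((renewalMeasure P μ0).map (fun y => y - t))) :
    StronglyMeasurable (fun y => ∫ s, f (s + y) ∂(jumpLaw P (y + t))) ∧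
    ∫ x, f x ∂((renewalMeasure P μ0).map (fun y => y - t)) =
      ∫ x, f (x - t) ∂μ0 + ∫ y, (∫ s, f (s + y) ∂(jumpLaw P (y + t)))
        ∂((renewalMeasure P μ0).map (fun y => y - t)) := by
  have e0 : ∀ y, ∫ s, f (s + y) ∂(jumpLaw P (y + t)) = ∫ z, f (z - t) ∂(P (y + t)) := by
    intro y
    unfold jumpLaw
    rw [integral_map (by fun_prop) (by fun_prop)]
    congr 1; ext z; congr 1; ring
  have hsm : StronglyMeasurable (fun x => ∫ z, f (z - t) ∂(P x)) :=
    StronglyMeasurable.integral_kernel (by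
      exact (hf.comp (by fun_prop : Continuous fun z : ℝ => z - t)).stronglyMeasurable)
  have hsm2 : StronglyMeasurable (fun y => ∫ z, f (z - t) ∂(P (y + t))) :=
    hsm.comp_measurable (g := fun y : ℝ => y + t) (by fun_prop)
  simp_rw [e0]
  refine ⟨hsm2, ?_⟩
  rw [integral_map (by fun_prop) (by fun_prop),
    integral_map (by fun_prop) hsm2.aestronglyMeasurable]
  simp only [sub_add_cancel]
  have hi : Integrable (fun x => f (x - t)) (renewalMeasure P μ0) :=
    (integrable_map_measure (by fun_prop) (by fun_prop)).1 hint
  have hi2 := hi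
  rw [renewal_eq_s2, integrable_add_measure] at hi2
  conv_lhs => rw [renewal_eq_s2]
  rw [integral_add_measure hi2.1 hi2.2]
  congr 1
  exact Kernel.integral_comp (κ := Kernel.const Unit (renewalMeasure P μ0)) (η := P) (a := ())
    (f := fun x => f (x - t)) hi2.2

noncomputable def cut (A : ℝ) (y : ℝ) : ℝ := max 0 (min 1 (A + 1 - |y|))

theorem cut_cont (A : ℝ) : Continuous (cut A) := by unfold cut; fun_prop
theorem cut_nonneg (A y : ℝ) : 0 ≤ cut A y := le_max_left _ _
theorem cut_le (A y : ℝ) : cut A y ≤ 1 := by unfold cut; simp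
theorem cut_one (A y : ℝ) (h : |y| ≤ A) : cut A y = 1 := by
  unfold cut; rw [min_eq_left (by linarith)]; simp
theorem cut_zero (A y : ℝ) (h : A + 1 < |y|) : cut A y = 0 := by
  unfold cut; rw [max_eq_left]; exact (min_le_right _ _).trans (by linarith)
theorem cut_supp (A : ℝ) : HasCompactSupport (cut A) := by
  refine HasCompactSupport.intro (isCompact_Icc (a := -(A + 1)) (b := A + 1)) fun y hy => ?_
  apply cut_zero
  by_contra h
  exact hy (abs_le.1 (not_lt.1 h))

theorem cut_tendsto (y : ℝ) : ∀ᶠ n : ℕ in atTop, cut n y = 1 := by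
  obtain ⟨N, hN⟩ := exists_nat_ge |y|
  filter_upwards [eventually_ge_atTop N] with n hn
  exact cut_one _ _ (hN.trans (by exact_mod_cast hn))

theorem cut_integral_tendsto (lam : Measure ℝ) (g : ℝ → ℝ) (hg : Integrable g lam) :
    Tendsto (fun n : ℕ => ∫ y, cut n y * g y ∂lam) atTop (𝓝 (∫ y, g y ∂lam)) := by
  refine tendsto_integral_of_dominated_convergence (fun y => ‖g y‖) ?_ hg.norm ?_ ?_
  · intro n
    exact (cut_cont n).aestronglyMeasurable.mul hg.1
  · intro n
    refine Eventually.of_forall fun y => ?_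
    rw [norm_mul, Real.norm_of_nonneg (cut_nonneg _ _)]
    exact mul_le_of_le_one_left (norm_nonneg _) (cut_le _ _)
  · refine Eventually.of_forall fun y => ?_
    refine tendsto_const_nhds.congr' ?_
    filter_upwards [cut_tendsto y] with n hn
    rw [hn, one_mul]

theorem cc_integrable (μ : Measure ℝ) (hμ : ∀ m : ℕ, μ (Icc (-(m : ℝ)) m) < ⊤)
    (f : ℝ → ℝ) (hf : Continuous f) (hs : HasCompactSupport f) : Integrable f μ := by
  have : IsFiniteMeasureOnCompacts μ := by
    refine ⟨fun K hK => ?_⟩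
    obtain ⟨r, hr⟩ := hK.isBounded.subset_closedBall 0
    obtain ⟨m, hm⟩ := exists_nat_ge r
    refine lt_of_le_of_lt (measure_mono fun x hx => ?_) (hμ m)
    have := hr hx
    simp only [Metric.mem_closedBall, dist_zero_right, Real.norm_eq_abs] at this
    exact abs_le.1 (this.trans hm)
  exact hf.integrable_of_hasCompactSupport hs

/-- Core comparison estimate. -/
theorem core_est (ηm : Measure ℝ) [IsProbabilityMeasure ηm] (K : ℝ≥0∞) (M : ℝ)
    (μ : Measure ℝ) [SFinite μ] (hμ : ∀ m : ℕ, μ (Icc (-(m : ℝ)) m) ≤ K * (2 * m + 2))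
    (C : ℝ) (ψ g : ℝ → ℝ) (hψi : Integrable ψ μ) (A : ℕ)
    (hgi : Integrable (fun y => cut A y * g y) μ)
    (hψ : ∀ y, ‖ψ y‖ₑ ≤ ENNReal.ofReal C * ηm {s : ℝ | |y| - M < s})
    (ε : ℝ) (hd : ∀ y : ℝ, |y| ≤ A + 1 → |ψ y - g y| ≤ ε) :
    ‖∫ y, ψ y ∂μ - ∫ y, cut A y * g y ∂μ‖ₑ ≤
      ENNReal.ofReal ε * (K * (2 * (A + 1 : ℕ) + 2)) + ENNReal.ofReal C * tailPhi ηm K M A := by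
  rw [← integral_sub hψi hgi]
  refine (enorm_integral_le_lintegral_enorm _).trans ?_
  have hm3 : MeasurableSet {y : ℝ | (A : ℝ) < |y|} := measurableSet_lt (by fun_prop) (by fun_prop)
  calc ∫⁻ y, ‖ψ y - cut A y * g y‖ₑ ∂μ
      ≤ ∫⁻ y, ((Icc (-((A + 1 : ℕ) : ℝ)) ((A + 1 : ℕ) : ℝ)).indicator (fun _ => ENNReal.ofReal ε) y +
        {y : ℝ | (A : ℝ) < |y|}.indicator
          (fun y => ENNReal.ofReal C * ηm {s : ℝ | |y| - M < s}) y) ∂μ := by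
        refine lintegral_mono fun y => ?_
        have hdec : ψ y - cut A y * g y = cut A y * (ψ y - g y) + (1 - cut A y) * ψ y := by ring
        rw [hdec]
        refine (enorm_add_le _ _).trans (add_le_add ?_ ?_)
        · by_cases hy : |y| ≤ A + 1
          · rw [indicator_of_mem (by push_cast; exact abs_le.1 hy), Real.enorm_eq_ofReal_abs, abs_mul,
              abs_of_nonneg (cut_nonneg _ _)]
            apply ENNReal.ofReal_le_ofReal
            exact (mul_le_of_le_one_left (abs_nonneg _) (cut_le _ _)).trans (hd y hy)
          · rw [cut_zero _ _ (not_le.1 hy)]; simp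
        · by_cases hy : |y| ≤ A
          · rw [cut_one _ _ hy]; simp
          · rw [indicator_of_mem (show y ∈ {y : ℝ | (A : ℝ) < |y|} from not_le.1 hy)]
            refine le_trans ?_ (hψ y)
            rw [enorm_mul]
            refine mul_le_of_le_one_left zero_le ?_
            rw [Real.enorm_eq_ofReal_abs, abs_of_nonneg (by linarith [cut_le A y])]
            exact ENNReal.ofReal_le_one.2 (by linarith [cut_nonneg A y])
    _ = ENNReal.ofReal ε * μ (Icc (-((A + 1 : ℕ) : ℝ)) ((A + 1 : ℕ) : ℝ)) +
        ENNReal.ofReal C * ∫⁻ y in {y : ℝ | (A : ℝ) < |y|}, ηm {s : ℝ | |y| - M < s} ∂μ := by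
        rw [lintegral_add_left (measurable_const.indicator measurableSet_Icc),
          lintegral_indicator measurableSet_Icc, setLIntegral_const, lintegral_indicator hm3,
          lintegral_const_mul _ (meas_H ηm M)]
    _ ≤ _ := add_le_add (mul_le_mul_right (hμ _) _)
        (mul_le_mul_right (tail_le ηm K M A μ hμ) _)

theorem total_le (ηm : Measure ℝ) [IsProbabilityMeasure ηm] (K : ℝ≥0∞) (M : ℝ)
    (μ : Measure ℝ) [SFinite μ] (hμ : ∀ m : ℕ, μ (Icc (-(m : ℝ)) m) ≤ K * (2 * m + 2))
    (C : ℝ) (ψ : ℝ → ℝ) 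
    (hψ : ∀ y, ‖ψ y‖ₑ ≤ ENNReal.ofReal C * ηm {s : ℝ | |y| - M < s}) :
    ∫⁻ y, ‖ψ y‖ₑ ∂μ ≤ ENNReal.ofReal C * tailPhi ηm K M (-1) := by
  have h := tail_le ηm K M (-1) μ hμ
  have hu : {y : ℝ | -1 < |y|} = univ := by
    ext y; simp only [mem_ofPred_eq, mem_univ, iff_true]; linarith [abs_nonneg y]
  rw [hu, Measure.restrict_univ] at h
  refine (lintegral_mono hψ).trans ?_
  rw [lintegral_const_mul _ (meas_H ηm M)]
  exact mul_le_mul_right h _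

/-- **Lemma 1.** If the jumps of the chain converge weakly to `F`, have an
integrable stochastic majorant, and the renewal measure `U` is bounded on unit
intervals, then any weak (vague) limit `λ` of the shifted measures `U(tₙ + ·)`
along a sequence `tₙ → ∞` satisfies the convolution identity `λ = λ * F`, i.e.
`∫ f dλ = ∫∫ f(x+y) F(dx) λ(dy)` for every smooth compactly supported `f`. -/
theorem weak_limit_of_shifted_renewal_measure_is_F_invariant
    (P : Kernel ℝ ℝ) [IsMarkovKernel P]
    (μ0 : Measure ℝ) [IsProbabilityMeasure μ0]
    (F : Measure ℝ) [IsProbabilityMeasure F]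
    (ηm : Measure ℝ) [IsProbabilityMeasure ηm]
    -- weak convergence of the jumps to `F`:
    (hweak : ∀ f : BoundedContinuousFunction ℝ ℝ,
      Tendsto (fun x : ℝ => ∫ s, f s ∂(jumpLaw P x)) atTop (nhds (∫ s, f s ∂F)))
    -- integrable stochastic majorant `η`:
    (hdom : ∀ x : ℝ, ∀ t : ℝ, jumpLaw P x {s : ℝ | t < |s|} ≤ ηm {s : ℝ | t < s})
    (hη_int : ∫⁻ s, ENNReal.ofReal |s| ∂ηm < ⊤)
    -- the renewal measure is bounded on unit intervals:
    (hU : (⨆ k : ℤ, renewalMeasure P μ0 (Set.Ioc (k : ℝ) (k + 1))) < ⊤)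
    -- a sequence `tₙ → ∞` along which `U(tₙ + ·)` converges weakly to `λ`:
    (t : ℕ → ℝ) (ht : Tendsto t atTop atTop)
    (lam : Measure ℝ)
    (hconv : ∀ f : C(ℝ, ℝ), HasCompactSupport f →
      Tendsto (fun n : ℕ =>
          ∫ x, f x ∂((renewalMeasure P μ0).map (fun y => y - t n)))
        atTop (nhds (∫ x, f x ∂lam))) :
    ∀ f : ℝ → ℝ, ContDiff ℝ (⊤ : ℕ∞) f → HasCompactSupport f →
      ∫ x, f x ∂lam = ∫ y, (∫ x, f (x + y) ∂F) ∂lam := by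
  intro f hfs hfc
  have hf : Continuous f := hfs.continuous
  set U := renewalMeasure P μ0 with hUdef
  set K : ℝ≥0∞ := ⨆ k : ℤ, U (Set.Ioc (k : ℝ) (k + 1)) with hKdef
  have hK : ∀ k : ℤ, U (Set.Ioc (k : ℝ) (k + 1)) ≤ K := fun k =>
    le_iSup (fun k : ℤ => U (Set.Ioc (k : ℝ) (k + 1))) k
  have hb : ∀ n m : ℕ, (U.map (fun y => y - t n)) (Icc (-(m : ℝ)) m) ≤ K * (2 * m + 2) :=
    fun n m => shifted_bound U K hK (t n) m
  have hbt : ∀ m : ℕ, K * (2 * m + 2) < ⊤ := fun m => ENNReal.mul_lt_top hU (by finiteness)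
  have hsf : SFinite U := renewal_sfinite P μ0
  have hsfn : ∀ n, SFinite (U.map (fun y => y - t n)) := fun n => inferInstance
  have hcc : ∀ n (h : ℝ → ℝ), Continuous h → HasCompactSupport h →
      Integrable h (U.map (fun y => y - t n)) := fun n h h1 h2 =>
    cc_integrable _ (fun m => (hb n m).trans_lt (hbt m)) h h1 h2
  have hconv' : ∀ h : ℝ → ℝ, Continuous h → HasCompactSupport h →
      Tendsto (fun n : ℕ => ∫ x, h x ∂(U.map (fun y => y - t n))) atTop (nhds (∫ x, h x ∂lam)) :=
    fun h h1 h2 => hconv ⟨h, h1⟩ h2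
  obtain ⟨C, hC⟩ : ∃ C, ∀ z, |f z| ≤ C := hf.bounded_above_of_compact_support hfc
  obtain ⟨M, hM0, hM⟩ : ∃ M : ℝ, 0 ≤ M ∧ ∀ z, M ≤ |z| → f z = 0 := by
    obtain ⟨R, hR⟩ := hfc.isCompact.isBounded.subset_closedBall 0
    refine ⟨|R| + 1, by positivity, fun z hz => ?_⟩
    by_contra hne
    have := hR (subset_tsupport f hne)
    simp only [Metric.mem_closedBall, dist_zero_right, Real.norm_eq_abs] at this
    linarith [le_abs_self R]
  have hfu : UniformContinuous f := hfc.uniformContinuous_of_continuous hf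
  set g : ℝ → ℝ := fun y => ∫ x, f (x + y) ∂F with hgdef
  have hgc : Continuous g := by
    refine continuous_of_dominated (bound := fun _ => C) ?_ ?_ ?_ ?_
    · intro y; fun_prop
    · intro y; exact Eventually.of_forall fun s => hC _
    · exact integrable_const _
    · exact Eventually.of_forall fun s => by fun_prop
  have hcutg : ∀ A, Continuous (fun y => cut A y * g y) := fun A => (cut_cont A).mul hgc
  have hcutgs : ∀ A, HasCompactSupport (fun y => cut A y * g y) := fun A => (cut_supp A).mul_right
  change ∫ x, f x ∂lam = ∫ y, g y ∂lam
  by_cases hcase : ∀ h : ℝ → ℝ, Continuous h → HasCompactSupport h → Integrable h lam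
  swap
  · -- degenerate case: every compactly supported function has zero integral
    push Not at hcase
    obtain ⟨h0, h0c, h0s, h0n⟩ := hcase
    have hz : ∀ h : ℝ → ℝ, Continuous h → HasCompactSupport h → ∫ x, h x ∂lam = 0 := by
      intro h h1 h2
      by_cases hi : Integrable h lam
      · have hn : ¬ Integrable (fun x => h x + h0 x) lam := by
          intro hcon
          apply h0n
          have := hcon.sub hi
          refine this.congr (Eventually.of_forall fun x => ?_)
          simp
        have l1 := hconv' _ (h1.add h0c) (h2.add h0s)
        have l2 := (hconv' _ h1 h2).add (hconv' _ h0c h0s)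
        have l3 : Tendsto (fun n : ℕ => ∫ x, (h x + h0 x) ∂(U.map (fun y => y - t n))) atTop
            (nhds (∫ x, h x ∂lam + ∫ x, h0 x ∂lam)) := by
          refine l2.congr fun n => ?_
          rw [integral_add (hcc n h h1 h2) (hcc n h0 h0c h0s)]
        have := tendsto_nhds_unique l1 l3
        rw [integral_undef h0n] at this
        have e : ∫ x, (h x + h0 x) ∂lam = 0 := integral_undef hn
        have e2 : ∫ x, (h + h0) x ∂lam = 0 := e
        linarith
      · exact integral_undef hi
    rw [hz f hf hfc]
    by_cases hi : Integrable g lam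
    · have := cut_integral_tendsto lam g hi
      refine tendsto_nhds_unique ?_ this
      refine tendsto_const_nhds.congr fun n => ?_
      exact (hz _ (hcutg n) (hcutgs n)).symm
    · exact (integral_undef hi).symm
  -- main case
  have hgb : ∀ y, ‖g y‖ₑ ≤ ENNReal.ofReal C * ηm {s : ℝ | |y| - M < s} := fun y =>
    limit_bound P F ηm hweak hdom f hf C M hC hM y
  have hΦ : ENNReal.ofReal C * tailPhi ηm K M (-1) ≠ ⊤ :=
    ENNReal.mul_ne_top ENNReal.ofReal_ne_top (tailPhi_finite ηm K hU.ne M (-1) hM0 hη_int)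
  have hgi : Integrable g lam := by
    refine ⟨hgc.aestronglyMeasurable, ?_⟩
    refine lt_of_le_of_lt ?_ hΦ.lt_top
    have hA : ∀ A : ℕ, ∫⁻ y, ‖cut A y * g y‖ₑ ∂lam ≤ ENNReal.ofReal C * tailPhi ηm K M (-1) := by
      intro A
      have hi := hcase _ (hcutg A) (hcutgs A)
      rw [← ofReal_integral_norm_eq_lintegral_enorm hi]
      have l1 := hconv' (fun y => ‖cut A y * g y‖) (hcutg A).norm (hcutgs A).norm
      refine le_of_tendsto' ((ENNReal.continuous_ofReal.tendsto _).comp l1) fun n => ?_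
      simp only [Function.comp]
      rw [ofReal_integral_norm_eq_lintegral_enorm (hcc n _ (hcutg A) (hcutgs A))]
      refine total_le ηm K M _ (hb n) C _ fun y => le_trans ?_ (hgb y)
      rw [enorm_mul]
      refine mul_le_of_le_one_left zero_le ?_
      rw [Real.enorm_eq_ofReal_abs, abs_of_nonneg (cut_nonneg _ _)]
      exact ENNReal.ofReal_le_one.2 (cut_le _ _)
    have hlim : ∀ y, liminf (fun A : ℕ => ‖cut A y * g y‖ₑ) atTop = ‖g y‖ₑ := by
      intro y
      refine Tendsto.liminf_eq (tendsto_const_nhds.congr' ?_)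
      filter_upwards [cut_tendsto y] with n hn
      rw [hn, one_mul]
    have hF := lintegral_liminf_le (μ := lam) (u := atTop)
      (f := fun (A : ℕ) y => ‖cut A y * g y‖ₑ) (fun A => (hcutg A).measurable.enorm)
    simp_rw [hlim] at hF
    refine hF.trans ?_
    refine (liminf_le_liminf (Eventually.of_forall hA)).trans ?_
    simp
  -- one-step identity
  have hid := fun n => shifted_identity P μ0 f hf (t n) (hcc n f hf hfc)
  have hψb : ∀ n y, ‖∫ s, f (s + y) ∂(jumpLaw P (y + t n))‖ₑ ≤
      ENNReal.ofReal C * ηm {s : ℝ | |y| - M < s} := fun n y =>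
    expect_bound ηm _ (hdom _) f C M hC hM y
  have hψi : ∀ n, Integrable (fun y => ∫ s, f (s + y) ∂(jumpLaw P (y + t n)))
      (U.map (fun y => y - t n)) := fun n =>
    ⟨(hid n).1.aestronglyMeasurable,
      (total_le ηm K M _ (hb n) C _ (hψb n)).trans_lt hΦ.lt_top⟩
  have hμ0 : Tendsto (fun n => ∫ x, f (x - t n) ∂μ0) atTop (𝓝 0) := by
    have : Tendsto (fun n => ∫ x, f (x - t n) ∂μ0) atTop (𝓝 (∫ _, (0 : ℝ) ∂μ0)) := by
      refine tendsto_integral_of_dominated_convergence (fun _ => C) ?_ (integrable_const _) ?_ ?_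
      · intro n; fun_prop
      · intro n; exact Eventually.of_forall fun s => hC _
      · refine Eventually.of_forall fun x => ?_
        refine tendsto_const_nhds.congr' ?_
        filter_upwards [ht.eventually_ge_atTop (M + x)] with n hn
        rw [hM]
        have := neg_le_abs (x - t n)
        linarith
    simpa using this
  have hkey : ∀ A : ℕ, ‖∫ x, f x ∂lam - ∫ y, cut A y * g y ∂lam‖ₑ ≤
      ENNReal.ofReal C * tailPhi ηm K M A := by
    intro A
    have l1 : Tendsto (fun n => ∫ x, f x ∂(U.map (fun y => y - t n)) - ∫ x, f (x - t n) ∂μ0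
        - ∫ y, cut A y * g y ∂(U.map (fun y => y - t n))) atTop
        (𝓝 (∫ x, f x ∂lam - 0 - ∫ y, cut A y * g y ∂lam)) :=
      ((hconv' f hf hfc).sub hμ0).sub (hconv' _ (hcutg A) (hcutgs A))
    rw [sub_zero] at l1
    have hε : ∀ ε : ℝ, 0 < ε → ‖∫ x, f x ∂lam - ∫ y, cut A y * g y ∂lam‖ₑ ≤
        ENNReal.ofReal ε * (K * (2 * (A + 1 : ℕ) + 2)) + ENNReal.ofReal C * tailPhi ηm K M A := by
      intro ε hε
      refine le_of_tendsto l1.enorm ?_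
      have hu := unif_conv P F hweak f hf hfu C hC (A + 1) ε hε
      filter_upwards [ht.eventually hu] with n hn
      rw [(hid n).2, add_sub_cancel_left]
      exact core_est ηm K M _ (hb n) C _ g (hψi n) A (hcc n _ (hcutg A) (hcutgs A)) (hψb n) ε hn
    have l2 : Tendsto (fun ε : ℝ => ENNReal.ofReal ε * (K * (2 * (A + 1 : ℕ) + 2)) +
        ENNReal.ofReal C * tailPhi ηm K M A) (𝓝[>] 0)
        (𝓝 (0 * (K * (2 * (A + 1 : ℕ) + 2)) + ENNReal.ofReal C * tailPhi ηm K M A)) := by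
      refine Tendsto.add_const _ (ENNReal.Tendsto.mul_const ?_ (Or.inr (hbt _).ne))
      have := (ENNReal.continuous_ofReal.tendsto 0).mono_left (nhdsWithin_le_nhds (s := Ioi 0))
      simpa using this
    rw [zero_mul, zero_add] at l2
    refine ge_of_tendsto l2 ?_
    filter_upwards [self_mem_nhdsWithin] with ε h using hε ε h
  have l1 := (tendsto_const_nhds (x := ∫ x, f x ∂lam)).sub (cut_integral_tendsto lam g hgi)
  have l2 : Tendsto (fun A : ℕ => ENNReal.ofReal C * tailPhi ηm K M A) atTop (𝓝 0) := by
    have := ENNReal.Tendsto.const_mul (a := ENNReal.ofReal C)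
      (tailPhi_tendsto ηm K hU.ne M hM0 hη_int) (Or.inr ENNReal.ofReal_ne_top)
    simpa using this
  have l3 := le_of_tendsto_of_tendsto' l1.enorm l2 hkey
  have l4 : ∫ x, f x ∂lam - ∫ y, g y ∂lam = 0 := by
    simpa using l3
  linarith
end

section
/- Let $F$ be a probability distribution on $\mathbf{R}$ not concentrated at $0$, concentrated on $\mathbf{Z}$ with minimal span $1$, and let $\lambda$ be a nonnegative measure on $\mathbf{Z}$ satisfying $\lambda=F*\lambda$ and $\sup_{n\in\mathbf{Z}}\lambda\{n\}<\infty$. Then $\lambda$ is proportional to the counting measure on $\mathbf{Z}$, i.e. there is $c\ge0$ with $\lambda\{n\}=c$ for all $n\in\mathbf{Z}$. -/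
open MeasureTheory Filter Set

lemma cd_aux (p : ℤ → ℝ) (hp0 : ∀ x, 0 ≤ p x) (hp : HasSum p 1) (h : ℤ → ℝ) (C : ℝ)
    (hC : ∀ n, |h n| ≤ C) (hh : ∀ n, HasSum (fun x => p x * h (n - x)) (h n))
    (a : ℤ) (ha : 0 < p a) (m : ℤ) : h m ≤ h (m - a) := by
  by_contra hlt
  push Not at hlt
  set g : ℤ → ℝ := fun n => h n - h (n - a) with hg
  have hbd : BddAbove (range g) := by
    refine ⟨2 * C, ?_⟩
    rintro _ ⟨n, rfl⟩
    have h1 := abs_le.1 (hC n)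
    have h2 := abs_le.1 (hC (n - a))
    simp only [hg]
    linarith
  set M := ⨆ n, g n with hM
  have hgM : ∀ n, g n ≤ M := fun n => le_ciSup hbd n
  have hMpos : 0 < M := lt_of_lt_of_le (by simp only [hg]; linarith) (hgM m)
  have hstep : ∀ n, p a * (M - g (n - a)) ≤ M - g n := by
    intro n
    have e : HasSum (fun x => p x * (M - g (n - x))) (M - g n) := by
      have h1 := (hp.mul_right M).sub ((hh n).sub (hh (n - a)))
      have e1 : (fun x => p x * (M - g (n - x)))
          = fun b => p b * M - (p b * h (n - b) - p b * h (n - a - b)) := by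
        funext x
        simp only [hg]
        rw [show n - x - a = n - a - x by ring]
        ring
      have e2 : M - g n = 1 * M - (h n - h (n - a)) := by
        simp only [hg]
        ring
      rw [e1, e2]
      exact h1
    exact le_hasSum e a (fun x _ => mul_nonneg (hp0 x) (sub_nonneg.2 (hgM _)))
  have hp1 : p a ≤ 1 := le_hasSum hp a (fun x _ => hp0 x)
  have hiter : ∀ n, ∀ j : ℕ, p a ^ j * (M - g (n - j * a)) ≤ M - g n := by
    intro n j
    induction j with
    | zero => simp
    | succ j ih =>
      have h1 := mul_le_mul_of_nonneg_left (hstep (n - j * a)) (pow_nonneg ha.le j)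
      have e : n - ((j + 1 : ℕ) : ℤ) * a = n - j * a - a := by push_cast; ring
      rw [e, pow_succ, mul_assoc]
      linarith
  obtain ⟨k, hk⟩ := exists_nat_gt (2 * C / (M / 2))
  rw [div_lt_iff₀ (by positivity)] at hk
  have hpk : 0 < p a ^ k := pow_pos ha k
  obtain ⟨n, hn⟩ := exists_lt_of_lt_ciSup (show M - M / 2 * p a ^ k < ⨆ n, g n by
    rw [← hM]; have : 0 < M / 2 * p a ^ k := by positivity
    linarith)
  have hall : ∀ j ≤ k, M / 2 ≤ g (n - j * a) := by
    intro j hj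
    have h1 := hiter n j
    have h2 : p a ^ k ≤ p a ^ j := pow_le_pow_of_le_one ha.le hp1 hj
    have h3 := mul_le_mul_of_nonneg_right h2 (sub_nonneg.2 (hgM (n - j * a)))
    have h4 : p a ^ k * (M - g (n - j * a)) ≤ p a ^ k * (M / 2) := by linarith
    have := le_of_mul_le_mul_left h4 hpk
    linarith
  have htel : ∀ j ≤ k, j * (M / 2) ≤ h n - h (n - j * a) := by
    intro j hj
    induction j with
    | zero => simp
    | succ j ih =>
      have h1 := ih (by omega)
      have h2 := hall j (by omega)
      have e : n - ((j + 1 : ℕ) : ℤ) * a = n - j * a - a := by push_cast; ring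
      rw [e]
      simp only [hg] at h2
      push_cast
      linarith
  have h1 := htel k le_rfl
  have h2 := abs_le.1 (hC n)
  have h3 := abs_le.1 (hC (n - k * a))
  linarith

/-- **Choquet–Deny theorem, lattice case (Lemma 2).**
Let `F` be a probability distribution on `ℤ` not concentrated at `0` with minimal
span `1`, and let `λ` be a nonnegative measure on `ℤ` satisfying `λ = F * λ`
which is bounded on singletons. Then `λ` is proportional to the counting
measure on `ℤ`. -/
theorem choquet_deny_lattice
    (F : Measure ℤ) [IsProbabilityMeasure F]
    (hF0 : F {(0 : ℤ)} ≠ 1)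
    -- `ℤ` is the lattice with minimal span for `F`:
    (hspan : ∀ d : ℕ, 2 ≤ d → F {x : ℤ | (d : ℤ) ∣ x} < 1)
    (lam : Measure ℤ)
    -- the convolution identity `λ = F * λ`:
    (hconv : ∀ B : Set ℤ,
      lam B = ∫⁻ y, F {x : ℤ | x + y ∈ B} ∂lam)
    -- boundedness on singletons:
    (hbdd : (⨆ n : ℤ, lam {n}) < ⊤) :
    ∃ c : NNReal, ∀ n : ℤ, lam {n} = c := by
  have hfin : ∀ n, lam {n} ≠ ⊤ := fun n => ((le_iSup (fun n => lam {n}) n).trans_lt hbdd).ne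
  set p : ℤ → ℝ := fun x => (F {x}).toReal with hpdef
  set h : ℤ → ℝ := fun n => (lam {n}).toReal with hhdef
  have hFsum : ∑' x : ℤ, F {x} = 1 := by
    have := lintegral_countable' (μ := F) (fun _ : ℤ => 1)
    simpa using this.symm
  have hp : HasSum p 1 := by
    have h1 : HasSum p _ := ENNReal.hasSum_toReal (f := fun x : ℤ => F {x}) (by rw [hFsum]; simp)
    have h2 := ENNReal.tsum_toReal_eq (f := fun x : ℤ => F {x}) (fun x => measure_ne_top F _)
    rw [hFsum] at h2
    simpa [← h2] using h1
  have hlam : ∀ n, lam {n} = ∑' x : ℤ, F {x} * lam {n - x} := by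
    intro n
    rw [hconv {n}, lintegral_countable', ← (Equiv.subLeft n).tsum_eq]
    refine tsum_congr fun x => ?_
    have : {z : ℤ | z + (Equiv.subLeft n) x ∈ ({n} : Set ℤ)} = {x} := by
      ext z
      simp only [Equiv.subLeft_apply, mem_ofPred_eq, mem_singleton_iff]
      omega
    rw [this]
    simp
  have hh : ∀ n, HasSum (fun x => p x * h (n - x)) (h n) := by
    intro n
    have h1 := ENNReal.hasSum_toReal (f := fun x : ℤ => F {x} * lam {n - x})
      (by rw [← hlam]; exact hfin n)
    have h2 := ENNReal.tsum_toReal_eq (f := fun x : ℤ => F {x} * lam {n - x})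
      (fun x => ENNReal.mul_ne_top (measure_ne_top F _) (hfin _))
    rw [← hlam] at h2
    rw [← h2] at h1
    simpa [p, h, ENNReal.toReal_mul] using h1
  have hC : ∀ n, |h n| ≤ (⨆ n : ℤ, lam {n}).toReal := by
    intro n
    rw [abs_of_nonneg ENNReal.toReal_nonneg]
    exact ENNReal.toReal_mono hbdd.ne (le_iSup (fun n => lam {n}) n)
  have hp0 : ∀ x, 0 ≤ p x := fun x => ENNReal.toReal_nonneg
  have hper : ∀ a, F {a} ≠ 0 → ∀ m, h m = h (m - a) := by
    intro a ha m
    have hpa : 0 < p a := ENNReal.toReal_pos ha (measure_ne_top F _)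
    apply le_antisymm
    · exact cd_aux p hp0 hp h _ hC hh a hpa m
    · have := cd_aux p hp0 hp (fun n => - h n) _ (fun n => by rw [abs_neg]; exact hC n)
        (fun n => by simpa using (hh n).neg) a hpa m
      linarith
  let G : AddSubgroup ℤ :=
    { carrier := {a | ∀ m, h (m + a) = h m}
      zero_mem' := by intro m; simp
      add_mem' := by
        intro a b ha hb m
        rw [← add_assoc, hb, ha]
      neg_mem' := by
        intro a ha m
        have := ha (m + -a)
        rw [← this]; simp }
  have hsupp : ∀ a, F {a} ≠ 0 → a ∈ G := by
    intro a ha m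
    rw [hper a ha (m + a)]; simp
  have hfull : ∀ S : Set ℤ, (∀ a ∈ G, a ∈ S) → F S = 1 := by
    intro S hS
    rw [prob_compl_eq_zero_iff (MeasurableSet.of_discrete) |>.symm]
    rw [measure_null_iff_singleton (to_countable _)]
    intro a ha
    by_contra hne
    exact ha (hS a (hsupp a hne))
  have h1G : (1 : ℤ) ∈ G := by
    obtain ⟨d, hd⟩ := Int.subgroup_cyclic G
    have hdvd : ∀ a ∈ G, ((d.natAbs : ℕ) : ℤ) ∣ a := by
      intro a ha
      rw [hd, ← AddSubgroup.zmultiples_eq_closure, Int.mem_zmultiples_iff] at ha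
      simpa using ha
    have hlt : d.natAbs < 2 := by
      by_contra hge
      exact (hspan d.natAbs (by omega)).ne (hfull _ hdvd)
    have h0 : d.natAbs ≠ 0 := by
      intro h0
      refine hF0 (hfull _ fun a ha => ?_)
      have := hdvd a ha
      rw [h0] at this
      simpa using this
    rw [hd, ← AddSubgroup.zmultiples_eq_closure, Int.mem_zmultiples_iff]
    rw [← Int.natAbs_dvd, show d.natAbs = 1 by omega]
    simp
  refine ⟨(lam {0}).toNNReal, fun n => ?_⟩
  rw [ENNReal.coe_toNNReal (hfin 0)]
  have hnG : n ∈ G := by simpa using G.zsmul_mem h1G n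
  have := hnG 0
  rw [zero_add] at this
  exact (ENNReal.toReal_eq_toReal_iff' (hfin n) (hfin 0)).1 this
end

section
/- Let $X_n$ be a time-homogeneous Markov chain on $\mathbf{R}$ with jump variables $\xi(x)$ and renewal measure $U$ (for an arbitrary initial distribution). Suppose there exists $A>0$ with $\varepsilon\equiv\inf_{x\in\mathbf{R}}\mathbf{E}(\xi(x)\wedge A)>0$, and suppose $\delta\equiv\inf_{x\in\mathbf{R}}\mathbf{P}\{X_n>x\text{ for all }n\ge1\mid X_0=x\}>0$. Then $U(x,x+h]\le (A+h)/(\varepsilon\delta)$ for all $x\in\mathbf{R}$ and $h>0$; in particular $\sup_{k\in\mathbf{Z}}U(k,k+1]<\infty$. -/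
open MeasureTheory ProbabilityTheory Filter Set

/-- `stayAbove P c n x` is the probability that the chain started at `x`
satisfies `X_1 > c, …, X_n > c`. -/
noncomputable def stayAbove (P : Kernel ℝ ℝ) (c : ℝ) : ℕ → ℝ → ENNReal
  | 0, _ => 1
  | n + 1, x => ∫⁻ y in Set.Ioi c, stayAbove P c n y ∂(P x)

theorem measurable_stayAbove (P : Kernel ℝ ℝ) [IsMarkovKernel P] (c : ℝ) (n : ℕ) :
    Measurable (stayAbove P c n) := by
  induction n with
  | zero => exact measurable_const
  | succ n ih =>
    have : stayAbove P c (n + 1)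
        = fun x => ∫⁻ y, (Set.Ioi c).indicator (stayAbove P c n) y ∂(P x) := by
      funext x
      rw [lintegral_indicator measurableSet_Ioi]
      rfl
    rw [this]
    exact (ih.indicator measurableSet_Ioi).lintegral_kernel

theorem stayAbove_succ_le (P : Kernel ℝ ℝ) [IsMarkovKernel P] (c : ℝ) (n : ℕ) :
    ∀ x, stayAbove P c (n + 1) x ≤ stayAbove P c n x := by
  induction n with
  | zero =>
    intro x
    simp only [stayAbove]
    simpa using prob_le_one
  | succ n ih =>
    intro x
    exact lintegral_mono (fun y => ih y)

theorem stayAbove_anti_level (P : Kernel ℝ ℝ) {c d : ℝ} (hcd : c ≤ d) (n : ℕ) :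
    ∀ x, stayAbove P d n x ≤ stayAbove P c n x := by
  induction n with
  | zero => intro x; exact le_rfl
  | succ n ih =>
    intro x
    exact lintegral_mono' (Measure.restrict_mono (Set.Ioi_subset_Ioi hcd) le_rfl)
      (fun y => ih y)

theorem iInf_stayAbove_le (P : Kernel ℝ ℝ) [IsMarkovKernel P] (c x : ℝ) :
    ⨅ n, stayAbove P c n x ≤ ∫⁻ y in Set.Ioi c, ⨅ n, stayAbove P c n y ∂(P x) := by
  rw [lintegral_iInf (fun n => measurable_stayAbove P c n)]
  · exact le_iInf fun n => iInf_le _ (n + 1)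
  · exact antitone_nat_of_succ_le fun n y => stayAbove_succ_le P c n y
  · have : ∫⁻ y in Set.Ioi c, stayAbove P c 0 y ∂(P x) ≤ 1 := by
      simp only [stayAbove]
      simpa using prob_le_one
    exact ne_top_of_le_ne_top ENNReal.one_ne_top this

theorem sum_chainDist_le (P : Kernel ℝ ℝ) (μ0 : Measure ℝ)
    (V : ℝ → ENNReal) (hV : Measurable V) (B : Set ℝ) (hB : MeasurableSet B)
    (h : ∀ y, B.indicator 1 y + ∫⁻ z, V z ∂(P y) ≤ V y) (N : ℕ) :
    ∑ n ∈ Finset.range N, chainDist P μ0 n B + ∫⁻ z, V z ∂(chainDist P μ0 N)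
      ≤ ∫⁻ z, V z ∂μ0 := by
  induction N with
  | zero => simp [chainDist]
  | succ N ih =>
    refine le_trans ?_ ih
    rw [Finset.sum_range_succ, add_assoc]
    gcongr
    rw [chainDist, Measure.lintegral_bind P.measurable.aemeasurable hV.aemeasurable,
      ← lintegral_indicator_one hB, ← lintegral_add_left (measurable_one.indicator hB)]
    exact lintegral_mono h

theorem renewal_bound_aux
    (P : Kernel ℝ ℝ) [IsMarkovKernel P]
    (μ0 : Measure ℝ) [IsProbabilityMeasure μ0]
    (A : ℝ) (hA : 0 < A)
    (ε : ℝ) (hε : 0 < ε)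
    (hdrift : ∀ x : ℝ, ε ≤ ∫ s, min s A ∂(jumpLaw P x))
    (δ : ℝ) (hδ : 0 < δ)
    (htrans : ∀ x : ℝ, ENNReal.ofReal δ ≤ ⨅ n : ℕ, stayAbove P x n x)
    (c h : ℝ) (hh : 0 < h) :
    renewalMeasure P μ0 (Set.Ioc c (c + h)) ≤ ENNReal.ofReal ((A + h) / (ε * δ)) := by
  have hδ1 : δ ≤ 1 := by
    have := (htrans 0).trans (iInf_le _ 0)
    simpa [stayAbove] using this
  set S : ℝ := (A + h) / (ε * δ) with hS
  have hS0 : 0 < S := by positivity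
  have hSeq : (A + h) / ε = δ * S := by rw [hS]; field_simp
  obtain ⟨b, hb⟩ : ∃ b, b = c + h := ⟨_, rfl⟩
  rw [← hb]
  set s : ℝ → ENNReal := fun y => ⨅ n, stayAbove P b n y with hs
  have hsm : Measurable s := Measurable.iInf fun n => measurable_stayAbove P b n
  have hs1 : ∀ y, s y ≤ 1 := fun y => (iInf_le _ 0).trans (by simp [stayAbove])
  have hsd : ∀ y, b ≤ y → ENNReal.ofReal δ ≤ s y := fun y hy =>
    (htrans y).trans (iInf_mono fun n => stayAbove_anti_level P hy n y)
  set u : ℝ → ℝ := fun y => (s y).toReal with hu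
  have hum : Measurable u := hsm.ennreal_toReal
  have hu0 : ∀ y, 0 ≤ u y := fun y => ENNReal.toReal_nonneg
  have hu1 : ∀ y, u y ≤ 1 := fun y => by
    have := ENNReal.toReal_mono ENNReal.one_ne_top (hs1 y)
    simpa using this
  have hud : ∀ y, b ≤ y → δ ≤ u y := fun y hy =>
    (ENNReal.ofReal_le_iff_le_toReal (ne_top_of_le_ne_top ENNReal.one_ne_top (hs1 y))).1
      (hsd y hy)
  have huint : ∀ x, Integrable ((Set.Ioi b).indicator u) (P x) := fun x => by
    refine Integrable.of_bound (hum.indicator measurableSet_Ioi).aestronglyMeasurable 1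
      (Eventually.of_forall fun y => ?_)
    by_cases hy : y ∈ Set.Ioi b
    · rw [Set.indicator_of_mem hy, Real.norm_of_nonneg (hu0 y)]; exact hu1 y
    · rw [Set.indicator_of_notMem hy]; simp
  have huP : ∀ x, u x ≤ ∫ y, (Set.Ioi b).indicator u y ∂(P x) := fun x => by
    rw [integral_indicator measurableSet_Ioi, hu]
    simp only
    rw [integral_toReal hsm.aemeasurable (Eventually.of_forall fun y =>
      (hs1 y).trans_lt ENNReal.one_lt_top)]
    refine ENNReal.toReal_mono ?_ (iInf_stayAbove_le P b x)
    have : ∫⁻ y in Set.Ioi b, s y ∂(P x) ≤ ∫⁻ y in Set.Ioi b, 1 ∂(P x) :=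
      lintegral_mono fun y => hs1 y
    refine ne_top_of_le_ne_top ENNReal.one_ne_top (this.trans ?_)
    simpa using prob_le_one
  set D : ℝ → ℝ := fun y => max 0 (b + A - max y c) with hD
  have hD0 : ∀ y, 0 ≤ D y := fun y => le_max_left _ _
  have hDle : ∀ y, D y ≤ A + h := fun y => by
    refine max_le (by positivity) ?_
    have := le_max_right y c
    linarith
  have hDm : Measurable D := by rw [hD]; fun_prop
  set V : ℝ → ℝ := fun z => if z ≤ b then D z / ε + (1 - δ) * S else (1 - u z) * S with hV
  have hVm : Measurable V := by
    refine Measurable.ite measurableSet_Iic ?_ ?_ <;> fun_prop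
  have hV0 : ∀ z, 0 ≤ V z := fun z => by
    simp only [hV]
    split_ifs
    · have := div_nonneg (hD0 z) hε.le
      have := mul_nonneg (sub_nonneg.2 hδ1) hS0.le
      linarith
    · exact mul_nonneg (sub_nonneg.2 (hu1 z)) hS0.le
  have hVS : ∀ z, V z ≤ S := fun z => by
    simp only [hV]
    split_ifs
    · have : D z / ε ≤ (A + h) / ε := by gcongr; exact hDle z
      rw [hSeq] at this
      linarith
    · have := mul_nonneg (hu0 z) hS0.le
      linarith
  have hVint : ∀ x, Integrable V (P x) := fun x =>
    Integrable.of_bound hVm.aestronglyMeasurable S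
      (Eventually.of_forall fun y => by rw [Real.norm_of_nonneg (hV0 y)]; exact hVS y)
  have hVle : ∀ z, V z ≤ D z / ε + (1 - δ) * S := fun z => by
    simp only [hV]
    split_ifs with hz
    · exact le_rfl
    · have := div_nonneg (hD0 z) hε.le
      have : (1 - u z) * S ≤ (1 - δ) * S := by
        gcongr
        exact hud z (not_le.1 hz).le
      linarith
  have hmin : ∀ y, ε ≤ ∫ z, min (z - y) A ∂(P y) := fun y => by
    have := hdrift y
    rwa [jumpLaw, integral_map (by fun_prop)
      (by exact Measurable.aestronglyMeasurable (by fun_prop))] at this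
  have hminint : ∀ y, Integrable (fun z => min (z - y) A) (P y) := fun y => by
    by_contra hc
    have := hmin y
    rw [integral_undef hc] at this
    linarith
  have hreal : ∀ y, (Set.Ioc c b).indicator 1 y + ∫ z, V z ∂(P y) ≤ V y := fun y => by
    by_cases hyb : y ≤ b
    · by_cases hyc : c < y
      · have hDy : D y = b + A - y := by
          simp only [hD]
          rw [max_eq_left hyc.le, max_eq_right (by linarith)]
        have hpt : ∀ z, V z ≤ (D y - min (z - y) A) / ε + (1 - δ) * S := fun z => by
          refine (hVle z).trans ?_
          have : D z ≤ D y - min (z - y) A := by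
            rw [hDy]
            refine max_le ?_ ?_
            · have := min_le_right (z - y) A
              linarith
            · have := min_le_left (z - y) A
              have := le_max_left z c
              linarith
          gcongr
        have hi := integral_mono (hVint y)
          ((((integrable_const (D y)).sub (hminint y)).div_const ε).add
            (integrable_const ((1 - δ) * S))) hpt
        have e : ∫ z, ((D y - min (z - y) A) / ε + (1 - δ) * S) ∂(P y)
            = (D y - ∫ z, min (z - y) A ∂(P y)) / ε + (1 - δ) * S := by
          have hint : Integrable (fun z => (D y - min (z - y) A) / ε) (P y) :=
            ((integrable_const (D y)).sub (hminint y)).div_const ε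
          rw [integral_add hint (integrable_const _), integral_div,
            integral_sub (integrable_const _) (hminint y)]
          simp
        have hi' : ∫ z, V z ∂(P y)
            ≤ (D y - ∫ z, min (z - y) A ∂(P y)) / ε + (1 - δ) * S := hi.trans_eq e
        have h2 : (D y - ∫ z, min (z - y) A ∂(P y)) / ε ≤ (D y - ε) / ε := by
          gcongr
          exact hmin y
        rw [sub_div, sub_div, div_self hε.ne'] at h2
        rw [sub_div] at hi'
        have hVy : V y = D y / ε + (1 - δ) * S := by simp only [hV]; rw [if_pos hyb]
        have hmem : y ∈ Set.Ioc c b := ⟨hyc, hyb⟩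
        rw [Set.indicator_of_mem hmem, hVy, Pi.one_apply]
        linarith
      · have hyc' := not_lt.1 hyc
        rw [Set.indicator_of_notMem (fun hm => hyc hm.1), zero_add]
        have hVy : V y = S := by
          simp only [hV, hD]
          rw [if_pos hyb, max_eq_right hyc', max_eq_right (by linarith)]
          have : b + A - c = A + h := by linarith
          rw [this, hSeq]
          ring
        rw [hVy]
        have := integral_mono (hVint y) (integrable_const S) hVS
        simpa using this
    · rw [Set.indicator_of_notMem (fun hm => hyb hm.2), zero_add]
      have hVy : V y = (1 - u y) * S := by simp only [hV]; rw [if_neg hyb]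
      have hpt : ∀ z, V z ≤ (1 - (Set.Ioi b).indicator u z) * S := fun z => by
        by_cases hz : z ≤ b
        · rw [Set.indicator_of_notMem (by simpa using hz)]
          simpa using hVS z
        · rw [Set.indicator_of_mem (by simpa using hz)]
          simp only [hV]
          rw [if_neg hz]
      have hi := integral_mono (hVint y)
        (((integrable_const (1 : ℝ)).sub (huint y)).mul_const S) hpt
      have e : ∫ z, ((1 - (Set.Ioi b).indicator u z) * S) ∂(P y)
          = (1 - ∫ z, (Set.Ioi b).indicator u z ∂(P y)) * S := by
        rw [integral_mul_const, integral_sub (integrable_const _) (huint y)]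
        simp
      rw [hVy]
      refine (hi.trans_eq e).trans ?_
      have := huP y
      gcongr
  have hmain := sum_chainDist_le P μ0 (fun z => ENNReal.ofReal (V z)) hVm.ennreal_ofReal
    (Set.Ioc c b) measurableSet_Ioc (fun y => by
      rw [← ofReal_integral_eq_lintegral_ofReal (hVint y) (Eventually.of_forall hV0)]
      have h1 : (Set.Ioc c b).indicator (1 : ℝ → ENNReal) y
          = ENNReal.ofReal ((Set.Ioc c b).indicator 1 y) := by
        by_cases hy : y ∈ Set.Ioc c b
        · simp [Set.indicator_of_mem hy]
        · simp [Set.indicator_of_notMem hy]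
      have h0 : 0 ≤ (Set.Ioc c b).indicator (1 : ℝ → ℝ) y :=
        Set.indicator_nonneg (fun _ _ => zero_le_one) y
      rw [h1, ← ENNReal.ofReal_add h0 (integral_nonneg hV0)]
      exact ENNReal.ofReal_le_ofReal (hreal y))
  have hfin : ∫⁻ z, ENNReal.ofReal (V z) ∂μ0 ≤ ENNReal.ofReal S := by
    calc ∫⁻ z, ENNReal.ofReal (V z) ∂μ0 ≤ ∫⁻ _, ENNReal.ofReal S ∂μ0 :=
          lintegral_mono fun z => ENNReal.ofReal_le_ofReal (hVS z)
      _ = ENNReal.ofReal S := by simp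
  rw [renewalMeasure, Measure.sum_apply _ measurableSet_Ioc]
  exact ENNReal.tsum_le_of_sum_range_le fun N =>
    (le_self_add.trans (hmain N)).trans hfin

/-- **Theorem 2.** If `ε = inf_x E(ξ(x) ∧ A) > 0` for some `A > 0` and
`δ = inf_x P{X_n > x for all n ≥ 1 | X_0 = x} > 0`, then
`U(x, x+h] ≤ (A+h)/(εδ)` for all `x ∈ ℝ` and `h > 0`; in particular the renewal
measure is bounded on unit intervals. -/
theorem renewal_measure_bound_of_drift_and_transience
    (P : Kernel ℝ ℝ) [IsMarkovKernel P]
    (μ0 : Measure ℝ) [IsProbabilityMeasure μ0]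
    (A : ℝ) (hA : 0 < A)
    (ε : ℝ) (hε : 0 < ε)
    -- `ε ≤ E (ξ(x) ∧ A)` for all `x`:
    (hdrift : ∀ x : ℝ, ε ≤ ∫ s, min s A ∂(jumpLaw P x))
    (δ : ℝ) (hδ : 0 < δ)
    -- `δ ≤ P{X_n > x for all n ≥ 1 | X_0 = x}` for all `x`:
    (htrans : ∀ x : ℝ, ENNReal.ofReal δ ≤ ⨅ n : ℕ, stayAbove P x n x) :
    (∀ x : ℝ, ∀ h : ℝ, 0 < h →
        renewalMeasure P μ0 (Set.Ioc x (x + h)) ≤ ENNReal.ofReal ((A + h) / (ε * δ)))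
      ∧ (⨆ k : ℤ, renewalMeasure P μ0 (Set.Ioc (k : ℝ) (k + 1))) < ⊤ := by
  have key := renewal_bound_aux P μ0 A hA ε hε hdrift δ hδ htrans
  refine ⟨key, ?_⟩
  exact (iSup_le fun k : ℤ => key (k : ℝ) 1 one_pos).trans_lt ENNReal.ofReal_lt_top
end

section
/- Let $X_n$ be a time-homogeneous Markov chain on $\mathbf{R}$ with jump variables $\xi(x)$. Suppose there is a random variable $\zeta$ with $\mathbf{E}\zeta>0$ such that $\xi(x)\ge_{\rm st}\zeta$ for every $x\in\mathbf{R}$. Then for any $A>0$ such that $\varepsilon\equiv\mathbf{E}(\zeta\wedge A)>0$, the renewal measure satisfies $U(x,x+h]\le (A+h)A/\varepsilon^2$ for all $x\in\mathbf{R}$ and $h>0$; in particular $\sup_{k\in\mathbf{Z}}U(k,k+1]<\infty$. -/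
open MeasureTheory ProbabilityTheory Filter Set

/-- `stayF ζm A n y` is the probability that the walk with steps `ζ ∧ A` started at `y`
stays positive up to time `n`. -/
noncomputable def stayF (ζm : Measure ℝ) (A : ℝ) : ℕ → ℝ → ℝ
  | 0 => fun y => if 0 < y then 1 else 0
  | n + 1 => fun y => if 0 < y then ∫ s, stayF ζm A n (y + min s A) ∂ζm else 0

lemma integrable_mono_comp (ζm : Measure ℝ) [IsProbabilityMeasure ζm] (A y C : ℝ) (f : ℝ → ℝ)
    (hm : Monotone f) (h0 : ∀ y, 0 ≤ f y) (h1 : ∀ y, f y ≤ C) :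
    Integrable (fun s => f (y + min s A)) ζm := by
  refine Integrable.of_bound (C := C) ?_ ?_
  · exact (hm.measurable.comp (by fun_prop)).aestronglyMeasurable
  · exact .of_forall fun s => by rw [Real.norm_eq_abs, abs_of_nonneg (h0 _)]; exact h1 _

lemma stayF_basic (ζm : Measure ℝ) [IsProbabilityMeasure ζm] (A : ℝ) (n : ℕ) :
    Monotone (stayF ζm A n) ∧ (∀ y, 0 ≤ stayF ζm A n y) ∧ (∀ y, stayF ζm A n y ≤ 1) := by
  induction n with
  | zero =>
    refine ⟨fun a b hab => ?_, fun y => ?_, fun y => ?_⟩ <;> simp only [stayF] <;> split_ifs <;>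
      first | linarith | norm_num
  | succ n ih =>
    obtain ⟨hm, h0, h1⟩ := ih
    have hi := fun y => integrable_mono_comp ζm A y 1 _ hm h0 h1
    have hn : ∀ y, 0 ≤ ∫ s, stayF ζm A n (y + min s A) ∂ζm := fun y =>
      integral_nonneg fun s => h0 _
    refine ⟨fun a b hab => ?_, fun y => ?_, fun y => ?_⟩ <;> simp only [stayF] <;> split_ifs
    · exact integral_mono (hi a) (hi b) fun s => hm (by linarith)
    · linarith
    · exact hn b
    · exact le_rfl
    · exact hn y
    · exact le_rfl
    · calc _ ≤ ∫ s, (1 : ℝ) ∂ζm := integral_mono (hi y) (integrable_const _) fun s => h1 _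
        _ = 1 := by simp
    · norm_num

lemma stayF_nonpos (ζm : Measure ℝ) (A : ℝ) (n : ℕ) (y : ℝ) (hy : y ≤ 0) :
    stayF ζm A n y = 0 := by
  cases n <;> simp [stayF, not_lt.2 hy]

lemma stayF_succ_le (ζm : Measure ℝ) [IsProbabilityMeasure ζm] (A : ℝ) (n : ℕ) :
    ∀ y, stayF ζm A (n + 1) y ≤ stayF ζm A n y := by
  induction n with
  | zero =>
    intro y
    by_cases hy : 0 < y
    · have := (stayF_basic ζm A 1).2.2 y
      simpa [stayF, hy] using this
    · rw [stayF_nonpos _ _ _ _ (not_lt.1 hy), stayF_nonpos _ _ _ _ (not_lt.1 hy)]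
  | succ n ih =>
    intro y
    by_cases hy : 0 < y
    · rw [stayF, stayF]
      simp only [hy, if_true]
      obtain ⟨hm, h0, h1⟩ := stayF_basic ζm A n
      obtain ⟨hm', h0', h1'⟩ := stayF_basic ζm A (n + 1)
      exact integral_mono (integrable_mono_comp ζm A y 1 _ hm' h0' h1')
        (integrable_mono_comp ζm A y 1 _ hm h0 h1) fun s => ih _
    · rw [stayF_nonpos _ _ _ _ (not_lt.1 hy), stayF_nonpos _ _ _ _ (not_lt.1 hy)]

lemma stayF_tendsto (ζm : Measure ℝ) [IsProbabilityMeasure ζm] (A : ℝ) (n : ℕ) :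
    Tendsto (stayF ζm A n) atTop (nhds 1) := by
  induction n with
  | zero =>
    refine tendsto_const_nhds.congr' ?_
    filter_upwards [eventually_gt_atTop 0] with y hy
    simp [stayF, hy]
  | succ n ih =>
    obtain ⟨hm, h0, h1⟩ := stayF_basic ζm A n
    have : Tendsto (fun y => ∫ s, stayF ζm A n (y + min s A) ∂ζm) atTop
        (nhds (∫ s, (1 : ℝ) ∂ζm)) := by
      refine tendsto_integral_filter_of_dominated_convergence (fun _ => 1) ?_ ?_
        (integrable_const _) ?_
      · exact .of_forall fun y => (integrable_mono_comp ζm A y 1 _ hm h0 h1).aestronglyMeasurable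
      · exact .of_forall fun y => .of_forall fun s => by
          rw [Real.norm_eq_abs, abs_of_nonneg (h0 _)]; exact h1 _
      · exact .of_forall fun s => ih.comp (tendsto_atTop_add_const_right _ _ tendsto_id)
    simp only [integral_const, probReal_univ, smul_eq_mul, mul_one] at this
    refine this.congr' ?_
    filter_upwards [eventually_gt_atTop 0] with y hy
    simp [stayF, hy]

lemma shift_integral (f : ℝ → ℝ) (hm : Monotone f) (h0 : ∀ y, 0 ≤ f y) (h1 : ∀ y, f y ≤ 1)
    (hz : ∀ y ≤ 0, f y = 0) (A : ℝ) (hA : 0 < A) (M t : ℝ) (ht : t ≤ A) :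
    t - A * (1 - f M) ≤ ∫ x in (-A)..M, (f (x + t) - f x) := by
  have hi : ∀ a b, IntervalIntegrable f volume a b := fun a b => hm.intervalIntegrable
  have hi' : IntervalIntegrable (fun x => f (x + t)) volume (-A) M :=
    Monotone.intervalIntegrable fun a b hab => hm (by linarith)
  rw [intervalIntegral.integral_sub hi' (hi _ _), intervalIntegral.integral_comp_add_right,
    intervalIntegral.integral_interval_sub_interval_comm' (hi _ _) (hi _ _) (hi _ _)]
  have e0 : ∫ x in (-A)..(-A + t), f x = 0 := by
    rw [intervalIntegral.integral_congr (g := fun _ => (0 : ℝ))]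
    · simp
    · intro x hx
      apply hz
      exact hx.2.trans (max_le (by linarith) (by linarith))
  rw [e0, sub_zero]
  have hfM := h1 M
  rcases le_total 0 t with h | h
  · calc t - A * (1 - f M) ≤ t * f M := by nlinarith
      _ = ∫ x in M..(M + t), f M := by simp
      _ ≤ _ := intervalIntegral.integral_mono_on (by linarith) (by simp) (hi _ _)
          fun x hx => hm hx.1
  · have : ∫ x in (M + t)..M, f x ≤ ∫ x in (M + t)..M, (1 : ℝ) :=
      intervalIntegral.integral_mono_on (by linarith) (hi _ _) (by simp) fun x hx => h1 x
    rw [intervalIntegral.integral_symm]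
    simp only [intervalIntegral.integral_const, smul_eq_mul, mul_one] at this
    nlinarith

lemma integrable_minA (ζm : Measure ℝ) [IsProbabilityMeasure ζm]
    (hζ_int : Integrable (fun s : ℝ => s) ζm) (A : ℝ) :
    Integrable (fun s => min s A) ζm := hζ_int.inf (integrable_const A)

lemma stay_key (ζm : Measure ℝ) [IsProbabilityMeasure ζm]
    (hζ_int : Integrable (fun s : ℝ => s) ζm) (A : ℝ) (hA : 0 < A) (n : ℕ) :
    ∫ s, min s A ∂ζm ≤ A * ∫ s, stayF ζm A n (min s A) ∂ζm := by
  obtain ⟨hm, h0, h1⟩ := stayF_basic ζm A n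
  have hz := stayF_nonpos ζm A n
  have hle := stayF_succ_le ζm A n
  have hsucc : ∀ y, 0 < y → ∫ s, stayF ζm A n (y + min s A) ∂ζm = stayF ζm A (n + 1) y := by
    intro y hy; simp [stayF, hy]
  have hlim := stayF_tendsto ζm A n
  generalize stayF ζm A n = f at *
  set c := ∫ s, f (min s A) ∂ζm with hc
  have hfi := fun y => integrable_mono_comp ζm A y 1 f hm h0 h1
  have key : ∀ M, 0 < M → ∫ s, min s A ∂ζm - A * (1 - f M) ≤ A * c := by
    intro M hM
    let F : ℝ → ℝ → ℝ := fun x s => f (x + min s A) - f x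
    have hFint : Integrable (Function.uncurry F)
        ((volume.restrict (Set.uIoc (-A) M)).prod ζm) := by
      haveI : IsFiniteMeasure (volume.restrict (Set.uIoc (-A) M)) :=
        ⟨by simp [Set.uIoc, Real.volume_Ioc]⟩
      refine Integrable.of_bound (C := 1) ?_ (.of_forall fun p => ?_)
      · refine Measurable.aestronglyMeasurable ?_
        exact (hm.measurable.comp (by fun_prop)).sub (hm.measurable.comp measurable_fst)
      · simp only [Function.uncurry, F, Real.norm_eq_abs]
        rw [abs_le]
        constructor <;> linarith [h0 (p.1 + min p.2 A), h1 (p.1 + min p.2 A), h0 p.1, h1 p.1]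
    have hswap := intervalIntegral_integral_swap hFint
    have hlow : ∫ s, min s A ∂ζm - A * (1 - f M) ≤ ∫ s, (∫ x in (-A)..M, F x s) ∂ζm := by
      have hmi := integrable_minA ζm hζ_int A
      have : ∫ s, (min s A - A * (1 - f M)) ∂ζm = ∫ s, min s A ∂ζm - A * (1 - f M) := by
        rw [integral_sub hmi (integrable_const _)]; simp
      rw [← this]
      refine integral_mono (hmi.sub (integrable_const _)) ?_ fun s =>
        shift_integral f hm h0 h1 hz A hA M _ (min_le_right _ _)
      have := hFint.integral_prod_right
      simpa [intervalIntegral.integral_of_le (by linarith : -A ≤ M),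
        Set.uIoc_of_le (by linarith : -A ≤ M)] using this
    have hG : ∀ x, ∫ s, F x s ∂ζm = ∫ s, f (x + min s A) ∂ζm - f x := by
      intro x
      simp only [F]
      rw [integral_sub (hfi x) (integrable_const _)]; simp
    have hGmono : Monotone (fun x => ∫ s, f (x + min s A) ∂ζm) := fun a b hab =>
      integral_mono (hfi a) (hfi b) fun s => hm (by linarith)
    have hGi : ∀ a b, IntervalIntegrable (fun x => ∫ s, F x s ∂ζm) volume a b := by
      intro a b
      simp only [hG]
      exact hGmono.intervalIntegrable.sub hm.intervalIntegrable
    rw [← hswap, ← intervalIntegral.integral_add_adjacent_intervals (hGi (-A) 0) (hGi 0 M)] at hlow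
    have u1 : ∫ x in (-A)..0, ∫ s, F x s ∂ζm ≤ ∫ x in (-A)..0, c := by
      refine intervalIntegral.integral_mono_on (by linarith) (hGi _ _) (by simp) fun x hx => ?_
      have h := hGmono hx.2
      simp only [zero_add] at h
      rw [hG]
      linarith [h0 x]
    have u2 : ∫ x in (0:ℝ)..M, ∫ s, F x s ∂ζm ≤ ∫ x in (0:ℝ)..M, (0 : ℝ) := by
      refine intervalIntegral.integral_mono_on_of_le_Ioo (by linarith) (hGi _ _) (by simp)
        fun x hx => ?_
      rw [hG, hsucc x hx.1]
      linarith [hle x]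
    simp only [intervalIntegral.integral_const, smul_eq_mul] at u1 u2
    linarith
  have hl : Tendsto (fun M => ∫ s, min s A ∂ζm - A * (1 - f M)) atTop
      (nhds (∫ s, min s A ∂ζm - A * (1 - 1))) :=
    tendsto_const_nhds.sub ((tendsto_const_nhds.sub hlim).const_mul A)
  have := le_of_tendsto hl ((eventually_gt_atTop 0).mono key)
  simpa using this

lemma stay_lower (ζm : Measure ℝ) [IsProbabilityMeasure ζm]
    (hζ_int : Integrable (fun s : ℝ => s) ζm) (A : ℝ) (hA : 0 < A) (n : ℕ) (y : ℝ) (hy : 0 < y) :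
    (∫ s, min s A ∂ζm) / A ≤ stayF ζm A n y := by
  refine le_trans ?_ (stayF_succ_le ζm A n y)
  rw [div_le_iff₀ hA, mul_comm]
  refine (stay_key ζm hζ_int A hA n).trans (mul_le_mul_of_nonneg_left ?_ hA.le)
  obtain ⟨hm, h0, h1⟩ := stayF_basic ζm A n
  have h := integrable_mono_comp ζm A 0 1 _ hm h0 h1
  simp only [zero_add] at h
  simp only [stayF, hy, if_true]
  exact integral_mono h (integrable_mono_comp ζm A y 1 _ hm h0 h1) fun s => hm (by linarith)

/-- The Lyapunov function. -/
noncomputable def lyapV (ζm : Measure ℝ) (A h : ℝ) (n : ℕ) (y : ℝ) : ℝ :=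
  if y ≤ h then max y 0 else (A + h) * A / (∫ s, min s A ∂ζm) * stayF ζm A n (y - h)

section lyap
variable (ζm : Measure ℝ) [IsProbabilityMeasure ζm]
    (hζ_int : Integrable (fun s : ℝ => s) ζm) (A : ℝ) (hA : 0 < A)
    (hε : 0 < ∫ s, min s A ∂ζm) (h : ℝ) (hh : 0 < h) (n : ℕ)

include hζ_int hA hε hh

lemma lyapV_ge (y : ℝ) (hy : h < y) : A + h ≤ lyapV ζm A h n y := by
  have := stay_lower ζm hζ_int A hA n (y - h) (by linarith)
  rw [lyapV, if_neg (not_le.2 hy)]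
  calc A + h = (A + h) * A / (∫ s, min s A ∂ζm) * ((∫ s, min s A ∂ζm) / A) := by field_simp
    _ ≤ _ := by gcongr

lemma lyapV_mono : Monotone (lyapV ζm A h n) := by
  intro a b hab
  have hm := (stayF_basic ζm A n).1
  by_cases hb : b ≤ h
  · rw [lyapV, lyapV, if_pos hb, if_pos (hab.trans hb)]
    exact max_le_max hab le_rfl
  · by_cases ha : a ≤ h
    · have := lyapV_ge ζm hζ_int A hA hε h hh n b (not_le.1 hb)
      refine le_trans ?_ this
      rw [lyapV, if_pos ha]
      exact max_le (by linarith) (by linarith)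
    · rw [lyapV, lyapV, if_neg hb, if_neg ha]
      have := hm (sub_le_sub_right hab h)
      gcongr

lemma lyapV_nonneg (y : ℝ) : 0 ≤ lyapV ζm A h n y := by
  have h0 := (stayF_basic ζm A n).2.1 (y - h)
  rw [lyapV]; split_ifs
  · exact le_max_right _ _
  · positivity

lemma lyapV_le (y : ℝ) : lyapV ζm A h n y ≤ (A + h) * A / (∫ s, min s A ∂ζm) := by
  have hbig : ∀ z, h < z → lyapV ζm A h n z ≤ (A + h) * A / (∫ s, min s A ∂ζm) := by
    intro z hz
    rw [lyapV, if_neg (not_le.2 hz)]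
    exact mul_le_of_le_one_right (by positivity) ((stayF_basic ζm A n).2.2 _)
  exact (lyapV_mono ζm hζ_int A hA hε h hh n (le_max_left y (h + 1))).trans
    (hbig _ (lt_of_lt_of_le (by linarith) (le_max_right _ _)))

lemma lyapV_drift (y : ℝ) :
    lyapV ζm A h (n + 1) y + (Set.Ioc 0 h).indicator (fun _ => ∫ s, min s A ∂ζm) y ≤
      ∫ s, lyapV ζm A h n (y + min s A) ∂ζm := by
  have hm := lyapV_mono ζm hζ_int A hA hε h hh n
  have h0 := lyapV_nonneg ζm hζ_int A hA hε h hh n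
  have hi := integrable_mono_comp ζm A y _ _ hm h0 (lyapV_le ζm hζ_int A hA hε h hh n)
  have hge := lyapV_ge ζm hζ_int A hA hε h hh n
  obtain ⟨fm, f0, f1⟩ := stayF_basic ζm A n
  rcases le_or_gt y 0 with hy | hy
  · rw [Set.indicator_of_notMem (by simp [hy]), lyapV, if_pos (by linarith), max_eq_right hy]
    simpa using integral_nonneg fun s => h0 _
  rcases le_or_gt y h with hy' | hy'
  · rw [Set.indicator_of_mem (show y ∈ Set.Ioc 0 h from ⟨hy, hy'⟩), lyapV, if_pos hy', max_eq_left hy.le]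
    have hmi := integrable_minA ζm hζ_int A
    calc _ = ∫ s, (y + min s A) ∂ζm := by
          rw [integral_add (integrable_const _) hmi]; simp
      _ ≤ _ := integral_mono ((integrable_const _).add hmi) hi fun s => ?_
    have hs := min_le_right s A
    rcases le_or_gt (y + min s A) h with hz | hz
    · simp only [lyapV, if_pos hz]; exact le_max_left _ _
    · have := hge _ hz
      simp only at this ⊢
      linarith
  · rw [Set.indicator_of_notMem (by simp [hy']), lyapV, if_neg (not_le.2 hy'), add_zero, stayF]
    simp only [sub_pos.2 hy', if_true]
    rw [← integral_const_mul]
    refine integral_mono ((integrable_mono_comp ζm A (y - h) 1 _ fm f0 f1).const_mul _) hi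
      fun s => ?_
    have e : y - h + min s A = y + min s A - h := by ring
    simp only [e]
    rcases le_or_gt (y + min s A) h with hz | hz
    · rw [stayF_nonpos _ _ _ _ (by linarith), mul_zero]; exact h0 _
    · rw [lyapV, if_neg (not_le.2 hz)]

end lyap

lemma upper_le (μ ν : Measure ℝ) [IsProbabilityMeasure μ] [IsProbabilityMeasure ν]
    (H : ∀ t : ℝ, μ {s : ℝ | t < s} ≤ ν {s : ℝ | t < s}) (S : Set ℝ) (hS : IsUpperSet S) :
    μ S ≤ ν S := by
  rcases S.eq_empty_or_nonempty with rfl | hne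
  · simp
  by_cases hb : BddBelow S
  · have h1 : Ioi (sInf S) ⊆ S := fun x hx => by
      obtain ⟨z, hz, hzx⟩ := exists_lt_of_csInf_lt hne hx
      exact hS hzx.le hz
    have h2 : S ⊆ Ici (sInf S) := fun x hx => csInf_le hb hx
    rcases mem_Ici_Ioi_of_subset_of_subset h1 h2 with h | h
    · rw [h]
      set a := sInf S
      obtain ⟨u, hu, hul, hut⟩ := exists_seq_strictMono_tendsto a
      have hI : Ici a = ⋂ n, Ioi (u n) := by
        ext x
        simp only [mem_Ici, mem_iInter, mem_Ioi]
        exact ⟨fun hx n => (hul n).trans_le hx, fun hx => le_of_tendsto' hut fun n => (hx n).le⟩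
      have ht : Tendsto (ν ∘ fun n => Ioi (u n)) atTop (nhds (ν (⋂ n, Ioi (u n)))) :=
        tendsto_measure_iInter_atTop (fun i => measurableSet_Ioi.nullMeasurableSet)
          (fun i j hij => Ioi_subset_Ioi (hu.monotone hij)) ⟨0, measure_ne_top _ _⟩
      rw [← hI] at ht
      refine ge_of_tendsto' ht fun n => ?_
      refine le_trans (measure_mono ?_) (H (u n))
      exact fun x hx => (hul n).trans_le hx
    · rw [h]; exact H _
  · have : S = univ := by
      refine eq_univ_of_forall fun x => ?_
      rw [not_bddBelow_iff] at hb
      obtain ⟨z, hz, hzx⟩ := hb x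
      exact hS hzx.le hz
    rw [this]; simp

lemma lintegral_mono_st (μ ν : Measure ℝ) [IsProbabilityMeasure μ] [IsProbabilityMeasure ν]
    (H : ∀ t : ℝ, μ {s : ℝ | t < s} ≤ ν {s : ℝ | t < s}) (f : ℝ → ℝ) (hf : Monotone f)
    (h0 : ∀ y, 0 ≤ f y) :
    ∫⁻ s, ENNReal.ofReal (f s) ∂μ ≤ ∫⁻ s, ENNReal.ofReal (f s) ∂ν := by
  rw [lintegral_eq_lintegral_meas_lt μ (.of_forall h0) hf.measurable.aemeasurable,
    lintegral_eq_lintegral_meas_lt ν (.of_forall h0) hf.measurable.aemeasurable]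
  refine lintegral_mono fun t => upper_le μ ν H _ ?_
  intro a b hab ha
  exact lt_of_lt_of_le ha (hf hab)

lemma chain_prob (P : Kernel ℝ ℝ) [IsMarkovKernel P]
    (μ0 : Measure ℝ) [IsProbabilityMeasure μ0] (n : ℕ) :
    IsProbabilityMeasure (chainDist P μ0 n) := by
  induction n with
  | zero => simpa [chainDist]
  | succ n ih => simp only [chainDist]; infer_instance

lemma main_bound
    (P : Kernel ℝ ℝ) [IsMarkovKernel P]
    (μ0 : Measure ℝ) [IsProbabilityMeasure μ0]
    (ζm : Measure ℝ) [IsProbabilityMeasure ζm]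
    (hζ_int : Integrable (fun s : ℝ => s) ζm)
    (hminor : ∀ x : ℝ, ∀ t : ℝ, ζm {s : ℝ | t < s} ≤ jumpLaw P x {s : ℝ | t < s})
    (A : ℝ) (hA : 0 < A)
    (hε : 0 < ∫ s, min s A ∂ζm) (x h : ℝ) (hh : 0 < h) :
    renewalMeasure P μ0 (Set.Ioc x (x + h)) ≤
          ENNReal.ofReal ((A + h) * A / (∫ s, min s A ∂ζm) ^ 2) := by
  set ε := ∫ s, min s A ∂ζm with hεdef
  let V : ℕ → ℝ → ENNReal := fun n y => ENNReal.ofReal (lyapV ζm A h n (y - x))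
  have hVm : ∀ n, Measurable (V n) := fun n =>
    ENNReal.measurable_ofReal.comp
      ((lyapV_mono ζm hζ_int A hA hε h hh n).measurable.comp (by fun_prop))
  have hdrift : ∀ n y, V (n + 1) y + ENNReal.ofReal ε * (Set.Ioc x (x + h)).indicator 1 y ≤
      ∫⁻ z, V n z ∂(P y) := by
    intro n y
    have hm := lyapV_mono ζm hζ_int A hA hε h hh n
    have h0 := lyapV_nonneg ζm hζ_int A hA hε h hh n
    have hle := lyapV_le ζm hζ_int A hA hε h hh n
    haveI : IsProbabilityMeasure (jumpLaw P y) :=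
      Measure.isProbabilityMeasure_map (by fun_prop)
    have hi := integrable_mono_comp ζm A (y - x) _ _ hm h0 hle
    have hmm : Monotone (fun s => lyapV ζm A h n (y - x + s)) :=
      fun a b hab => hm (by linarith)
    calc V (n + 1) y + ENNReal.ofReal ε * (Set.Ioc x (x + h)).indicator 1 y
        = ENNReal.ofReal (lyapV ζm A h (n + 1) (y - x) +
            (Set.Ioc 0 h).indicator (fun _ => ε) (y - x)) := by
          rw [ENNReal.ofReal_add (lyapV_nonneg ζm hζ_int A hA hε h hh (n + 1) _)
            (Set.indicator_nonneg (fun _ _ => hε.le) _)]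
          congr 1
          by_cases hy : y ∈ Set.Ioc x (x + h)
          · rw [Set.indicator_of_mem hy, Set.indicator_of_mem]
            · simp
            · exact ⟨by linarith [hy.1], by linarith [hy.2]⟩
          · rw [Set.indicator_of_notMem hy, Set.indicator_of_notMem]
            · simp
            · exact fun hc => hy ⟨by linarith [hc.1], by linarith [hc.2]⟩
      _ ≤ ENNReal.ofReal (∫ s, lyapV ζm A h n (y - x + min s A) ∂ζm) :=
          ENNReal.ofReal_le_ofReal (lyapV_drift ζm hζ_int A hA hε h hh n (y - x))
      _ = ∫⁻ s, ENNReal.ofReal (lyapV ζm A h n (y - x + min s A)) ∂ζm :=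
          ofReal_integral_eq_lintegral_ofReal hi (.of_forall fun s => h0 _)
      _ ≤ ∫⁻ s, ENNReal.ofReal (lyapV ζm A h n (y - x + s)) ∂ζm :=
          lintegral_mono fun s => ENNReal.ofReal_le_ofReal (hmm (min_le_left _ _))
      _ ≤ ∫⁻ s, ENNReal.ofReal (lyapV ζm A h n (y - x + s)) ∂(jumpLaw P y) :=
          lintegral_mono_st _ _ (hminor y) _ hmm fun s => h0 _
      _ = ∫⁻ z, V n z ∂(P y) := by
          have hme : Measurable (fun s => ENNReal.ofReal (lyapV ζm A h n (y - x + s))) :=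
            ENNReal.measurable_ofReal.comp hmm.measurable
          rw [jumpLaw, lintegral_map hme (by fun_prop)]
          refine lintegral_congr fun z => ?_
          simp only [V]
          congr 2
          ring
  have hstep : ∀ n k, ∫⁻ y, V (n + 1) y ∂(chainDist P μ0 k) +
      ENNReal.ofReal ε * chainDist P μ0 k (Set.Ioc x (x + h)) ≤
      ∫⁻ y, V n y ∂(chainDist P μ0 (k + 1)) := by
    intro n k
    rw [chainDist, Measure.lintegral_bind P.measurable.aemeasurable (hVm n).aemeasurable]
    refine le_trans (le_of_eq ?_) (lintegral_mono (hdrift n))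
    rw [lintegral_add_left (hVm _), lintegral_const_mul _
      (measurable_one.indicator measurableSet_Ioc), lintegral_indicator_one measurableSet_Ioc]
  have hsum : ∀ N n, ENNReal.ofReal ε *
      ∑ k ∈ Finset.range N, chainDist P μ0 k (Set.Ioc x (x + h)) ≤
      ∫⁻ y, V n y ∂(chainDist P μ0 N) := by
    intro N
    induction N with
    | zero => intro n; simp
    | succ N ih =>
      intro n
      rw [Finset.sum_range_succ, mul_add]
      exact (add_le_add_left (ih (n + 1)) _).trans (hstep n N)
  have hfin : ∀ N, ∑ k ∈ Finset.range N, chainDist P μ0 k (Set.Ioc x (x + h)) ≤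
      ENNReal.ofReal ((A + h) * A / ε ^ 2) := by
    intro N
    haveI := chain_prob P μ0 N
    have h1 : ENNReal.ofReal ε * ∑ k ∈ Finset.range N, chainDist P μ0 k (Set.Ioc x (x + h)) ≤
        ENNReal.ofReal ε * ENNReal.ofReal ((A + h) * A / ε ^ 2) := by
      refine (hsum N 0).trans ?_
      calc _ ≤ ∫⁻ y, ENNReal.ofReal ((A + h) * A / ε) ∂(chainDist P μ0 N) :=
            lintegral_mono fun y => ENNReal.ofReal_le_ofReal
              (lyapV_le ζm hζ_int A hA hε h hh 0 (y - x))
        _ = ENNReal.ofReal ((A + h) * A / ε) := by simp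
        _ = _ := by
            rw [← ENNReal.ofReal_mul hε.le]
            congr 1
            field_simp
    exact (ENNReal.mul_le_mul_iff_right (by simpa using hε) ENNReal.ofReal_ne_top).1 h1
  rw [renewalMeasure, Measure.sum_apply _ measurableSet_Ioc, ENNReal.tsum_eq_iSup_nat]
  exact iSup_le hfin

/-- **Corollary.** If the family of jumps `{ξ(x), x ∈ ℝ}` possesses an integrable
stochastic minorant `ζ` with positive mean, then for any `A > 0` such that
`ε = E(ζ ∧ A) > 0`, the renewal measure satisfies `U(x, x+h] ≤ (A+h)A/ε²`
for all `x ∈ ℝ` and `h > 0`; in particular it is bounded on unit intervals. -/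
theorem renewal_measure_bound_of_minorant
    (P : Kernel ℝ ℝ) [IsMarkovKernel P]
    (μ0 : Measure ℝ) [IsProbabilityMeasure μ0]
    (ζm : Measure ℝ) [IsProbabilityMeasure ζm]
    (hζ_int : Integrable (fun s : ℝ => s) ζm)
    (hζ_mean : 0 < ∫ s, s ∂ζm)
    -- stochastic minorisation `ξ(x) ≥st ζ` for all `x`:
    (hminor : ∀ x : ℝ, ∀ t : ℝ, ζm {s : ℝ | t < s} ≤ jumpLaw P x {s : ℝ | t < s})
    (A : ℝ) (hA : 0 < A)
    (hε : 0 < ∫ s, min s A ∂ζm) :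
    (∀ x : ℝ, ∀ h : ℝ, 0 < h →
        renewalMeasure P μ0 (Set.Ioc x (x + h)) ≤
          ENNReal.ofReal ((A + h) * A / (∫ s, min s A ∂ζm) ^ 2))
      ∧ (⨆ k : ℤ, renewalMeasure P μ0 (Set.Ioc (k : ℝ) (k + 1))) < ⊤ := by
  have hb := fun x h hh => main_bound P μ0 ζm hζ_int hminor A hA hε x h hh
  refine ⟨hb, ?_⟩
  exact lt_of_le_of_lt (iSup_le fun k : ℤ => hb (k : ℝ) 1 one_pos) ENNReal.ofReal_lt_top
end
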